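/- arXiv:2510.15407 — 4 statements merged into one kernel-verified Lean document; each statement's English description precedes it below -/
import Mathlib

section
/- Let G be a plane triangulation and v a vertex of G of degree at most 4. Then for every proper 5-coloring c of the induced subgraph G − v there exists a proper 5-coloring of G whose set of vertices colored 5 is exactly the set of vertices colored 5 by c. -/
open SimpleGraph

variable {V : Type}

/-- The involution of the darts of a graph reversing each dart. -/
def dartRev (G : SimpleGraph V) : Equiv.Perm G.Dart :=
  Function.Involutive.toPerm SimpleGraph.Dart.symm SimpleGraph.Dart.symm_involutive

/-- The face permutation of a rotation system `σ`: it sends a dart `(u,v)` to `σ (v,u)`. -/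
def facePerm {G : SimpleGraph V} (σ : Equiv.Perm G.Dart) : Equiv.Perm G.Dart :=
  (dartRev G).trans σ

/-- The setoid on `α` whose classes are the orbits (cycles) of a permutation of `α`. -/
def orbitSetoid {α : Type*} (f : Equiv.Perm α) : Setoid α :=
  ⟨f.SameCycle, ⟨fun x => Equiv.Perm.SameCycle.refl f x, fun h => h.symm, fun h h' => h.trans h'⟩⟩

/-- The number of faces of a rotation system: the number of orbits of the face permutation. -/
noncomputable def numFaces {G : SimpleGraph V} (σ : Equiv.Perm G.Dart) : ℕ :=
  Nat.card (Quotient (orbitSetoid (facePerm σ)))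

/-- The number of darts in the face (orbit of the face permutation) containing the dart `d`. -/
noncomputable def faceSize {G : SimpleGraph V} (σ : Equiv.Perm G.Dart) (d : G.Dart) : ℕ :=
  Nat.card {e : G.Dart // (facePerm σ).SameCycle d e}

/-- `σ` is a rotation system on `G`: every dart and its image share their first vertex, and
the `σ`-orbit of every dart consists of all darts sharing its first vertex. -/
structure IsRotationSystem (G : SimpleGraph V) (σ : Equiv.Perm G.Dart) : Prop where
  fst_eq : ∀ d : G.Dart, (σ d).toProd.1 = d.toProd.1
  orbit_eq : ∀ d e : G.Dart, d.toProd.1 = e.toProd.1 → σ.SameCycle d e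

/-- The degree of a vertex. -/
noncomputable def deg (G : SimpleGraph V) (v : V) : ℕ := Nat.card (G.neighborSet v)

/-- A plane triangulation: a finite connected simple graph on at least 4 vertices equipped with
a rotation system satisfying Euler's formula `|V| - |E| + F = 2` in which every face consists of
exactly 3 darts. -/
structure IsPlaneTriangulation [Fintype V] (G : SimpleGraph V) (σ : Equiv.Perm G.Dart) :
    Prop where
  connected : G.Connected
  four_le_card : 4 ≤ Fintype.card V
  rot : IsRotationSystem G σ
  euler : Fintype.card V + numFaces σ = Nat.card G.edgeSet + 2
  face_size_eq : ∀ d : G.Dart, faceSize σ d = 3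

/-- A proper 5-coloring (colors `0,...,4` standing for `1,...,5`). -/
def Proper5 (G : SimpleGraph V) (c : V → Fin 5) : Prop :=
  ∀ ⦃u w : V⦄, G.Adj u w → c u ≠ c w

/-- A finite simple graph is planar if it is isomorphic to a subgraph of a plane triangulation. -/
def IsPlanar [Fintype V] (G : SimpleGraph V) : Prop :=
  ∃ (W : Type) (iW : Fintype W) (T : SimpleGraph W) (σ : Equiv.Perm T.Dart),
    @IsPlaneTriangulation W iW T σ ∧ ∃ f : G →g T, Function.Injective f

/-- `w` is the neighbor of `v` following `u` in the cyclic (counterclockwise) order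
around `v` given by the rotation system `σ`. -/
def NextNbr {G : SimpleGraph V} (σ : Equiv.Perm G.Dart) (v u w : V) : Prop :=
  ∃ h : G.Adj v u, (σ ⟨(v, u), h⟩).toProd.2 = w

/-- A minimal counterexample: a plane triangulation admitting no proper 5-coloring with some
color class of size at most `|V|/6`, while every planar graph on fewer vertices admits one. -/
def IsMinimalCounterexample [Fintype V] (G : SimpleGraph V) (σ : Equiv.Perm G.Dart) : Prop :=
  IsPlaneTriangulation G σ ∧
  (¬ ∃ c : V → Fin 5, Proper5 G c ∧
      ∃ k : Fin 5, 6 * Nat.card {v : V | c v = k} ≤ Fintype.card V) ∧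
  (∀ (W : Type) [Fintype W] (H : SimpleGraph W), IsPlanar H →
      Fintype.card W < Fintype.card V →
      ∃ c : W → Fin 5, Proper5 H c ∧
        ∃ k : Fin 5, 6 * Nat.card {w : W | c w = k} ≤ Fintype.card W)

open Classical in
lemma finrank_const_le {ι : Type} [Fintype ι] (W : Submodule (ZMod 2) (ι → ZMod 2))
    (h : ∀ f ∈ W, ∀ i j, f i = f j) : Module.finrank (ZMod 2) W ≤ 1 := by
  have hle : W ≤ Submodule.span (ZMod 2) {(fun _ => 1 : ι → ZMod 2)} := by
    intro f hf
    rw [Submodule.mem_span_singleton]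
    rcases isEmpty_or_nonempty ι with hι | ⟨⟨i⟩⟩
    · exact ⟨0, funext fun i => (hι.false i).elim⟩
    · refine ⟨f i, funext fun j => ?_⟩
      simp [h f hf i j]
  calc _ ≤ _ := Submodule.finrank_mono hle
    _ ≤ 1 := by
      have := finrank_span_le_card (R := ZMod 2) ({(fun _ => 1 : ι → ZMod 2)} : Set (ι → ZMod 2))
      simpa using this

lemma const_on_vertex {G : SimpleGraph V} {σ : Equiv.Perm G.Dart} (hr : IsRotationSystem G σ)
    {α : Type} (f : G.Dart → α) (x : V) (hf : ∀ d : G.Dart, d.fst = x → f (σ d) = f d)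
    (d e : G.Dart) (hd : d.fst = x) (he : e.fst = x) [Finite G.Dart] : f d = f e := by
  obtain ⟨n, -, hn⟩ := (hr.orbit_eq d e (hd.trans he.symm)).exists_pow_eq'
  rw [← hn]
  clear hn
  have key : ∀ n : ℕ, ((σ ^ n) d).fst = x ∧ f ((σ ^ n) d) = f d := by
    intro n
    induction n with
    | zero => simp [hd]
    | succ k ih =>
      rw [pow_succ', Equiv.Perm.mul_apply]
      exact ⟨(hr.fst_eq _).trans ih.1, (hf _ ih.1).trans ih.2⟩
  exact (key n).2.symm

lemma const_darts {G : SimpleGraph V} {σ : Equiv.Perm G.Dart} (hr : IsRotationSystem G σ)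
    (hG : G.Connected) [Finite G.Dart]
    {α : Type} (f : G.Dart → α) (hf : ∀ d, f (σ d) = f d) (hs : ∀ d, f d.symm = f d)
    (d e : G.Dart) : f d = f e := by
  have key : ∀ (x y : V) (p : G.Walk x y) (d e : G.Dart), d.fst = x → e.fst = y → f d = f e := by
    intro x y p
    induction p with
    | nil =>
      intro d e hd he
      exact const_on_vertex hr f _ (fun d _ => hf d) d e hd he
    | cons h p ih =>
      intro d e hd he
      rw [const_on_vertex hr f _ (fun d _ => hf d) d ⟨(_, _), h⟩ hd rfl, ← hs]
      exact ih _ _ rfl he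
  exact key _ _ (hG.preconnected d.fst e.fst).some d e rfl rfl

open Classical in
lemma sum_edges_eq [Fintype V] (G : SimpleGraph V) (z : G.edgeSet → ZMod 2) (u : V) :
    ∑ e : G.edgeSet, (if u ∈ e.1 then z e else 0) =
      ∑ d : G.Dart with d.fst = u, z ⟨d.edge, d.edge_mem⟩ := by
  rw [← Finset.sum_filter]
  symm
  refine Finset.sum_bij (fun d _ => ⟨d.edge, d.edge_mem⟩) ?_ ?_ ?_ ?_
  · intro d hd
    simp only [Finset.mem_filter, Finset.mem_univ, true_and] at hd ⊢
    rw [← hd]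
    obtain ⟨⟨x, y⟩, h⟩ := d
    simp [SimpleGraph.Dart.edge]
  · intro d hd e he h
    simp only [Finset.mem_filter, Finset.mem_univ, true_and] at hd he
    have h' : d.edge = e.edge := congrArg Subtype.val h
    rcases (SimpleGraph.dart_edge_eq_iff d e).1 h' with h1 | h1
    · exact h1
    · exfalso
      have h2 : e.snd = u := by rw [← hd, h1]; rfl
      exact e.adj.ne (he.trans h2.symm)
  · rintro ⟨e, he⟩ hu
    simp only [Finset.mem_filter, Finset.mem_univ, true_and] at hu
    obtain ⟨w, rfl⟩ := Sym2.mem_iff_exists.1 hu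
    exact ⟨⟨(u, w), he⟩, by simp, rfl⟩
  · intros; rfl

open Classical in
lemma exactness [Fintype V] (G : SimpleGraph V) (σ : Equiv.Perm G.Dart)
    (hT : IsPlaneTriangulation G σ) (z : G.edgeSet → ZMod 2)
    (hz : ∀ u, ∑ e : G.edgeSet, (if u ∈ e.1 then z e else 0) = 0) :
    ∃ φ : G.Dart → ZMod 2, (∀ d, φ (σ d) = φ d.symm) ∧
      ∀ d : G.Dart, φ d + φ d.symm = z ⟨d.edge, d.edge_mem⟩ := by
  let F := Quotient (orbitSetoid (facePerm σ))
  let q : G.Dart → F := fun d => Quotient.mk _ d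
  have hq : ∀ d, q (σ d) = q d.symm := by
    intro d
    refine (Quotient.sound ?_).symm
    change (facePerm σ).SameCycle d.symm (σ d)
    refine ⟨1, ?_⟩
    simp [facePerm, dartRev]
  have hout : ∀ e : G.edgeSet, ∃ d : G.Dart, d.edge = e.1 := by
    rintro ⟨e, he⟩
    induction e with
    | _ x y => exact ⟨⟨(x, y), he⟩, rfl⟩
  choose out hout using hout
  let D : (F → ZMod 2) →ₗ[ZMod 2] (G.edgeSet → ZMod 2) :=
    { toFun := fun φ e => φ (q (out e)) + φ (q (out e).symm)
      map_add' := by intro a b; ext e; simp; ring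
      map_smul' := by intro a b; ext e; simp; ring }
  have hD : ∀ φ (d : G.Dart), D φ ⟨d.edge, d.edge_mem⟩ = φ (q d) + φ (q d.symm) := by
    intro φ d
    change φ (q (out _)) + φ (q (out _).symm) = _
    rcases (SimpleGraph.dart_edge_eq_iff _ _).1 (hout ⟨d.edge, d.edge_mem⟩) with h | h
    · rw [h]
    · rw [h, SimpleGraph.Dart.symm_symm, add_comm]
  obtain ⟨M, hMe⟩ : ∃ M : Matrix V G.edgeSet (ZMod 2),
      ∀ u e, M u e = if u ∈ e.1 then 1 else 0 := ⟨fun u e => if u ∈ e.1 then 1 else 0, fun _ _ => rfl⟩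
  have hM : ∀ y u, M.mulVecLin y u = ∑ e : G.edgeSet, (if u ∈ e.1 then y e else 0) := by
    intro y u
    simp [Matrix.mulVec, dotProduct, hMe]
  have hle : LinearMap.range D ≤ LinearMap.ker M.mulVecLin := by
    rintro _ ⟨φ, rfl⟩
    rw [LinearMap.mem_ker]
    ext u
    rw [hM, sum_edges_eq]
    simp only [hD, Pi.zero_apply]
    rw [Finset.sum_add_distrib]
    have : ∑ d : G.Dart with d.fst = u, φ (q d.symm) = ∑ d : G.Dart with d.fst = u, φ (q d) := by
      refine Finset.sum_equiv σ ?_ ?_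
      · intro d
        simp only [Finset.mem_filter, Finset.mem_univ, true_and]
        rw [← hT.rot.fst_eq d]
      · intro d _
        rw [hq]
    rw [this]
    exact CharTwo.add_self_eq_zero _
  have h1 : Module.finrank (ZMod 2) (LinearMap.ker D) ≤ 1 := by
    apply finrank_const_le
    intro φ hφ i j
    rw [LinearMap.mem_ker] at hφ
    have hs : ∀ d, φ (q d.symm) = φ (q d) := by
      intro d
      have := hD φ d
      rw [hφ] at this
      exact (CharTwo.add_eq_zero.1 this.symm).symm
    induction i using Quotient.inductionOn with
    | _ d =>
    induction j using Quotient.inductionOn with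
    | _ e =>
    exact const_darts hT.rot hT.connected (fun d => φ (q d))
      (fun d => by simp only [hq, hs]) hs d e
  have h2 : Module.finrank (ZMod 2) (LinearMap.ker M.transpose.mulVecLin) ≤ 1 := by
    apply finrank_const_le
    intro f hf i j
    rw [LinearMap.mem_ker] at hf
    have hadj : ∀ x y, G.Adj x y → f x = f y := by
      intro x y h
      have := congrFun hf ⟨s(x, y), h⟩
      simp only [Matrix.mulVecLin_apply, Matrix.mulVec, dotProduct, Matrix.transpose_apply, hMe,
        Sym2.mem_iff, ite_mul, one_mul, zero_mul, Pi.zero_apply] at this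
      rw [← Finset.sum_filter] at this
      have hS : (Finset.univ.filter fun a => a = x ∨ a = y) = {x, y} := by ext; simp
      rw [hS, Finset.sum_pair h.ne] at this
      exact CharTwo.add_eq_zero.1 this
    obtain ⟨p⟩ := hT.connected.preconnected i j
    induction p with
    | nil => rfl
    | cons h p ih => exact (hadj _ _ h).trans ih
  have e1 := LinearMap.finrank_range_add_finrank_ker D
  have e2 := LinearMap.finrank_range_add_finrank_ker M.mulVecLin
  have e3 := LinearMap.finrank_range_add_finrank_ker M.transpose.mulVecLin
  have e4 : Module.finrank (ZMod 2) (LinearMap.range M.transpose.mulVecLin) =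
    Module.finrank (ZMod 2) (LinearMap.range M.mulVecLin) := Matrix.rank_transpose M
  have e5 := hT.euler
  rw [Module.finrank_pi] at e1 e2 e3
  have e6 : numFaces σ = Fintype.card F := Nat.card_eq_fintype_card
  rw [e6, Nat.card_eq_fintype_card] at e5
  have heq := Submodule.eq_of_le_of_finrank_le hle (by omega)
  have hzk : z ∈ LinearMap.ker M.mulVecLin := by
    rw [LinearMap.mem_ker]
    ext u
    rw [hM, hz]; rfl
  rw [← heq] at hzk
  obtain ⟨φ, rfl⟩ := hzk
  exact ⟨fun d => φ (q d), fun d => by simp only [hq], fun d => (hD φ d).symm⟩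

/-- Adjacency within a vertex set. -/
def relIn (G : SimpleGraph V) (P : V → Prop) (x y : V) : Prop := G.Adj x y ∧ P x ∧ P y

open Classical in
lemma chain_edge [Fintype V] (G : SimpleGraph V) {x y : V} (h : G.Adj x y) (u : V) :
    ∑ e : G.edgeSet, (if u ∈ e.1 then (Pi.single ⟨s(x, y), h⟩ 1 : G.edgeSet → ZMod 2) e else 0) =
      (Pi.single x 1 + Pi.single y 1 : V → ZMod 2) u := by
  rw [Finset.sum_eq_single ⟨s(x, y), h⟩]
  · have := h.ne
    by_cases h1 : u = x
    · subst h1; simp [this]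
    · by_cases h2 : u = y
      · subst h2; simp [h1]
      · simp [h1, h2]
  · intro b _ hb
    simp [hb]
  · simp

open Classical in
lemma chain_path [Fintype V] (G : SimpleGraph V) (P : V → Prop) {a b : V}
    (h : Relation.ReflTransGen (relIn G P) a b) :
    ∃ z : G.edgeSet → ZMod 2, (∀ e, z e ≠ 0 → ∀ x ∈ e.1, P x) ∧
      ∀ u, ∑ e : G.edgeSet, (if u ∈ e.1 then z e else 0) =
        (Pi.single a 1 + Pi.single b 1 : V → ZMod 2) u := by
  induction h with
  | refl =>
    refine ⟨0, by simp, fun u => ?_⟩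
    simp only [Pi.zero_apply, ite_self, Finset.sum_const_zero, Pi.add_apply]
    exact (CharTwo.add_self_eq_zero _).symm
  | @tail b c _ hbc ih =>
    obtain ⟨z, hz1, hz2⟩ := ih
    refine ⟨z + Pi.single ⟨s(b, c), hbc.1⟩ 1, ?_, ?_⟩
    · intro e he x hx
      by_cases h1 : e = ⟨s(b, c), hbc.1⟩
      · subst h1
        rcases Sym2.mem_iff.1 hx with rfl | rfl
        exacts [hbc.2.1, hbc.2.2]
      · exact hz1 e (by simpa [h1] using he) x hx
    · intro u
      have := chain_edge G hbc.1 u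
      have h3 := hz2 u
      simp only [Pi.add_apply] at this h3 ⊢
      have h4 : ∀ e : G.edgeSet, (if u ∈ e.1 then z e +
          (Pi.single ⟨s(b, c), hbc.1⟩ 1 : G.edgeSet → ZMod 2) e else 0) =
          (if u ∈ e.1 then z e else 0) +
          (if u ∈ e.1 then (Pi.single ⟨s(b, c), hbc.1⟩ 1 : G.edgeSet → ZMod 2) e else 0) := by
        intro e; split_ifs <;> simp
      simp only [h4, Finset.sum_add_distrib, this, h3]
      have h5 := CharTwo.add_self_eq_zero ((Pi.single b 1 : V → ZMod 2) u)
      linear_combination h5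

open Classical in
/-- Discrete Jordan curve theorem. -/
lemma jordan [Fintype V] (G : SimpleGraph V) (σ : Equiv.Perm G.Dart)
    (hT : IsPlaneTriangulation G σ) (v : V) (P Q : V → Prop) (hP : ¬ P v) (hQ : ¬ Q v)
    (hPQ : ∀ x, P x → ¬ Q x) (d₀ : G.Dart) (hd : d₀.fst = v)
    (hne : (σ (σ d₀)).snd ≠ d₀.snd)
    (Q1 : Q (σ d₀).snd) (Q3 : Q (σ (σ (σ d₀))).snd)
    (P0 : P d₀.snd) (P2 : P (σ (σ d₀)).snd)
    (h1 : Relation.ReflTransGen (relIn G P) d₀.snd (σ (σ d₀)).snd)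
    (h2 : Relation.ReflTransGen (relIn G Q) (σ d₀).snd (σ (σ (σ d₀))).snd) : False := by
  have hr := hT.rot
  have f1 : (σ d₀).fst = v := (hr.fst_eq _).trans hd
  have f2 : (σ (σ d₀)).fst = v := (hr.fst_eq _).trans f1
  have f3 : (σ (σ (σ d₀))).fst = v := (hr.fst_eq _).trans f2
  generalize hd1 : σ d₀ = d₁ at *
  generalize hd2 : σ d₁ = d₂ at *
  generalize hd3 : σ d₂ = d₃ at *
  have Pnev : ∀ x, P x → x ≠ v := fun x hx h => hP (h ▸ hx)
  have Qnev : ∀ x, Q x → x ≠ v := fun x hx h => hQ (h ▸ hx)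
  obtain ⟨z, hz1, hz2⟩ := chain_path G P h1
  have a0 : G.Adj v d₀.snd := hd ▸ d₀.adj
  have a2 : G.Adj v d₂.snd := f2 ▸ d₂.adj
  let z0 : G.edgeSet → ZMod 2 := Pi.single ⟨s(v, d₀.snd), a0⟩ 1
  let z2 : G.edgeSet → ZMod 2 := Pi.single ⟨s(v, d₂.snd), a2⟩ 1
  obtain ⟨φ, hφ1, hφ2⟩ := exactness G σ hT (fun e => z e + z0 e + z2 e) (by
    intro u
    have k0 := chain_edge G a0 u
    have k2 := chain_edge G a2 u
    have k := hz2 u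
    have h4 : ∀ e : G.edgeSet, (if u ∈ e.1 then z e + z0 e + z2 e else 0) =
          (if u ∈ e.1 then z e else 0) + (if u ∈ e.1 then z0 e else 0)
          + (if u ∈ e.1 then z2 e else 0) := by
        intro e; split_ifs <;> simp
    simp only [h4, Finset.sum_add_distrib]
    rw [k, k0, k2]
    simp only [Pi.add_apply]
    have h5 := CharTwo.add_self_eq_zero ((Pi.single v 1 : V → ZMod 2) u)
    have h6 := CharTwo.add_self_eq_zero ((Pi.single d₀.snd 1 : V → ZMod 2) u)
    have h7 := CharTwo.add_self_eq_zero ((Pi.single d₂.snd 1 : V → ZMod 2) u)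
    linear_combination h5 + h6 + h7)
  -- edges touching `Q` carry nothing
  have hzQ : ∀ d : G.Dart, Q d.fst ∨ Q d.snd → φ d = φ d.symm := by
    intro d hQd
    have hdz := hφ2 d
    have : ∃ x ∈ d.edge, Q x := by
      rcases hQd with h | h
      · exact ⟨_, by simp [SimpleGraph.Dart.edge], h⟩
      · exact ⟨_, by simp [SimpleGraph.Dart.edge], h⟩
    obtain ⟨x, hx, hQx⟩ := this
    have s1 : z ⟨d.edge, d.edge_mem⟩ = 0 := by
      by_contra h
      exact hPQ x (hz1 _ h x hx) hQx
    have s2 : ∀ (y : V) (h : G.Adj v y), P y →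
        (Pi.single ⟨s(v, y), h⟩ 1 : G.edgeSet → ZMod 2) ⟨d.edge, d.edge_mem⟩ = 0 := by
      intro y h hy
      apply Pi.single_eq_of_ne
      intro heq
      have heq := congrArg Subtype.val heq
      simp only at heq
      rw [heq] at hx
      rcases Sym2.mem_iff.1 hx with rfl | rfl
      · exact hQ hQx
      · exact hPQ _ hy hQx
    have s3 : z0 ⟨d.edge, d.edge_mem⟩ = 0 := s2 _ a0 P0
    have s4 : z2 ⟨d.edge, d.edge_mem⟩ = 0 := s2 _ a2 P2
    rw [s1, s3, s4] at hdz
    simp only [add_zero] at hdz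
    exact CharTwo.add_eq_zero.1 hdz
  have hvert : ∀ x, Q x → ∀ d e : G.Dart, d.fst = x → e.fst = x → φ d = φ e := by
    intro x hx d e hd he
    refine const_on_vertex hr φ x ?_ d e hd he
    intro d' hd'
    rw [hφ1, hzQ d' (Or.inl (hd' ▸ hx))]
  have hpath : ∀ y, Relation.ReflTransGen (relIn G Q) d₁.snd y →
      Q y ∧ ∀ e : G.Dart, e.fst = y → φ d₁.symm = φ e := by
    intro y hy
    induction hy with
    | refl => exact ⟨Q1, fun e he => hvert _ Q1 _ _ rfl he⟩
    | @tail b c _ hbc ih =>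
      refine ⟨hbc.2.2, fun e he => ?_⟩
      rw [ih.2 ⟨(b, c), hbc.1⟩ rfl, hzQ _ (Or.inl hbc.2.1)]
      exact hvert c hbc.2.2 _ _ rfl he
  have g1 := (hpath _ h2).2 d₃.symm rfl
  have g2 := hzQ d₁ (Or.inr Q1)
  have g3 := hzQ d₃ (Or.inr Q3)
  have g4 := hφ1 d₁
  have g5 := hφ1 d₂
  have g6 := hφ2 d₂
  rw [hd2] at g4
  rw [hd3] at g5
  have ed : d₂.edge = s(v, d₂.snd) := by
    rw [← f2]; rfl
  have t1 : z ⟨d₂.edge, d₂.edge_mem⟩ = 0 := by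
    by_contra h
    exact hP (hz1 _ h v (by change v ∈ d₂.edge; rw [ed]; simp))
  have t2 : z0 ⟨d₂.edge, d₂.edge_mem⟩ = 0 := by
    apply Pi.single_eq_of_ne
    intro heq
    have heq := congrArg Subtype.val heq
    simp only at heq
    rw [ed, Sym2.congr_right] at heq
    exact hne heq
  have t3 : z2 ⟨d₂.edge, d₂.edge_mem⟩ = 1 := by
    have : (⟨d₂.edge, d₂.edge_mem⟩ : G.edgeSet) = ⟨s(v, d₂.snd), a2⟩ := Subtype.ext ed
    rw [this]
    exact Pi.single_eq_same _ _
  rw [t1, t2, t3, ← g5, g4, g3, ← g1] at g6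
  rw [CharTwo.add_self_eq_zero] at g6
  simp at g6

/-- A Kempe swap. -/
lemma kempe (G : SimpleGraph V) (v : V) (cc : V → Fin 5)
    (hcc : ∀ u w, u ≠ v → w ≠ v → G.Adj u w → cc u ≠ cc w)
    (u w : V) (hu4 : cc u ≠ 4) (hw4 : cc w ≠ 4) (huw : cc u ≠ cc w) (huv : u ≠ v)
    (hu : ∀ x, G.Adj v x → cc x = cc u → x = u)
    (hw : ∀ x, G.Adj v x → cc x = cc w → x = w)
    (h : ¬ Relation.ReflTransGen
      (relIn G (fun x => x ≠ v ∧ (cc x = cc u ∨ cc x = cc w))) u w) :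
    ∃ c' : V → Fin 5, Proper5 G c' ∧ ∀ x : V, (c' x = 4 ↔ x ≠ v ∧ cc x = 4) := by
  classical
  set P : V → Prop := fun x => x ≠ v ∧ (cc x = cc u ∨ cc x = cc w) with hPdef
  set K : V → Prop := fun x => Relation.ReflTransGen (relIn G P) u x with hK
  have KP : ∀ x, K x → P x := by
    intro x hx
    rcases Relation.ReflTransGen.cases_tail hx with h | ⟨y, _, h⟩
    · rw [h]; exact ⟨huv, Or.inl rfl⟩
    · exact h.2.2
  have Kstep : ∀ x y, K x → G.Adj x y → P y → K y := fun x y hx ha hy =>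
    Relation.ReflTransGen.tail hx ⟨ha, KP x hx, hy⟩
  have Ku : K u := Relation.ReflTransGen.refl
  have Kw : ¬ K w := h
  let c' : V → Fin 5 := fun x => if x = v then cc u else
    if K x then Equiv.swap (cc u) (cc w) (cc x) else cc x
  have cv : c' v = cc u := by simp [c']
  have cK : ∀ x, x ≠ v → K x → c' x = Equiv.swap (cc u) (cc w) (cc x) := by
    intro x h1 h2; simp [c', h1, h2]
  have cN : ∀ x, x ≠ v → ¬ K x → c' x = cc x := by
    intro x h1 h2; simp [c', h1, h2]
  have hvx : ∀ x, G.Adj v x → c' x ≠ cc u := by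
    intro x hx heq
    have hxv : x ≠ v := hx.ne'
    by_cases hk : K x
    · rw [cK x hxv hk, Equiv.swap_apply_eq_iff, Equiv.swap_apply_left] at heq
      exact Kw (hw x hx heq ▸ hk)
    · rw [cN x hxv hk] at heq
      exact hk (hu x hx heq ▸ Ku)
  have hmix : ∀ x y, x ≠ v → y ≠ v → G.Adj x y → K x → ¬ K y → c' x ≠ c' y := by
    intro x y hx hy hxy kx ky heq
    rw [cK x hx kx, cN y hy ky] at heq
    apply ky
    refine Kstep x y kx hxy ⟨hy, ?_⟩
    rcases (KP x kx).2 with h | h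
    · rw [h, Equiv.swap_apply_left] at heq; exact Or.inr heq.symm
    · rw [h, Equiv.swap_apply_right] at heq; exact Or.inl heq.symm
  refine ⟨c', ?_, ?_⟩
  · intro x y hxy
    by_cases hx : x = v
    · subst hx
      rw [cv]; exact (hvx y hxy).symm
    by_cases hy : y = v
    · subst hy
      rw [cv]; exact hvx x hxy.symm
    by_cases kx : K x <;> by_cases ky : K y
    · rw [cK x hx kx, cK y hy ky]
      exact fun h => hcc x y hx hy hxy ((Equiv.swap _ _).injective h)
    · exact hmix x y hx hy hxy kx ky
    · exact (hmix y x hy hx hxy.symm ky kx).symm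
    · rw [cN x hx kx, cN y hy ky]
      exact hcc x y hx hy hxy
  · intro x
    by_cases hx : x = v
    · subst hx; simp [cv, hu4]
    · by_cases kx : K x
      · rw [cK x hx kx, Equiv.swap_apply_eq_iff,
          Equiv.swap_apply_of_ne_of_ne hu4.symm hw4.symm]
        simp [hx]
      · rw [cN x hx kx]; simp [hx]

lemma main_aux [Fintype V] (G : SimpleGraph V) (σ : Equiv.Perm G.Dart)
    (hT : IsPlaneTriangulation G σ) (v : V) (hv : deg G v ≤ 4) (cc : V → Fin 5)
    (hcc : ∀ u w, u ≠ v → w ≠ v → G.Adj u w → cc u ≠ cc w) :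
    ∃ c' : V → Fin 5, Proper5 G c' ∧ ∀ x : V, (c' x = 4 ↔ x ≠ v ∧ cc x = 4) := by
  classical
  by_cases hfree : ∃ k : Fin 5, k ≠ 4 ∧ ∀ x, G.Adj v x → cc x ≠ k
  · obtain ⟨k, hk, hx⟩ := hfree
    refine ⟨Function.update cc v k, ?_, ?_⟩
    · intro x y hxy
      by_cases h1 : x = v
      · subst h1
        rw [Function.update_self, Function.update_of_ne hxy.ne']
        exact (hx y hxy).symm
      · by_cases h2 : y = v
        · subst h2
          rw [Function.update_self, Function.update_of_ne h1]
          exact hx x hxy.symm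
        · rw [Function.update_of_ne h1, Function.update_of_ne h2]
          exact hcc x y h1 h2 hxy
    · intro x
      by_cases h1 : x = v
      · subst h1; simp [hk]
      · simp [h1]
  push Not at hfree
  have hr := hT.rot
  let s : Finset G.Dart := Finset.univ.filter fun d => d.fst = v
  let t : Finset (Fin 5) := Finset.univ.filter fun k => k ≠ 4
  have ht : t.card = 4 := by decide
  have hs : s.card ≤ 4 := by
    have : s.card ≤ (G.neighborFinset v).card := by
      refine Finset.card_le_card_of_injOn (fun d => d.snd) ?_ ?_
      · intro d hd
        have hd : d.fst = v := by simpa [s] using hd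
        simpa [← hd] using d.adj
      · intro d hd e he h
        have hd : d.fst = v := by simpa [s] using hd
        have he : e.fst = v := by simpa [s] using he
        exact SimpleGraph.Dart.ext _ _ (Prod.ext (hd.trans he.symm) h)
    refine this.trans ?_
    rw [SimpleGraph.card_neighborFinset_eq_degree, ← SimpleGraph.card_neighborSet_eq_degree]
    rwa [deg, Nat.card_eq_fintype_card] at hv
  have hsub : t ⊆ s.image (fun d => cc d.snd) := by
    intro k hk
    obtain ⟨x, hx, hxk⟩ := hfree k (by simpa [t] using hk)
    exact Finset.mem_image.2 ⟨⟨(v, x), hx⟩, by simp [s], hxk⟩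
  have hle1 := Finset.card_le_card hsub
  have hle2 := Finset.card_image_le (s := s) (f := fun d => cc d.snd)
  have hs4 : s.card = 4 := by omega
  have himg : t = s.image (fun d => cc d.snd) :=
    Finset.eq_of_subset_of_card_le hsub (by omega)
  have hinj : Set.InjOn (fun d : G.Dart => cc d.snd) s :=
    Finset.card_image_iff.1 (by omega)
  have hn4 : ∀ d ∈ s, cc d.snd ≠ 4 := by
    intro d hd
    have : cc d.snd ∈ t := by rw [himg]; exact Finset.mem_image_of_mem _ hd
    simpa [t] using this
  have hcyc : σ.IsCycleOn s := by
    refine ⟨⟨?_, σ.injective.injOn, ?_⟩, ?_⟩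
    · intro d hd
      have hd : d.fst = v := by simpa [s] using hd
      simpa [s] using (hr.fst_eq d).trans hd
    · intro d hd
      have hd : d.fst = v := by simpa [s] using hd
      refine ⟨σ.symm d, ?_, by simp⟩
      have := hr.fst_eq (σ.symm d)
      rw [Equiv.apply_symm_apply] at this
      simpa [s] using this.symm.trans hd
    · intro d hd e he
      have hd : d.fst = v := by simpa [s] using hd
      have he : e.fst = v := by simpa [s] using he
      exact hr.orbit_eq d e (hd.trans he.symm)
  obtain ⟨d₀, m0⟩ : s.Nonempty := Finset.card_pos.1 (by omega)
  have mσ : ∀ d ∈ s, σ d ∈ s := by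
    intro d hd
    exact_mod_cast hcyc.1.mapsTo hd
  have m1 := mσ _ m0
  have m2 := mσ _ m1
  have m3 := mσ _ m2
  have hne2 : ∀ d ∈ s, σ (σ d) ≠ d := by
    intro d hd h
    have := (hcyc.pow_apply_eq (n := 2) hd).1 (by simpa [pow_succ] using h)
    rw [hs4] at this
    omega
  have hfst : ∀ d ∈ s, d.fst = v := by intro d hd; simpa [s] using hd
  have hadj : ∀ d ∈ s, G.Adj v d.snd := by
    intro d hd; rw [← hfst d hd]; exact d.adj
  have huniq : ∀ d ∈ s, ∀ x, G.Adj v x → cc x = cc d.snd → x = d.snd := by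
    intro d hd x hx h
    have : (⟨(v, x), hx⟩ : G.Dart) = d := hinj (by simp [s]) hd h
    rw [← this]
  by_cases hA : Relation.ReflTransGen (relIn G (fun x => x ≠ v ∧
      (cc x = cc d₀.snd ∨ cc x = cc (σ (σ d₀)).snd))) d₀.snd (σ (σ d₀)).snd
  · by_cases hB : Relation.ReflTransGen (relIn G (fun x => x ≠ v ∧
      (cc x = cc (σ d₀).snd ∨ cc x = cc (σ (σ (σ d₀))).snd))) (σ d₀).snd (σ (σ (σ d₀))).snd
    · exfalso
      have hcne : ∀ d ∈ s, ∀ e ∈ s, d ≠ e → cc d.snd ≠ cc e.snd :=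
        fun d hd e he hde h => hde (hinj hd he h)
      have hne1 : ∀ d ∈ s, σ d ≠ d := by
        intro d hd h
        exact hne2 d hd (by rw [h, h])
      have hne3 : σ (σ (σ d₀)) ≠ d₀ := by
        intro h
        have := (hcyc.pow_apply_eq (n := 3) m0).1 (by simpa [pow_succ] using h)
        rw [hs4] at this
        omega
      have c01 := hcne _ m1 _ m0 (hne1 _ m0)
      have c12 := hcne _ m2 _ m1 (hne1 _ m1)
      have c23 := hcne _ m3 _ m2 (hne1 _ m2)
      have c03 := hcne _ m3 _ m0 hne3
      have c02 := hcne _ m2 _ m0 (hne2 _ m0)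
      refine jordan G σ hT v _ _ (fun h => h.1 rfl) (fun h => h.1 rfl) ?_ d₀ (hfst _ m0)
        (fun h => c02 (congrArg cc h)) ⟨(hadj _ m1).ne', Or.inl rfl⟩
        ⟨(hadj _ m3).ne', Or.inr rfl⟩ ⟨(hadj _ m0).ne', Or.inl rfl⟩
        ⟨(hadj _ m2).ne', Or.inr rfl⟩ hA hB
      rintro x ⟨-, h1⟩ ⟨-, h2⟩
      rcases h1 with h1 | h1 <;> rcases h2 with h2 | h2 <;> rw [h1] at h2
      exacts [c01 h2.symm, c03 h2.symm, c12 h2, c23 h2.symm]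
    · exact kempe G v cc hcc _ _ (hn4 _ m1) (hn4 _ m3)
        (fun h => hne2 _ m1 (hinj m1 m3 h).symm) (hadj _ m1).ne' (huniq _ m1) (huniq _ m3) hB
  · exact kempe G v cc hcc _ _ (hn4 _ m0) (hn4 _ m2)
        (fun h => hne2 _ m0 (hinj m0 m2 h).symm) (hadj _ m0).ne' (huniq _ m0) (huniq _ m2) hA

theorem statement1 [Fintype V] (G : SimpleGraph V) (σ : Equiv.Perm G.Dart)
    (hT : IsPlaneTriangulation G σ) (v : V) (hv : deg G v ≤ 4)
    (c : {x : V // x ≠ v} → Fin 5)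
    (hc : ∀ u w : {x : V // x ≠ v}, G.Adj u.1 w.1 → c u ≠ c w) :
    ∃ c' : V → Fin 5, Proper5 G c' ∧
      ∀ x : V, (c' x = 4 ↔ ∃ hx : x ≠ v, c ⟨x, hx⟩ = 4) := by
  classical
  let cc : V → Fin 5 := fun x => if h : x ≠ v then c ⟨x, h⟩ else 0
  have hcc : ∀ x (h : x ≠ v), cc x = c ⟨x, h⟩ := fun x h => dif_pos h
  obtain ⟨c', h1, h2⟩ := main_aux G σ hT v hv cc (by
    intro u w hu hw huw
    rw [hcc u hu, hcc w hw]
    exact hc ⟨u, hu⟩ ⟨w, hw⟩ huw)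
  refine ⟨c', h1, fun x => (h2 x).trans ⟨?_, ?_⟩⟩
  · rintro ⟨hx, h⟩
    exact ⟨hx, by rw [← hcc x hx]; exact h⟩
  · rintro ⟨hx, h⟩
    exact ⟨hx, by rw [hcc x hx]; exact h⟩
end

section
/- Let G be a plane triangulation containing six distinct vertices v1, …, v6 such that v1v2v3v4v5 is a 5-cycle in G, v6 is adjacent to all of v1, …, v5, the degree of v6 is 5, and the multiset of degrees {deg v1, …, deg v5} equals {6,6,6,7,8}. Then for every proper 5-coloring c of the induced subgraph G − {v1,…,v6} there exists a proper 5-coloring of G whose set of vertices colored 5 consists of the vertices colored 5 by c together with at most one vertex of {v1,…,v6}. -/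
open SimpleGraph

variable {V : Type}

section Homology

open Classical

variable [Fintype V] {G : SimpleGraph V}

/-- the edge of a dart, as an element of the edge set -/
def eg (d : G.Dart) : G.edgeSet := ⟨d.edge, d.edge_mem⟩

theorem eg_symm (d : G.Dart) : eg d.symm = eg d := by
  simp [eg]

theorem eg_surj (e : G.edgeSet) : ∃ d : G.Dart, eg d = e := by
  obtain ⟨e, he⟩ := e
  induction e using Sym2.ind with
  | _ x y => exact ⟨⟨(x, y), he⟩, rfl⟩

theorem eg_eq_iff (d d' : G.Dart) : eg d' = eg d ↔ d' = d ∨ d' = d.symm := by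
  simp [eg, SimpleGraph.dart_edge_eq_iff]

theorem sum_eg {M : Type*} [AddCommMonoid M] (d : G.Dart) (f : G.Dart → M) :
    (∑ d', if eg d' = eg d then f d' else 0) = f d + f d.symm := by
  rw [← Finset.sum_filter]
  have : (Finset.univ.filter fun d' : G.Dart => eg d' = eg d) = {d, d.symm} := by
    ext d'; simp [eg_eq_iff]
  rw [this, Finset.sum_pair d.symm_ne.symm]

/-- boundary map mod 2 -/
noncomputable def bd (G : SimpleGraph V) : (G.edgeSet → ZMod 2) →ₗ[ZMod 2] (V → ZMod 2) where
  toFun z v := ∑ d : G.Dart, if d.fst = v then z (eg d) else 0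
  map_add' x y := by
    funext v
    simp only [Pi.add_apply, ← Finset.sum_add_distrib]
    refine Finset.sum_congr rfl fun d _ => ?_
    split_ifs <;> simp
  map_smul' a x := by
    funext v
    simp [Finset.mul_sum]

/-- coboundary on faces mod 2 -/
noncomputable def cb (σ : Equiv.Perm G.Dart) :
    (Quotient (orbitSetoid (facePerm σ)) → ZMod 2) →ₗ[ZMod 2] (G.edgeSet → ZMod 2) where
  toFun φ e := ∑ d : G.Dart, if eg d = e then φ (Quotient.mk _ d) else 0
  map_add' x y := by
    funext v
    simp only [Pi.add_apply, ← Finset.sum_add_distrib]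
    refine Finset.sum_congr rfl fun d _ => ?_
    split_ifs <;> simp
  map_smul' a x := by
    funext v
    simp [Finset.mul_sum]

theorem cb_eg (σ : Equiv.Perm G.Dart) (φ) (d : G.Dart) :
    cb σ φ (eg d) = φ (Quotient.mk _ d) + φ (Quotient.mk _ d.symm) := by
  simp only [cb, LinearMap.coe_mk, AddHom.coe_mk]
  exact sum_eg d (fun d' => φ (Quotient.mk _ d'))

theorem face_symm (σ : Equiv.Perm G.Dart) (d : G.Dart) :
    (Quotient.mk (orbitSetoid (facePerm σ)) (σ d)) = Quotient.mk _ d.symm := by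
  apply Quotient.sound
  change (facePerm σ).SameCycle (σ d) d.symm
  have : σ d = facePerm σ d.symm := by
    simp [facePerm, dartRev]
  rw [this]
  exact (Equiv.Perm.sameCycle_apply_left).2 (Equiv.Perm.SameCycle.refl _ _)

theorem bd_single (d : G.Dart) :
    bd G (Pi.single (eg d) 1) = Pi.single d.fst 1 + Pi.single d.snd 1 := by
  funext v
  have h := sum_eg d (fun d' => if d'.fst = v then (1 : ZMod 2) else 0)
  simp only [bd, LinearMap.coe_mk, AddHom.coe_mk, Pi.add_apply]
  rw [show (Pi.single d.fst (1 : ZMod 2) : V → ZMod 2) v + (Pi.single d.snd (1 : ZMod 2) : V → ZMod 2) v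
    = (if d.fst = v then 1 else 0) + (if d.symm.fst = v then 1 else 0) by
      simp [Pi.single_apply, eq_comm], ← h]
  refine Finset.sum_congr rfl fun d' _ => ?_
  simp only [Pi.single_apply]
  split_ifs <;> rfl

theorem bd_cb {σ : Equiv.Perm G.Dart} (hr : IsRotationSystem G σ) (φ) : bd G (cb σ φ) = 0 := by
  funext v
  simp only [bd, LinearMap.coe_mk, AddHom.coe_mk, Pi.zero_apply]
  have h1 : ∀ d : G.Dart, (if d.fst = v then cb σ φ (eg d) else 0) =
      (if d.fst = v then φ (Quotient.mk _ d) else 0) +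
      (if (σ d).fst = v then φ (Quotient.mk _ (σ d)) else 0) := by
    intro d
    have := hr.fst_eq d
    rw [this, cb_eg, face_symm]
    split_ifs <;> simp
  rw [Finset.sum_congr rfl fun d _ => h1 d, Finset.sum_add_distrib,
    Equiv.sum_comp σ (fun d => if d.fst = v then φ (Quotient.mk _ d) else 0)]
  exact CharTwo.add_self_eq_zero _

theorem const_vertex {σ : Equiv.Perm G.Dart} (hr : IsRotationSystem G σ) (f : G.Dart → ZMod 2)
    (v : V) (h : ∀ d : G.Dart, d.fst = v → f (σ d) = f d) (d e : G.Dart) (hd : d.fst = v)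
    (he : e.fst = v) : f d = f e := by
  obtain ⟨n, hn⟩ := (hr.orbit_eq d e (hd.trans he.symm)).exists_nat_pow_eq
  have key : ∀ n : ℕ, ((σ ^ n) d).fst = v ∧ f ((σ ^ n) d) = f d := by
    intro n
    induction n with
    | zero => simp [hd]
    | succ k ih =>
      rw [pow_succ', Equiv.Perm.mul_apply]
      exact ⟨(hr.fst_eq _).trans ih.1, (h _ ih.1).trans ih.2⟩
  rw [← hn]
  exact (key n).2.symm

theorem ker_cb {σ : Equiv.Perm G.Dart} (hr : IsRotationSystem G σ) (hc : G.Connected) :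
    Module.finrank (ZMod 2) (LinearMap.ker (cb σ)) ≤ 1 := by
  by_cases hne : Nonempty G.Dart
  swap
  · have : IsEmpty (Quotient (orbitSetoid (facePerm σ))) :=
      ⟨fun q => hne ⟨q.out⟩⟩
    have := Submodule.finrank_le (LinearMap.ker (cb σ))
    rw [Module.finrank_fintype_fun_eq_card, Fintype.card_eq_zero] at this
    omega
  obtain ⟨d0⟩ := hne
  have hle : LinearMap.ker (cb σ) ≤ Submodule.span (ZMod 2) {fun _ => (1 : ZMod 2)} := by
    intro φ hφ
    rw [LinearMap.mem_ker] at hφ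
    have h1 : ∀ d : G.Dart, φ (Quotient.mk _ d.symm) = φ (Quotient.mk _ d) := by
      intro d
      have := congrFun hφ (eg d)
      rw [cb_eg] at this
      exact (CharTwo.add_eq_zero.1 this).symm
    have h2 : ∀ v (d e : G.Dart), d.fst = v → e.fst = v →
        φ (Quotient.mk _ d) = φ (Quotient.mk _ e) := by
      intro v d e hd he
      refine const_vertex hr (fun d => φ (Quotient.mk _ d)) v ?_ d e hd he
      intro d _
      rw [face_symm, h1]
    have h3 : ∀ u, Relation.ReflTransGen G.Adj d0.fst u → ∀ e : G.Dart, e.fst = u →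
        φ (Quotient.mk _ e) = φ (Quotient.mk _ d0) := by
      intro u hu
      induction hu with
      | refl => intro e he; exact h2 _ _ _ he rfl
      | @tail x y _ hxy ih =>
        intro e he
        rw [← ih ⟨(x, y), hxy⟩ rfl, ← h1 ⟨(x, y), hxy⟩]
        exact h2 y _ _ he rfl
    rw [Submodule.mem_span_singleton]
    refine ⟨φ (Quotient.mk _ d0), ?_⟩
    funext q
    induction q using Quotient.ind with
    | _ e =>
      have := h3 e.fst ((SimpleGraph.reachable_iff_reflTransGen _ _).1 (hc.preconnected _ _)) e rfl
      simp [this]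
  exact (Submodule.finrank_mono hle).trans ((finrank_span_le_card _).trans (by simp))

theorem range_bd (hc : G.Connected) :
    Fintype.card V ≤ Module.finrank (ZMod 2) (LinearMap.range (bd G)) + 1 := by
  obtain ⟨v0⟩ := hc.nonempty
  let s : Submodule (ZMod 2) (V → ZMod 2) := Submodule.span (ZMod 2) {Pi.single v0 1}
  have htop : LinearMap.range (bd G) ⊔ s = ⊤ := by
    rw [eq_top_iff]
    have h3 : ∀ u, Relation.ReflTransGen G.Adj v0 u →
        (Pi.single u 1 : V → ZMod 2) ∈ LinearMap.range (bd G) ⊔ s := by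
      intro u hu
      induction hu with
      | refl => exact Submodule.mem_sup_right (Submodule.mem_span_singleton_self _)
      | @tail x y _ hxy ih =>
        have := bd_single (G := G) ⟨(x, y), hxy⟩
        have h4 : (Pi.single y 1 : V → ZMod 2) = bd G (Pi.single (eg ⟨(x, y), hxy⟩) 1)
            + Pi.single x 1 := by
          rw [this]
          funext t
          have := CharTwo.add_self_eq_zero ((Pi.single x 1 : V → ZMod 2) t)
          simp only [Pi.add_apply]
          linear_combination -this
        rw [h4]
        exact Submodule.add_mem _ (Submodule.mem_sup_left ⟨_, rfl⟩) ih
    intro f _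
    rw [pi_eq_sum_univ' f]
    refine Submodule.sum_mem _ fun u _ => Submodule.smul_mem _ _ ?_
    have := h3 u ((SimpleGraph.reachable_iff_reflTransGen _ _).1 (hc.preconnected _ _))
    convert this using 1
  have h1 := Submodule.finrank_add_le_finrank_add_finrank (LinearMap.range (bd G)) s
  rw [htop, finrank_top, Module.finrank_fintype_fun_eq_card] at h1
  have h2 : Module.finrank (ZMod 2) s ≤ 1 := (finrank_span_le_card _).trans (by simp)
  omega

theorem exact_seq {σ : Equiv.Perm G.Dart} (hT : IsPlaneTriangulation G σ) :
    LinearMap.range (cb σ) = LinearMap.ker (bd G) := by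
  apply Submodule.eq_of_le_of_finrank_le
  · rintro _ ⟨φ, rfl⟩
    exact bd_cb hT.rot φ
  · have h1 := LinearMap.finrank_range_add_finrank_ker (cb σ)
    have h2 := LinearMap.finrank_range_add_finrank_ker (bd G)
    have h3 := ker_cb hT.rot hT.connected
    have h4 := range_bd hT.connected
    have h5 := hT.euler
    rw [numFaces] at h5
    rw [Module.finrank_fintype_fun_eq_card] at h1 h2
    rw [Nat.card_eq_fintype_card, Nat.card_eq_fintype_card] at h5
    omega

theorem chain_exists {A : Set V} {a c : V}
    (h : Relation.ReflTransGen (fun x y => x ∈ A ∧ y ∈ A ∧ G.Adj x y) a c) :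
    ∃ z, bd G z = Pi.single a 1 + Pi.single c 1 ∧
      ∀ d : G.Dart, z (eg d) ≠ 0 → d.fst ∈ A := by
  induction h with
  | refl =>
    refine ⟨0, ?_, by simp⟩
    funext t
    simpa using (CharTwo.add_self_eq_zero _).symm
  | @tail x y _ hxy ih =>
    obtain ⟨z, hz, hA⟩ := ih
    obtain ⟨hx, hy, hxy⟩ := hxy
    refine ⟨z + Pi.single (eg ⟨(x, y), hxy⟩) 1, ?_, ?_⟩
    · rw [map_add, hz, bd_single]
      funext t
      have := CharTwo.add_self_eq_zero ((Pi.single x 1 : V → ZMod 2) t)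
      simp only [Pi.add_apply]
      linear_combination this
    · intro d hd
      by_cases hz0 : z (eg d) = 0
      · simp only [Pi.add_apply, hz0, zero_add, Pi.single_apply] at hd
        have : eg d = eg ⟨(x, y), hxy⟩ := by
          by_contra hh
          simp [hh] at hd
        rcases (eg_eq_iff _ _).1 this with rfl | rfl
        · exact hx
        · exact hy
      · exact hA d hz0

/-- The discrete Jordan curve lemma. -/
theorem jordan_s2 {σ : Equiv.Perm G.Dart} (hT : IsPlaneTriangulation G σ) {v : V} {A B : Set V}
    (hAB : Disjoint A B) (hvA : v ∉ A) (hvB : v ∉ B) (da db dc dd : G.Dart)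
    (hda : da.fst = v) (j k l n : ℕ) (hj : 0 < j) (hjk : j < k) (hkl : k < l) (hln : l < n)
    (hinj : ∀ i i', i < n → i' < n → (σ ^ i) da = (σ ^ i') da → i = i')
    (hdb : (σ ^ j) da = db) (hdc : (σ ^ k) da = dc) (hdd : (σ ^ l) da = dd)
    (haA : da.snd ∈ A) (hcA : dc.snd ∈ A) (hbB : db.snd ∈ B) (hdB : dd.snd ∈ B)
    (hac : Relation.ReflTransGen (fun x y => x ∈ A ∧ y ∈ A ∧ G.Adj x y) da.snd dc.snd)
    (hbd : Relation.ReflTransGen (fun x y => x ∈ B ∧ y ∈ B ∧ G.Adj x y) db.snd dd.snd) :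
    False := by
  have hfst : ∀ i : ℕ, ((σ ^ i) da).fst = v := by
    intro i
    induction i with
    | zero => simpa using hda
    | succ m ih =>
      rw [pow_succ', Equiv.Perm.mul_apply]
      exact (hT.rot.fst_eq _).trans ih
  have hb1 : db.fst = v := hdb ▸ hfst j
  have hc1 : dc.fst = v := hdc ▸ hfst k
  have hd1 : dd.fst = v := hdd ▸ hfst l
  obtain ⟨z, hz, hzA⟩ := chain_exists hac
  let Z := z + Pi.single (eg da) 1 + Pi.single (eg dc) 1
  have hZ : bd G Z = 0 := by
    simp only [Z, map_add, hz, bd_single, hda, hc1]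
    funext t
    have h1 := CharTwo.add_self_eq_zero ((Pi.single da.snd 1 : V → ZMod 2) t)
    have h2 := CharTwo.add_self_eq_zero ((Pi.single dc.snd 1 : V → ZMod 2) t)
    have h3 := CharTwo.add_self_eq_zero ((Pi.single v 1 : V → ZMod 2) t)
    simp only [Pi.add_apply, Pi.zero_apply]
    linear_combination h1 + h2 + h3
  have hZ' : Z ∈ LinearMap.range (cb σ) := by
    rw [exact_seq hT]; exact hZ
  obtain ⟨φ, hφ⟩ := hZ'
  have hne : da ≠ dc := by
    intro h
    have := hinj 0 k (by omega) (by omega) (by simpa [hdc] using h)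
    omega
  -- values of Z
  have hzv : ∀ d : G.Dart, d.fst = v → z (eg d) = 0 := by
    intro d hd
    by_contra h
    exact hvA (hd ▸ hzA d h)
  have hsame : ∀ d e : G.Dart, d.fst = v → e.fst = v → eg d = eg e → d = e := by
    intro d e hd he h
    rcases (eg_eq_iff _ _).1 h with h | h
    · exact h
    · exfalso
      rw [h] at hd
      exact e.fst_ne_snd (he.trans hd.symm)
  have hstep : ∀ d : G.Dart, φ (Quotient.mk _ (σ d)) = φ (Quotient.mk _ d) + Z (eg d) := by
    intro d
    rw [face_symm, ← hφ, cb_eg]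
    have := CharTwo.add_self_eq_zero (φ (Quotient.mk _ d))
    linear_combination -this
  have hZv : ∀ d : G.Dart, d.fst = v → d ≠ da → d ≠ dc → Z (eg d) = 0 := by
    intro d hd h1 h2
    have e1 : eg d ≠ eg da := fun h => h1 (hsame _ _ hd hda h)
    have e2 : eg d ≠ eg dc := fun h => h2 (hsame _ _ hd hc1 h)
    simp [Z, hzv d hd, Pi.single_apply, e1, e2]
  have hZc : Z (eg dc) = 1 := by
    have e1 : eg dc ≠ eg da := fun h => hne (hsame _ _ hc1 hda h).symm
    simp [Z, hzv dc hc1, Pi.single_apply, e1]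
  have hBv : ∀ d : G.Dart, Z (eg d) ≠ 0 → d.fst ∉ B := by
    intro d hd hB
    have hdA : d.fst ∉ A := fun h => Set.disjoint_left.1 hAB h hB
    have hz0 : z (eg d) = 0 := by
      by_contra h
      exact hdA (hzA d h)
    have e1 : eg d ≠ eg da := by
      intro h
      rcases (eg_eq_iff _ _).1 h with rfl | rfl
      · exact hvB (hda ▸ hB)
      · exact hdA haA
    have e2 : eg d ≠ eg dc := by
      intro h
      rcases (eg_eq_iff _ _).1 h with rfl | rfl
      · exact hvB (hc1 ▸ hB)
      · exact hdA hcA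
    apply hd
    simp [Z, hz0, Pi.single_apply, e1, e2]
  have hB0 : ∀ d : G.Dart, d.fst ∈ B → Z (eg d) = 0 := by
    intro d hd
    by_contra h
    exact hBv d h hd
  have hBeq : ∀ d : G.Dart, d.fst ∈ B → φ (Quotient.mk _ d.symm) = φ (Quotient.mk _ d) := by
    intro d hd
    rw [← face_symm, hstep, hB0 d hd, add_zero]
  have hBc : ∀ x ∈ B, ∀ d e : G.Dart, d.fst = x → e.fst = x →
      φ (Quotient.mk _ d) = φ (Quotient.mk _ e) := by
    intro x hx d e hd he
    refine const_vertex hT.rot (fun d => φ (Quotient.mk _ d)) x ?_ d e hd he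
    intro d hd
    rw [hstep, hB0 d (hd ▸ hx), add_zero]
  have hBpath : ∀ y, Relation.ReflTransGen (fun x y => x ∈ B ∧ y ∈ B ∧ G.Adj x y) db.snd y →
      ∀ e : G.Dart, e.fst = y → φ (Quotient.mk _ e) = φ (Quotient.mk _ db.symm) := by
    intro y hy
    induction hy with
    | refl => intro e he; exact hBc _ hbB _ _ he rfl
    | @tail x y _ hxy ih =>
      obtain ⟨hx, hy, hxy⟩ := hxy
      intro e he
      rw [← ih ⟨(x, y), hxy⟩ rfl, ← hBeq ⟨(x, y), hxy⟩ hx]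
      exact hBc y hy _ _ he rfl
  have hfin : φ (Quotient.mk _ dd) = φ (Quotient.mk _ db) := by
    have h1 := hBpath _ hbd dd.symm rfl
    have h2 := hBeq dd.symm hdB
    have h3 := hBeq db.symm hbB
    rw [SimpleGraph.Dart.symm_symm] at h2 h3
    rw [h2, h1, h3]
  -- go around v
  have hgo : ∀ i i', 0 < i → i ≤ i' → i' ≤ n → (∀ m, i ≤ m → m < i' → m ≠ k) →
      φ (Quotient.mk _ ((σ ^ i') da)) = φ (Quotient.mk _ ((σ ^ i) da)) := by
    intro i i' hi hii
    induction i', hii using Nat.le_induction with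
    | base => intros; rfl
    | succ m hm ih =>
      intro hn hk
      rw [← ih (by omega) (fun t h1 h2 => hk t h1 (by omega)), pow_succ', Equiv.Perm.mul_apply,
        hstep, hZv _ (hfst m), add_zero]
      · intro h
        have := hinj m 0 (by omega) (by omega) (by simpa using h)
        omega
      · intro h
        have := hinj m k (by omega) (by omega) (h.trans hdc.symm)
        exact hk m hm (by omega) this
  have g1 := hgo j k hj hjk.le (by omega) (fun m _ h => by omega)
  have g2 := hgo (k + 1) l (by omega) (by omega) (by omega) (fun m h _ => by omega)
  rw [pow_succ', Equiv.Perm.mul_apply, hstep, hdc, hdd, hZc] at g2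
  rw [hdb, hdc] at g1
  rw [hfin, g1] at g2
  simp at g2

end Homology

section Kempe

open Classical

variable [Fintype V] {G : SimpleGraph V}

/-- `c` is proper on the vertex set `S`. -/
def ProperOn (G : SimpleGraph V) (S : Set V) (c : V → Fin 5) : Prop :=
  ∀ u ∈ S, ∀ w ∈ S, G.Adj u w → c u ≠ c w

/-- `c` can be modified to a colouring of `S ∪ {v}`, keeping the class of colour 4. -/
def Extends (G : SimpleGraph V) (S : Set V) (c : V → Fin 5) (v : V) : Prop :=
  ∃ c' : V → Fin 5, ProperOn G (insert v S) c' ∧ c' v ≠ 4 ∧ ∀ x ∈ S, (c' x = 4 ↔ c x = 4)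

/-- The Kempe relation for colours `p`, `q`. -/
def KSet (S : Set V) (c : V → Fin 5) (p q : Fin 5) : Set V := {x | x ∈ S ∧ (c x = p ∨ c x = q)}

/-- One step in a Kempe chain. -/
def KRel (G : SimpleGraph V) (A : Set V) (x y : V) : Prop := x ∈ A ∧ y ∈ A ∧ G.Adj x y

theorem extends_free {S : Set V} {c : V → Fin 5} {v : V} (hv : v ∉ S) (hc : ProperOn G S c)
    (p : Fin 5) (hp : p ≠ 4) (h : ∀ w ∈ S, G.Adj v w → c w ≠ p) : Extends G S c v := by
  have hne : ∀ x ∈ S, x ≠ v := fun x hx h => hv (h ▸ hx)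
  refine ⟨fun x => if x = v then p else c x, ?_, by simpa using hp, ?_⟩
  · intro u hu w hw huw
    rcases hu with rfl | hu <;> rcases hw with rfl | hw
    · exact absurd huw (G.loopless.irrefl _)
    · simpa [hne w hw] using (h w hw huw).symm
    · simpa [hne u hu] using h u hu huw.symm
    · simpa [hne u hu, hne w hw] using hc u hu w hw huw
  · intro x hx
    simp [hne x hx]

theorem extends_swap {S : Set V} {c : V → Fin 5} {v : V} (hv : v ∉ S) (hc : ProperOn G S c)
    (p q : Fin 5) (hp : p ≠ 4) (hq : q ≠ 4) (hpq : p ≠ q) (a b : V)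
    (haS : a ∈ S) (ha : c a = p)
    (hua : ∀ w ∈ S, G.Adj v w → c w = p → w = a)
    (hub : ∀ w ∈ S, G.Adj v w → c w = q → w = b)
    (hnr : ¬ Relation.ReflTransGen (KRel G (KSet S c p q)) a b) : Extends G S c v := by
  let K : Set V := {x | Relation.ReflTransGen (KRel G (KSet S c p q)) a x}
  have haK : a ∈ K := Relation.ReflTransGen.refl
  have hK : ∀ x ∈ K, x ∈ KSet S c p q := by
    intro x hx
    rcases Relation.ReflTransGen.cases_tail hx with h | ⟨y, _, h⟩
    · rw [h]; exact ⟨haS, Or.inl ha⟩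
    · exact h.2.1
  have hcl : ∀ x ∈ K, ∀ y ∈ S, G.Adj x y → (c y = p ∨ c y = q) → y ∈ K := by
    intro x hx y hy hxy hcy
    exact Relation.ReflTransGen.tail hx ⟨hK x hx, ⟨hy, hcy⟩, hxy⟩
  let c1 : V → Fin 5 := fun x => if x ∈ K then Equiv.swap p q (c x) else c x
  have h4 : ∀ x ∈ S, (c1 x = 4 ↔ c x = 4) := by
    intro x hx
    simp only [c1]
    split_ifs with h
    · rcases (hK x h).2 with h' | h' <;> simp [h', hp, hq]
    · rfl
  have hc1 : ProperOn G S c1 := by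
    intro u hu w hw huw
    have := hc u hu w hw huw
    simp only [c1]
    split_ifs with h1 h2 h2
    · simpa using this
    · have hw' : ¬ (c w = p ∨ c w = q) := fun h => h2 (hcl u h1 w hw huw h)
      rcases (hK u h1).2 with h' | h' <;> simp only [h', Equiv.swap_apply_left,
        Equiv.swap_apply_right] <;> tauto
    · have hw' : ¬ (c u = p ∨ c u = q) := fun h => h1 (hcl w h2 u hu huw.symm h)
      rcases (hK w h2).2 with h' | h' <;> simp only [h', Equiv.swap_apply_left,
        Equiv.swap_apply_right] <;> tauto
    · exact this
  obtain ⟨c', h1, h2, h3⟩ := extends_free (c := c1) hv hc1 p hp (by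
    intro w hw hvw
    simp only [c1]
    split_ifs with h
    · rcases (hK w h).2 with h' | h'
      · simp [h', hpq.symm]
      · exact absurd ((hub w hw hvw h') ▸ h) hnr
    · intro h'
      exact h ((hua w hw hvw h') ▸ haK))
  exact ⟨c', h1, h2, fun x hx => (h3 x hx).trans (h4 x hx)⟩

theorem extends_four {σ : Equiv.Perm G.Dart} (hT : IsPlaneTriangulation G σ)
    {S : Set V} {c : V → Fin 5} {v : V} (hv : v ∉ S) (hc : ProperOn G S c)
    (dt : Fin 4 → G.Dart) (hfst : ∀ i, (dt i).fst = v) (hS : ∀ i, (dt i).snd ∈ S)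
    (hcol : ∀ i, c (dt i).snd = i.castSucc)
    (hu : ∀ (i : Fin 4), ∀ w ∈ S, G.Adj v w → c w = i.castSucc → w = (dt i).snd)
    (n : ℕ) (hinj : ∀ i i', i < n → i' < n → (σ ^ i) (dt 0) = (σ ^ i') (dt 0) → i = i')
    (p q r : Fin 4) (hp0 : p ≠ 0) (hq0 : q ≠ 0) (hr0 : r ≠ 0)
    (hpq : p ≠ q) (hpr : p ≠ r) (hqr : q ≠ r)
    (j k l : ℕ) (hj : 0 < j) (hjk : j < k) (hkl : k < l) (hln : l < n)
    (hdb : (σ ^ j) (dt 0) = dt p) (hdc : (σ ^ k) (dt 0) = dt q) (hdd : (σ ^ l) (dt 0) = dt r) :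
    Extends G S c v := by
  have h4 : ∀ i : Fin 4, i.castSucc ≠ 4 := by decide
  have hinj' : ∀ i i' : Fin 4, i ≠ i' → i.castSucc ≠ i'.castSucc := by decide
  by_cases h1 : Relation.ReflTransGen (KRel G (KSet S c (0 : Fin 4).castSucc q.castSucc))
      (dt 0).snd (dt q).snd
  swap
  · exact extends_swap hv hc _ _ (h4 0) (h4 q) (hinj' _ _ hq0.symm) _ _ (hS 0) (hcol 0)
      (hu 0) (hu q) h1
  by_cases h2 : Relation.ReflTransGen (KRel G (KSet S c p.castSucc r.castSucc))
      (dt p).snd (dt r).snd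
  swap
  · exact extends_swap hv hc _ _ (h4 p) (h4 r) (hinj' _ _ hpr) _ _ (hS p) (hcol p)
      (hu p) (hu r) h2
  exfalso
  refine jordan_s2 hT (v := v) (A := KSet S c (0 : Fin 4).castSucc q.castSucc)
    (B := KSet S c p.castSucc r.castSucc) ?_ (fun h => hv h.1) (fun h => hv h.1)
    (dt 0) (dt p) (dt q) (dt r) (hfst 0) j k l n hj hjk hkl hln hinj hdb hdc hdd
    ⟨hS 0, Or.inl (hcol 0)⟩ ⟨hS q, Or.inr (hcol q)⟩ ⟨hS p, Or.inl (hcol p)⟩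
    ⟨hS r, Or.inr (hcol r)⟩ h1 h2
  rw [Set.disjoint_left]
  rintro x ⟨_, hx⟩ ⟨_, hx'⟩
  rcases hx with hx | hx <;> rcases hx' with hx' | hx' <;> rw [hx] at hx'
  · exact hinj' _ _ hp0.symm hx'
  · exact hinj' _ _ hr0.symm hx'
  · exact hinj' _ _ hpq.symm hx'
  · exact hinj' _ _ hqr hx'

theorem extends_le_four {σ : Equiv.Perm G.Dart} (hT : IsPlaneTriangulation G σ)
    {S : Set V} {c : V → Fin 5} {v : V} (hv : v ∉ S) (hc : ProperOn G S c)
    (hcard : (Finset.univ.filter fun w => G.Adj v w ∧ w ∈ S ∧ c w ≠ 4).card ≤ 4) :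
    Extends G S c v := by
  by_cases hex : ∃ p : Fin 4, ∀ w ∈ S, G.Adj v w → c w ≠ p.castSucc
  · obtain ⟨p, hp⟩ := hex
    exact extends_free hv hc p.castSucc ((show ∀ i : Fin 4, i.castSucc ≠ 4 by decide) p) hp
  push Not at hex
  choose f hfS hfv hfc using hex
  have h4 : ∀ i : Fin 4, i.castSucc ≠ 4 := by decide
  have hfi : Function.Injective f := by
    intro i j h
    have : i.castSucc = j.castSucc := by rw [← hfc i, ← hfc j, h]
    exact Fin.castSucc_injective _ this
  have himg : Finset.univ.image f = (Finset.univ.filter fun w => G.Adj v w ∧ w ∈ S ∧ c w ≠ 4) := by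
    apply Finset.eq_of_subset_of_card_le
    · intro w hw
      simp only [Finset.mem_image, Finset.mem_univ, true_and] at hw
      obtain ⟨i, rfl⟩ := hw
      simp [hfv, hfS, hfc, h4]
    · rw [Finset.card_image_of_injective _ hfi]
      simpa using hcard
  have hu : ∀ (i : Fin 4), ∀ w ∈ S, G.Adj v w → c w = i.castSucc → w = f i := by
    intro i w hw hvw hcw
    have : w ∈ Finset.univ.image f := by
      rw [himg]; simp [hw, hvw, hcw, h4]
    simp only [Finset.mem_image, Finset.mem_univ, true_and] at this
    obtain ⟨j, rfl⟩ := this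
    rw [hfc] at hcw
    rw [Fin.castSucc_injective _ hcw]
  let dt : Fin 4 → G.Dart := fun i => ⟨(v, f i), hfv i⟩
  have hdti : ∀ i j, dt i = dt j → i = j := by
    intro i j h
    apply hfi
    exact congrArg (fun d : G.Dart => d.snd) h
  have hpos : ∀ i, ∃ m, m < Function.minimalPeriod σ (dt 0) ∧ (σ ^ m) (dt 0) = dt i := by
    intro i
    have hsc : σ.SameCycle (dt 0) (dt i) := hT.rot.orbit_eq _ _ rfl
    obtain ⟨m, h⟩ := hsc.exists_nat_pow_eq
    refine ⟨m % Function.minimalPeriod σ (dt 0), Nat.mod_lt _ ?_, ?_⟩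
    · apply Function.minimalPeriod_pos_of_mem_periodicPts
      exact Function.mem_periodicPts.2 ⟨orderOf σ, orderOf_pos σ, by
        rw [Function.IsPeriodicPt, Function.IsFixedPt, Equiv.Perm.iterate_eq_pow,
          pow_orderOf_eq_one, Equiv.Perm.one_apply]⟩
    · rw [← h, ← Equiv.Perm.iterate_eq_pow, ← Equiv.Perm.iterate_eq_pow,
        Function.iterate_mod_minimalPeriod_eq]
  have hinj : ∀ i i', i < Function.minimalPeriod σ (dt 0) → i' < Function.minimalPeriod σ (dt 0) →
      (σ ^ i) (dt 0) = (σ ^ i') (dt 0) → i = i' := by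
    intro i i' hi hi' h
    rw [← Equiv.Perm.iterate_eq_pow, ← Equiv.Perm.iterate_eq_pow] at h
    exact Function.iterate_injOn_Iio_minimalPeriod hi hi' h
  obtain ⟨m1, hm1, e1⟩ := hpos 1
  obtain ⟨m2, hm2, e2⟩ := hpos 2
  obtain ⟨m3, hm3, e3⟩ := hpos 3
  have z1 : 0 < m1 := Nat.pos_of_ne_zero fun h => by
    subst h; exact absurd (hdti 0 1 (by simpa using e1)) (by decide)
  have z2 : 0 < m2 := Nat.pos_of_ne_zero fun h => by
    subst h; exact absurd (hdti 0 2 (by simpa using e2)) (by decide)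
  have z3 : 0 < m3 := Nat.pos_of_ne_zero fun h => by
    subst h; exact absurd (hdti 0 3 (by simpa using e3)) (by decide)
  have n12 : m1 ≠ m2 := fun h => by
    subst h; exact absurd (hdti 1 2 (e1.symm.trans e2)) (by decide)
  have n13 : m1 ≠ m3 := fun h => by
    subst h; exact absurd (hdti 1 3 (e1.symm.trans e3)) (by decide)
  have n23 : m2 ≠ m3 := fun h => by
    subst h; exact absurd (hdti 2 3 (e2.symm.trans e3)) (by decide)
  have key := fun p q r a1 a2 a3 a4 a5 a6 j k l b1 b2 b3 b4 b5 b6 b7 =>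
    extends_four hT hv hc dt (fun _ => rfl) hfS hfc hu _ hinj p q r a1 a2 a3 a4 a5 a6
      j k l b1 b2 b3 b4 b5 b6 b7
  rcases lt_or_gt_of_ne n12 with l12 | l12 <;> rcases lt_or_gt_of_ne n13 with l13 | l13 <;>
    rcases lt_or_gt_of_ne n23 with l23 | l23
  · exact key 1 2 3 (by decide) (by decide) (by decide) (by decide) (by decide) (by decide)
      m1 m2 m3 z1 l12 l23 hm3 e1 e2 e3
  · exact key 1 3 2 (by decide) (by decide) (by decide) (by decide) (by decide) (by decide)
      m1 m3 m2 z1 l13 l23 hm2 e1 e3 e2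
  · omega
  · exact key 3 1 2 (by decide) (by decide) (by decide) (by decide) (by decide) (by decide)
      m3 m1 m2 z3 l13 l12 hm2 e3 e1 e2
  · exact key 2 1 3 (by decide) (by decide) (by decide) (by decide) (by decide) (by decide)
      m2 m1 m3 z2 l12 l13 hm3 e2 e1 e3
  · omega
  · exact key 2 3 1 (by decide) (by decide) (by decide) (by decide) (by decide) (by decide)
      m2 m3 m1 z2 l23 l13 hm1 e2 e3 e1
  · exact key 3 2 1 (by decide) (by decide) (by decide) (by decide) (by decide) (by decide)
      m3 m2 m1 z3 l23 l12 hm1 e3 e2 e1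

theorem extends_step {σ : Equiv.Perm G.Dart} (hT : IsPlaneTriangulation G σ)
    {S : Set V} {c : V → Fin 5} {v : V} (hv : v ∉ S) (hc : ProperOn G S c)
    (T : Finset V) (hTadj : ∀ t ∈ T, G.Adj v t) (hT4 : ∀ t ∈ T, t ∉ S ∨ c t = 4)
    (hd : deg G v ≤ 4 + T.card) : Extends G S c v := by
  apply extends_le_four hT hv hc
  have h1 : (Finset.univ.filter fun w => G.Adj v w ∧ w ∈ S ∧ c w ≠ 4) ⊆
      (Finset.univ.filter fun w => G.Adj v w) \ T := by
    intro w hw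
    simp only [Finset.mem_filter, Finset.mem_univ, true_and, Finset.mem_sdiff] at hw ⊢
    refine ⟨hw.1, fun h => ?_⟩
    rcases hT4 w h with h | h
    · exact h hw.2.1
    · exact hw.2.2 h
  have h2 := Finset.card_le_card h1
  rw [Finset.card_sdiff_of_subset (by intro t ht; simpa using hTadj t ht)] at h2
  have h3 : deg G v = (Finset.univ.filter fun w => G.Adj v w).card := by
    rw [deg, Nat.card_eq_fintype_card, Fintype.card_subtype]
    rfl
  omega

end Kempe

section Config

open Classical

variable [Fintype V] {G : SimpleGraph V}

/-- Intermediate states: the vertices of `L` have been coloured in addition to `S0`. -/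
def St (G : SimpleGraph V) (S0 : Set V) (c0 : V → Fin 5) (L : Set V) : Prop :=
  ∃ c : V → Fin 5, ProperOn G (L ∪ S0) c ∧ (∀ x ∈ S0, (c x = 4 ↔ c0 x = 4)) ∧ ∀ x ∈ L, c x ≠ 4

/-- `w` has an outer neighbour of colour 4. -/
def Has5 (G : SimpleGraph V) (O : Set V) (c0 : V → Fin 5) (w : V) : Prop :=
  ∃ o ∈ O, G.Adj w o ∧ c0 o = 4

/-- The degree of `w`, less one if it has an outer neighbour of colour 4, is at most `k`. -/
def EX (G : SimpleGraph V) (O : Set V) (c0 : V → Fin 5) (w : V) (k : ℕ) : Prop :=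
  deg G w ≤ k ∨ (deg G w ≤ k + 1 ∧ Has5 G O c0 w)

/-- `t` does not count when colouring. -/
def Skip (S0 L : Set V) (c0 : V → Fin 5) (t : V) : Prop :=
  (t ∉ L ∧ t ∉ S0) ∨ (t ∉ L ∧ c0 t = 4)

theorem st_step {σ : Equiv.Perm G.Dart} (hT : IsPlaneTriangulation G σ) {O S0 L : Set V}
    {c0 : V → Fin 5} (hOL : ∀ x ∈ L, x ∉ O) (h : St G S0 c0 L) (v : V)
    (hvL : v ∉ L) (hvS : v ∉ S0) (T : Finset V) (hTO : ∀ t ∈ T, t ∉ O)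
    (hadj : ∀ t ∈ T, G.Adj v t) (hsk : ∀ t ∈ T, Skip S0 L c0 t) (hE : EX G O c0 v (4 + T.card)) :
    St G S0 c0 (insert v L) := by
  obtain ⟨c, h1, h2, h3⟩ := h
  have hT4 : ∀ t, Skip S0 L c0 t → t ∉ L ∪ S0 ∨ c t = 4 := by
    rintro t (⟨a, b⟩ | ⟨a, b⟩)
    · left; rintro (h | h)
      · exact a h
      · exact b h
    · by_cases hS : t ∈ S0
      · right; exact (h2 t hS).2 b
      · left; rintro (h | h)
        · exact a h
        · exact hS h
  have hv : v ∉ L ∪ S0 := by rintro (h | h); exacts [hvL h, hvS h]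
  have key : Extends G (L ∪ S0) c v := by
    rcases hE with hE | ⟨hE, o, ho, hvo, ho4⟩
    · exact extends_step hT hv h1 T hadj (fun t ht => hT4 t (hsk t ht)) hE
    · refine extends_step hT hv h1 (insert o T) ?_ ?_ ?_
      · intro t ht
        rcases Finset.mem_insert.1 ht with rfl | ht
        · exact hvo
        · exact hadj t ht
      · intro t ht
        rcases Finset.mem_insert.1 ht with rfl | ht
        · exact hT4 _ (Or.inr ⟨fun h => hOL _ h ho, ho4⟩)
        · exact hT4 t (hsk t ht)
      · rw [Finset.card_insert_of_notMem (fun h => hTO o h ho)]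
        omega
  obtain ⟨c', g1, g2, g3⟩ := key
  refine ⟨c', ?_, ?_, ?_⟩
  · rw [Set.insert_union]; exact g1
  · intro x hx
    exact (g3 x (Or.inr hx)).trans (h2 x hx)
  · rintro x (rfl | hx)
    · exact g2
    · rw [Ne, g3 x (Or.inl hx)]
      exact h3 x hx

/-- The configuration: hub `h`, rim `x, a, b, c, d` in cyclic order. -/
structure Conf (G : SimpleGraph V) (O : Set V) (c0 : V → Fin 5) (h x y1 y2 y3 y4 : V) : Prop where
  nd : List.Nodup [h, x, y1, y2, y3, y4]
  x1 : G.Adj x y1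
  a12 : G.Adj y1 y2
  a23 : G.Adj y2 y3
  a34 : G.Adj y3 y4
  a4x : G.Adj y4 x
  hx : G.Adj h x
  h1 : G.Adj h y1
  h2 : G.Adj h y2
  h3 : G.Adj h y3
  h4 : G.Adj h y4
  hO : ∀ z, z ∉ O ↔ (z = h ∨ z = x ∨ z = y1 ∨ z = y2 ∨ z = y3 ∨ z = y4)
  c4 : ∀ z, z ∉ O → c0 z = 4
  pr : ProperOn G O c0
  dh : deg G h ≤ 5
  hub : ∀ z, G.Adj h z → z ∉ O

theorem Conf.rot {O : Set V} {c0 : V → Fin 5} {h x y1 y2 y3 y4 : V}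
    (C : Conf G O c0 h x y1 y2 y3 y4) : Conf G O c0 h y1 y2 y3 y4 x := by
  obtain ⟨nd, x1, a12, a23, a34, a4x, hx, h1, h2, h3, h4, hO, c4, pr, dh, hub⟩ := C
  refine ⟨?_, a12, a23, a34, a4x, x1, h1, h2, h3, h4, hx, ?_, c4, pr, dh, hub⟩
  · simp only [List.nodup_cons, List.mem_cons, List.not_mem_nil] at nd ⊢
    grind
  · intro z; rw [hO z]; tauto

theorem Conf.refl {O : Set V} {c0 : V → Fin 5} {h x y1 y2 y3 y4 : V}
    (C : Conf G O c0 h x y1 y2 y3 y4) : Conf G O c0 h x y4 y3 y2 y1 := by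
  obtain ⟨nd, x1, a12, a23, a34, a4x, hx, h1, h2, h3, h4, hO, c4, pr, dh, hub⟩ := C
  refine ⟨?_, a4x.symm, a34.symm, a23.symm, a12.symm, x1.symm, hx, h4, h3, h2, h1, ?_, c4, pr, dh,
    hub⟩
  · simp only [List.nodup_cons, List.mem_cons, List.not_mem_nil] at nd ⊢
    grind
  · intro z; rw [hO z]; tauto

/-- The conclusion. -/
def Goal (G : SimpleGraph V) (O : Set V) (c0 : V → Fin 5) : Prop :=
  ∃ c' : V → Fin 5, Proper5 G c' ∧ (∀ o ∈ O, (c' o = 4 ↔ c0 o = 4)) ∧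
    {x | x ∉ O ∧ c' x = 4}.Subsingleton

theorem St.start {O : Set V} {c0 : V → Fin 5} (pr : ProperOn G O c0) (x : V) (hx : c0 x = 4)
    (hno : ¬ Has5 G O c0 x) : St G (insert x O) c0 ∅ := by
  refine ⟨c0, ?_, fun _ _ => Iff.rfl, by simp⟩
  rw [Set.empty_union]
  have h : ∀ w ∈ O, G.Adj x w → c0 w ≠ 4 := fun w hw hxw h4 => hno ⟨w, hw, hxw, h4⟩
  rintro u (rfl | hu) w (rfl | hw) huw
  · exact absurd huw (G.loopless.irrefl _)
  · rw [hx]; exact (h w hw huw).symm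
  · rw [hx]; exact h u hu huw.symm
  · exact pr u hu w hw huw

theorem St.finish {O L : Set V} {c0 : V → Fin 5} (x : V)
    (h : St G (insert x O) c0 L) (hL : ∀ z, z ∉ O → z = x ∨ z ∈ L) : Goal G O c0 := by
  obtain ⟨c, h1, h2, h3⟩ := h
  have hall : ∀ z, z ∈ L ∪ insert x O := by
    intro z
    by_cases hz : z ∈ O
    · exact Or.inr (Or.inr hz)
    · rcases hL z hz with rfl | hz
      · exact Or.inr (Or.inl rfl)
      · exact Or.inl hz
  refine ⟨c, fun u w huw => h1 u (hall u) w (hall w) huw, fun o ho => h2 o (Or.inr ho), ?_⟩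
  have key : ∀ z, z ∉ O → c z = 4 → z = x := by
    intro z hz hc
    rcases hL z hz with h | h
    · exact h
    · exact absurd hc (h3 z h)
  rintro a ⟨ha, ha'⟩ b ⟨hb, hb'⟩
  rw [key a ha ha', key b hb hb']

theorem path_case {σ : Equiv.Perm G.Dart} (hT : IsPlaneTriangulation G σ) {O : Set V}
    {c0 : V → Fin 5} {h x y1 y2 y3 y4 : V} (C : Conf G O c0 h x y1 y2 y3 y4)
    (hno : ¬ Has5 G O c0 x) (e3 : EX G O c0 y3 6) (e4 : EX G O c0 y4 6)
    (e12 : (EX G O c0 y1 7 ∧ EX G O c0 y2 6) ∨ (EX G O c0 y1 6 ∧ EX G O c0 y2 7)) :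
    Goal G O c0 := by
  obtain ⟨nd, x1, a12, a23, a34, a4x, hx, h1, h2, h3, h4, hO, c4, pr, dh, hub⟩ := C
  simp only [List.nodup_cons, List.mem_cons, List.not_mem_nil, not_or, not_false_eq_true,
    and_true, List.nodup_nil] at nd
  obtain ⟨⟨n1, n2, n3, n4, n5⟩, ⟨n6, n7, n8, n9⟩, ⟨n10, n11, n12⟩, ⟨n13, n14⟩, n15⟩ := nd
  have oh : h ∉ O := (hO h).2 (by simp)
  have ox : x ∉ O := (hO x).2 (by simp)
  have o1 : y1 ∉ O := (hO y1).2 (by simp)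
  have o2 : y2 ∉ O := (hO y2).2 (by simp)
  have o3 : y3 ∉ O := (hO y3).2 (by simp)
  have o4 : y4 ∉ O := (hO y4).2 (by simp)
  have x1' := x1.symm
  have a12' := a12.symm
  have a23' := a23.symm
  have a34' := a34.symm
  have a4x' := a4x.symm
  have hx' := hx.symm
  have h1' := h1.symm
  have h2' := h2.symm
  have h3' := h3.symm
  have h4' := h4.symm
  have cx := c4 x ox
  have s0 := St.start pr x cx hno
  have s12 : ∃ L : Set V, (∀ z, z ∈ L ↔ z = y1 ∨ z = y2) ∧ St G (insert x O) c0 L := by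
    rcases e12 with ⟨e1, e2⟩ | ⟨e1, e2⟩
    · have s1 := st_step (O := O) hT (by grind) s0 y1 (by grind) (by grind) {h, x, y2} (by grind)
        (by grind) (by grind [Skip]) (by rwa [Finset.card_eq_three.2 ⟨h, x, y2, by grind⟩])
      have s2 := st_step (O := O) hT (by grind) s1 y2 (by grind) (by grind) {h, y3} (by grind)
        (by grind) (by grind [Skip]) (by rwa [Finset.card_pair (by grind)])
      exact ⟨_, by grind, s2⟩
    · have s1 := st_step (O := O) hT (by grind) s0 y2 (by grind) (by grind) {h, y1, y3} (by grind)
        (by grind) (by grind [Skip]) (by rwa [Finset.card_eq_three.2 ⟨h, y1, y3, by grind⟩])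
      have s2 := st_step (O := O) hT (by grind) s1 y1 (by grind) (by grind) {h, x} (by grind)
        (by grind) (by grind [Skip]) (by rwa [Finset.card_pair (by grind)])
      exact ⟨_, by grind, s2⟩
  obtain ⟨L, hL, s2⟩ := s12
  have s3 := st_step (O := O) hT (by grind) s2 y3 (by grind) (by grind) {h, y4} (by grind)
    (by grind) (by grind [Skip]) (by rwa [Finset.card_pair (by grind)])
  have s4 := st_step (O := O) hT (by grind) s3 y4 (by grind) (by grind) {h, x} (by grind)
    (by grind) (by grind [Skip]) (by rwa [Finset.card_pair (by grind)])
  have eh : EX G O c0 h 5 := Or.inl dh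
  have s5 := st_step (O := O) hT (by grind) s4 h (by grind) (by grind) {x} (by grind)
    (by grind) (by grind [Skip]) (by rwa [Finset.card_singleton])
  exact s5.finish x (by grind)

theorem all_case {σ : Equiv.Perm G.Dart} (hT : IsPlaneTriangulation G σ) {O : Set V}
    {c0 : V → Fin 5} {h x y1 y2 y3 y4 : V} (C : Conf G O c0 h x y1 y2 y3 y4)
    (ex : EX G O c0 x 7) (e1 : EX G O c0 y1 6) (e2 : EX G O c0 y2 6) (e3 : EX G O c0 y3 6)
    (e4 : EX G O c0 y4 5) : Goal G O c0 := by
  obtain ⟨nd, x1, a12, a23, a34, a4x, hx, h1, h2, h3, h4, hO, c4, pr, dh, hub⟩ := C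
  simp only [List.nodup_cons, List.mem_cons, List.not_mem_nil, not_or, not_false_eq_true,
    and_true, List.nodup_nil] at nd
  obtain ⟨⟨n1, n2, n3, n4, n5⟩, ⟨n6, n7, n8, n9⟩, ⟨n10, n11, n12⟩, ⟨n13, n14⟩, n15⟩ := nd
  have oh : h ∉ O := (hO h).2 (by simp)
  have ox : x ∉ O := (hO x).2 (by simp)
  have o1 : y1 ∉ O := (hO y1).2 (by simp)
  have o2 : y2 ∉ O := (hO y2).2 (by simp)
  have o3 : y3 ∉ O := (hO y3).2 (by simp)
  have o4 : y4 ∉ O := (hO y4).2 (by simp)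
  have x1' := x1.symm
  have a12' := a12.symm
  have a23' := a23.symm
  have a34' := a34.symm
  have a4x' := a4x.symm
  have hx' := hx.symm
  have h1' := h1.symm
  have h2' := h2.symm
  have h3' := h3.symm
  have h4' := h4.symm
  have ch := c4 h oh
  have s0 := St.start pr h ch (by rintro ⟨o, ho, hho, _⟩; exact hub o hho ho)
  have s1 := st_step (O := O) hT (by grind) s0 x (by grind) (by grind) {h, y1, y4} (by grind)
    (by grind) (by grind [Skip]) (by rwa [Finset.card_eq_three.2 ⟨h, y1, y4, by grind⟩])
  have s2 := st_step (O := O) hT (by grind) s1 y1 (by grind) (by grind) {h, y2} (by grind)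
    (by grind) (by grind [Skip]) (by rwa [Finset.card_pair (by grind)])
  have s3 := st_step (O := O) hT (by grind) s2 y2 (by grind) (by grind) {h, y3} (by grind)
    (by grind) (by grind [Skip]) (by rwa [Finset.card_pair (by grind)])
  have s4 := st_step (O := O) hT (by grind) s3 y3 (by grind) (by grind) {h, y4} (by grind)
    (by grind) (by grind [Skip]) (by rwa [Finset.card_pair (by grind)])
  have s5 := st_step (O := O) hT (by grind) s4 y4 (by grind) (by grind) {h} (by grind)
    (by grind) (by
      intro t ht
      obtain rfl := Finset.mem_singleton.1 ht
      refine Or.inr ⟨?_, ch⟩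
      simp [n1, n2, n3, n4, n5]) (by rwa [Finset.card_singleton])
  exact s5.finish h (by grind)

/-- The degree-8 vertex is `x`; the degree-7 vertex is among the others and not `y4`. -/
theorem conf_main {σ : Equiv.Perm G.Dart} (hT : IsPlaneTriangulation G σ) {O : Set V}
    {c0 : V → Fin 5} {h x y1 y2 y3 y4 : V} (C : Conf G O c0 h x y1 y2 y3 y4)
    (dx : deg G x = 8)
    (d : (deg G y1 = 7 ∧ deg G y2 = 6) ∨ (deg G y1 = 6 ∧ deg G y2 = 7))
    (d3 : deg G y3 = 6) (d4 : deg G y4 = 6) : Goal G O c0 := by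
  have e3 : EX G O c0 y3 6 := Or.inl d3.le
  have e4 : EX G O c0 y4 6 := Or.inl d4.le
  by_cases hx : Has5 G O c0 x
  swap
  · refine path_case hT C hx e3 e4 ?_
    rcases d with ⟨a, b⟩ | ⟨a, b⟩
    · exact Or.inl ⟨Or.inl a.le, Or.inl b.le⟩
    · exact Or.inr ⟨Or.inl a.le, Or.inl b.le⟩
  have ex : EX G O c0 x 7 := Or.inr ⟨by omega, hx⟩
  by_cases h1 : Has5 G O c0 y1
  · by_cases h2 : Has5 G O c0 y2
    · have e1 : EX G O c0 y1 6 := Or.inr ⟨by omega, h1⟩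
      have e2 : EX G O c0 y2 6 := Or.inr ⟨by omega, h2⟩
      by_cases h3 : Has5 G O c0 y3
      · by_cases h4 : Has5 G O c0 y4
        · exact all_case hT C ex e1 e2 e3 (Or.inr ⟨by omega, h4⟩)
        · exact path_case hT C.rot.rot.rot.rot h4 e2 e3 (Or.inl ⟨ex, e1⟩)
      · exact path_case hT C.rot.rot.rot h3 e1 e2 (Or.inr ⟨e4, ex⟩)
    · have e1 : EX G O c0 y1 6 := Or.inr ⟨by omega, h1⟩
      exact path_case hT C.rot.rot.refl h2 e4 e3 (Or.inr ⟨e1, ex⟩)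
  · rcases d with ⟨a, b⟩ | ⟨a, b⟩
    · exact path_case hT C.rot.refl h1 e3 (Or.inl b.le) (Or.inl ⟨ex, e4⟩)
    · by_cases h2 : Has5 G O c0 y2
      · exact path_case hT C.rot.refl h1 e3 (Or.inr ⟨by omega, h2⟩) (Or.inl ⟨ex, e4⟩)
      · exact path_case hT C.rot.rot.refl h2 e4 e3 (Or.inr ⟨Or.inl a.le, ex⟩)

/-- The degree-8 vertex is `x`. -/
theorem conf_main' {σ : Equiv.Perm G.Dart} (hT : IsPlaneTriangulation G σ) {O : Set V}
    {c0 : V → Fin 5} {h x y1 y2 y3 y4 : V} (C : Conf G O c0 h x y1 y2 y3 y4)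
    (dx : deg G x = 8)
    (d : ({deg G y1, deg G y2, deg G y3, deg G y4} : Multiset ℕ) = {6, 6, 6, 7}) :
    Goal G O c0 := by
  have m7 : 7 ∈ ({deg G y1, deg G y2, deg G y3, deg G y4} : Multiset ℕ) := by rw [d]; decide
  have key : ∀ a b c e : ℕ, ({a, b, c, e} : Multiset ℕ) = {6, 6, 6, 7} →
      (a = 7 ∧ b = 6 ∧ c = 6 ∧ e = 6) ∨ (a = 6 ∧ b = 7 ∧ c = 6 ∧ e = 6) ∨
      (a = 6 ∧ b = 6 ∧ c = 7 ∧ e = 6) ∨ (a = 6 ∧ b = 6 ∧ c = 6 ∧ e = 7) := by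
    intro a b c e h
    have hs := congrArg Multiset.sum h
    have hm : ∀ x ∈ ({a, b, c, e} : Multiset ℕ), x = 6 ∨ x = 7 := by
      rw [h]; decide
    have ha := hm a (by simp)
    have hb := hm b (by simp)
    have hc := hm c (by simp)
    have he := hm e (by simp)
    simp at hs
    omega
  rcases key _ _ _ _ d with ⟨a, b, c, e⟩ | ⟨a, b, c, e⟩ | ⟨a, b, c, e⟩ | ⟨a, b, c, e⟩
  · exact conf_main hT C dx (Or.inl ⟨a, b⟩) c e
  · exact conf_main hT C dx (Or.inr ⟨a, b⟩) c e
  · exact conf_main hT C.refl dx (Or.inr ⟨e, c⟩) b a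
  · exact conf_main hT C.refl dx (Or.inl ⟨e, c⟩) b a

theorem conf_final {σ : Equiv.Perm G.Dart} (hT : IsPlaneTriangulation G σ) {O : Set V}
    {c0 : V → Fin 5} {h w1 w2 w3 w4 w5 : V} (C : Conf G O c0 h w1 w2 w3 w4 w5)
    (d : ({deg G w1, deg G w2, deg G w3, deg G w4, deg G w5} : Multiset ℕ) = {6, 6, 6, 7, 8}) :
    Goal G O c0 := by
  have m8 : 8 ∈ ({deg G w1, deg G w2, deg G w3, deg G w4, deg G w5} : Multiset ℕ) := by
    rw [d]; decide
  have key : ∀ a b c e f : ℕ, a = 8 → ({a, b, c, e, f} : Multiset ℕ) = {6, 6, 6, 7, 8} →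
      ({b, c, e, f} : Multiset ℕ) = {6, 6, 6, 7} := by
    intro a b c e f ha h
    subst ha
    have : ({6, 6, 6, 7, 8} : Multiset ℕ) = 8 ::ₘ {6, 6, 6, 7} := by decide
    rw [this] at h
    exact (Multiset.cons_inj_right 8).1 h
  have rot : ∀ a b c e f : ℕ, ({a, b, c, e, f} : Multiset ℕ) = {b, c, e, f, a} := by
    intro a b c e f
    simp only [Multiset.insert_eq_cons, ← Multiset.singleton_add]
    abel
  have d2 := (rot _ _ _ _ _).symm.trans d
  have d3 := (rot _ _ _ _ _).symm.trans d2
  have d4 := (rot _ _ _ _ _).symm.trans d3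
  have d5 := (rot _ _ _ _ _).symm.trans d4
  simp only [Multiset.insert_eq_cons, Multiset.mem_cons, Multiset.mem_singleton] at m8
  rcases m8 with m | m | m | m | m
  · exact conf_main' hT C m.symm (key _ _ _ _ _ m.symm d)
  · exact conf_main' hT C.rot m.symm (key _ _ _ _ _ m.symm d2)
  · exact conf_main' hT C.rot.rot m.symm (key _ _ _ _ _ m.symm d3)
  · exact conf_main' hT C.rot.rot.rot m.symm (key _ _ _ _ _ m.symm d4)
  · exact conf_main' hT C.rot.rot.rot.rot m.symm (key _ _ _ _ _ m.symm d5)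

theorem hub_closed {h w1 w2 w3 w4 w5 : V} (nd : List.Nodup [w1, w2, w3, w4, w5])
    (h1 : G.Adj h w1) (h2 : G.Adj h w2) (h3 : G.Adj h w3) (h4 : G.Adj h w4) (h5 : G.Adj h w5)
    (hd : deg G h = 5) (z : V) (hz : G.Adj h z) : z ∈ [w1, w2, w3, w4, w5] := by
  have h6 : deg G h = (Finset.univ.filter fun w => G.Adj h w).card := by
    rw [deg, Nat.card_eq_fintype_card, Fintype.card_subtype]
    rfl
  have h7 : [w1, w2, w3, w4, w5].toFinset = Finset.univ.filter fun w => G.Adj h w := by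
    apply Finset.eq_of_subset_of_card_le
    · intro t ht
      simp only [List.mem_toFinset, List.mem_cons, List.not_mem_nil, or_false] at ht
      simp only [Finset.mem_filter, Finset.mem_univ, true_and]
      rcases ht with rfl | rfl | rfl | rfl | rfl <;> assumption
    · rw [List.toFinset_card_of_nodup nd, ← h6, hd]
      rfl
  rw [← List.mem_toFinset, h7]
  simpa using hz

end Config

theorem statement2 [Fintype V] (G : SimpleGraph V) (σ : Equiv.Perm G.Dart)
    (hT : IsPlaneTriangulation G σ) (v1 v2 v3 v4 v5 v6 : V)
    (hdistinct : List.Nodup [v1, v2, v3, v4, v5, v6])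
    (h12 : G.Adj v1 v2) (h23 : G.Adj v2 v3) (h34 : G.Adj v3 v4)
    (h45 : G.Adj v4 v5) (h51 : G.Adj v5 v1)
    (h61 : G.Adj v6 v1) (h62 : G.Adj v6 v2) (h63 : G.Adj v6 v3)
    (h64 : G.Adj v6 v4) (h65 : G.Adj v6 v5)
    (hdeg6 : deg G v6 = 5)
    (hdegs : ({deg G v1, deg G v2, deg G v3, deg G v4, deg G v5} : Multiset ℕ) = {6, 6, 6, 7, 8})
    (c : {x : V // x ∉ ({v1, v2, v3, v4, v5, v6} : Set V)} → Fin 5)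
    (hc : ∀ u w : {x : V // x ∉ ({v1, v2, v3, v4, v5, v6} : Set V)}, G.Adj u.1 w.1 → c u ≠ c w) :
    ∃ c' : V → Fin 5, Proper5 G c' ∧
      (∀ (x : V) (hx : x ∉ ({v1, v2, v3, v4, v5, v6} : Set V)), (c' x = 4 ↔ c ⟨x, hx⟩ = 4)) ∧
      ({x : V | x ∈ ({v1, v2, v3, v4, v5, v6} : Set V) ∧ c' x = 4} : Set V).Subsingleton := by
  classical
  let O : Set V := {x | x ∉ ({v1, v2, v3, v4, v5, v6} : Set V)}
  let c0 : V → Fin 5 := fun x =>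
    if hx : x ∉ ({v1, v2, v3, v4, v5, v6} : Set V) then c ⟨x, hx⟩ else 4
  have hO : ∀ z, z ∉ O ↔ (z = v6 ∨ z = v1 ∨ z = v2 ∨ z = v3 ∨ z = v4 ∨ z = v5) := by
    intro z
    simp only [O, Set.mem_setOf_eq, not_not, Set.mem_insert_iff, Set.mem_singleton_iff]
    tauto
  have hc0 : ∀ x (hx : x ∉ ({v1, v2, v3, v4, v5, v6} : Set V)), c0 x = c ⟨x, hx⟩ := by
    intro x hx
    exact dif_pos hx
  have C : Conf G O c0 v6 v1 v2 v3 v4 v5 := by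
    refine ⟨?_, h12, h23, h34, h45, h51, h61, h62, h63, h64, h65, hO, ?_, ?_, hdeg6.le, ?_⟩
    · simp only [List.nodup_cons, List.mem_cons, List.not_mem_nil] at hdistinct ⊢
      grind
    · intro z hz
      exact dif_neg hz
    · intro u hu w hw huw
      rw [hc0 u hu, hc0 w hw]
      exact hc ⟨u, hu⟩ ⟨w, hw⟩ huw
    · intro z hz
      have nd : List.Nodup [v1, v2, v3, v4, v5] := by
        simp only [List.nodup_cons, List.mem_cons, List.not_mem_nil] at hdistinct ⊢
        grind
      have := hub_closed nd h61 h62 h63 h64 h65 hdeg6 z hz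
      rw [hO]
      simp only [List.mem_cons, List.not_mem_nil, or_false] at this
      exact Or.inr this
  obtain ⟨c', g1, g2, g3⟩ := conf_final hT C hdegs
  refine ⟨c', g1, ?_, ?_⟩
  · intro x hx
    rw [g2 x hx, hc0 x hx]
  · intro a ha b hb
    exact g3 ⟨fun h => h ha.1, ha.2⟩ ⟨fun h => h hb.1, hb.2⟩
end

section
/- Let G be a plane triangulation containing six distinct vertices v1, …, v6 such that v2, v3, v4, v5, v6 are all neighbors of v1, deg v1 = 7, deg v2 = 8, deg v3 = deg v4 = deg v5 = deg v6 = 5, and v3 and v4 are both adjacent to v2. Then for every proper 5-coloring c of the induced subgraph G − {v1,…,v6} there exists a proper 5-coloring of G whose set of vertices colored 5 consists of the vertices colored 5 by c together with at most one vertex of {v1,…,v6}. -/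
open SimpleGraph

variable {V : Type}

section Homology

open Classical in
/-- The mod 2 boundary map from edge functions to vertex functions. -/
noncomputable def bd1 [Fintype V] (G : SimpleGraph V) :
    (G.edgeSet → ZMod 2) →ₗ[ZMod 2] (V → ZMod 2) where
  toFun h := fun u => ∑ d : G.Dart, if d.fst = u then h ⟨d.edge, d.edge_mem⟩ else 0
  map_add' h h' := by
    funext u
    simp only [Pi.add_apply, ← Finset.sum_add_distrib]
    refine Finset.sum_congr rfl fun d _ => ?_
    split_ifs <;> simp
  map_smul' a h := by
    funext u
    simp only [Pi.smul_apply, smul_eq_mul, Finset.mul_sum, RingHom.id_apply]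
    refine Finset.sum_congr rfl fun d _ => ?_
    split_ifs <;> simp

open Classical in
theorem bd1_single [Fintype V] (G : SimpleGraph V) (d : G.Dart) :
    bd1 G (Pi.single ⟨d.edge, d.edge_mem⟩ 1) = Pi.single d.fst 1 + Pi.single d.snd 1 := by
  funext u
  have key : ∀ d' : G.Dart,
      (if d'.fst = u then (Pi.single (⟨d.edge, d.edge_mem⟩ : G.edgeSet) (1 : ZMod 2) :
        G.edgeSet → ZMod 2) ⟨d'.edge, d'.edge_mem⟩ else 0)
      = (if d' = d then (if d.fst = u then (1 : ZMod 2) else 0) else 0)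
        + (if d' = d.symm then (if d.snd = u then (1 : ZMod 2) else 0) else 0) := by
    intro d'
    have h1 : (d'.edge = d.edge) ↔ (d' = d ∨ d' = d.symm) := SimpleGraph.dart_edge_eq_iff d' d
    have h2 : d.symm ≠ d := SimpleGraph.Dart.symm_ne d
    simp only [Pi.single_apply, Subtype.mk.injEq, h1]
    by_cases e1 : d' = d
    · subst e1; simp [h2.symm]
    · by_cases e2 : d' = d.symm
      · subst e2
        simp [h2]
      · simp [e1, e2]
  have : bd1 G (Pi.single ⟨d.edge, d.edge_mem⟩ 1) u = ∑ d' : G.Dart,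
      (if d'.fst = u then (Pi.single (⟨d.edge, d.edge_mem⟩ : G.edgeSet) (1 : ZMod 2) :
        G.edgeSet → ZMod 2) ⟨d'.edge, d'.edge_mem⟩ else 0) := rfl
  rw [this, Finset.sum_congr rfl fun d' _ => key d', Finset.sum_add_distrib]
  simp [Pi.single_apply, eq_comm]

abbrev Faces {G : SimpleGraph V} (σ : Equiv.Perm G.Dart) := Quotient (orbitSetoid (facePerm σ))

def faceOf {G : SimpleGraph V} (σ : Equiv.Perm G.Dart) (d : G.Dart) : Faces σ :=
  Quotient.mk (orbitSetoid (facePerm σ)) d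

theorem faceOf_symm {G : SimpleGraph V} (σ : Equiv.Perm G.Dart) (d : G.Dart) :
    faceOf σ d.symm = faceOf σ (σ d) := by
  apply Quotient.sound
  change (facePerm σ).SameCycle d.symm (σ d)
  have : facePerm σ d.symm = σ d := by
    change σ (d.symm.symm) = σ d
    rw [SimpleGraph.Dart.symm_symm]
  rw [← this]
  exact Equiv.Perm.sameCycle_apply_right.2 (Equiv.Perm.SameCycle.refl _ _)

/-- Every edge has an orientation. -/
theorem exists_edgeDart {G : SimpleGraph V} (e : G.edgeSet) : ∃ d : G.Dart, d.edge = e.1 := by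
  obtain ⟨e, he⟩ := e
  induction e using Sym2.ind with
  | _ a b => exact ⟨⟨(a, b), he⟩, rfl⟩

/-- A chosen orientation of an edge. -/
noncomputable def edgeDart {G : SimpleGraph V} (e : G.edgeSet) : G.Dart :=
  Classical.choose (exists_edgeDart e)

theorem edgeDart_edge {G : SimpleGraph V} (e : G.edgeSet) : (edgeDart e).edge = e.1 :=
  Classical.choose_spec (exists_edgeDart e)

noncomputable def bd2 {G : SimpleGraph V} (σ : Equiv.Perm G.Dart) :
    (Faces σ → ZMod 2) →ₗ[ZMod 2] (G.edgeSet → ZMod 2) where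
  toFun s := fun e => s (faceOf σ (edgeDart e)) + s (faceOf σ (edgeDart e).symm)
  map_add' s s' := by
    funext e
    simp only [Pi.add_apply]; ring
  map_smul' a s := by
    funext e
    simp only [Pi.smul_apply, smul_eq_mul, RingHom.id_apply]; ring

theorem bd2_apply {G : SimpleGraph V} (σ : Equiv.Perm G.Dart) (s : Faces σ → ZMod 2)
    (d : G.Dart) : bd2 σ s ⟨d.edge, d.edge_mem⟩ = s (faceOf σ d) + s (faceOf σ (σ d)) := by
  rw [← faceOf_symm]
  change s (faceOf σ (edgeDart _)) + s (faceOf σ (edgeDart _).symm) = _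
  have h := edgeDart_edge (⟨d.edge, d.edge_mem⟩ : G.edgeSet)
  rcases (SimpleGraph.dart_edge_eq_iff _ d).1 h with h | h
  · rw [h]
  · rw [h, SimpleGraph.Dart.symm_symm, add_comm]

theorem bd1_bd2 [Fintype V] {G : SimpleGraph V} (σ : Equiv.Perm G.Dart)
    (hσ : IsRotationSystem G σ) (s : Faces σ → ZMod 2) : bd1 G (bd2 σ s) = 0 := by
  classical
  funext u
  change (∑ d : G.Dart, if d.fst = u then bd2 σ s ⟨d.edge, d.edge_mem⟩ else 0) = 0
  have key : ∀ d : G.Dart, (if d.fst = u then bd2 σ s ⟨d.edge, d.edge_mem⟩ else 0)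
      = (if d.fst = u then s (faceOf σ d) else 0)
        + (if (σ d).fst = u then s (faceOf σ (σ d)) else 0) := by
    intro d
    rw [bd2_apply]
    have := hσ.fst_eq d
    simp only [this]
    split_ifs <;> simp
  convert Finset.sum_congr rfl fun d _ => key d
  rw [Finset.sum_add_distrib, Equiv.sum_comp σ (fun d => if d.fst = u then s (faceOf σ d) else 0)]
  exact (CharTwo.add_self_eq_zero _).symm

/-- A function on darts invariant under `σ` and reversal is constant. -/
theorem const_of_inv {G : SimpleGraph V} (σ : Equiv.Perm G.Dart)
    (hσ : IsRotationSystem G σ) (hG : G.Connected) (t : G.Dart → ZMod 2)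
    (h1 : ∀ d, t (σ d) = t d) (h2 : ∀ d, t d.symm = t d) (d e : G.Dart) : t d = t e := by
  have hcyc : ∀ a b : G.Dart, a.fst = b.fst → t a = t b := by
    intro a b hab
    obtain ⟨i, hi⟩ := hσ.orbit_eq a b hab
    have : ∀ i : ℤ, ∀ a, t ((σ ^ i) a) = t a := by
      intro i
      induction i using Int.induction_on with
      | zero => simp
      | succ n ih => intro a; rw [zpow_add_one, Equiv.Perm.mul_apply, ih, h1]
      | pred n ih =>
        intro a
        rw [zpow_sub_one, Equiv.Perm.mul_apply, ih, ← h1]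
        exact congrArg t (σ.apply_symm_apply a)
    rw [← hi, this]
  obtain ⟨w⟩ := hG.preconnected d.fst e.fst
  have : ∀ (u x : V) (w : G.Walk u x) (a b : G.Dart), a.fst = u → b.fst = x → t a = t b := by
    intro u x w
    induction w with
    | nil => intro a b ha hb; exact hcyc _ _ (ha.trans hb.symm)
    | @cons u y x hadj p ih =>
      intro a b ha hb
      have e1 : t a = t (⟨(u, y), hadj⟩ : G.Dart) := hcyc _ _ ha
      rw [e1, ← h2]
      exact ih _ _ rfl hb
  exact this _ _ w d e rfl rfl

theorem ker_bd1_finrank [Fintype V] (G : SimpleGraph V) (hG : G.Connected) :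
    Module.finrank (ZMod 2) (LinearMap.ker (bd1 G)) + Fintype.card V ≤ Nat.card G.edgeSet + 1 := by
  classical
  obtain ⟨r⟩ := hG.nonempty
  have hspan : LinearMap.range (bd1 G) ⊔ Submodule.span (ZMod 2) {Pi.single r (1 : ZMod 2)} = ⊤ := by
    set W := LinearMap.range (bd1 G) ⊔ Submodule.span (ZMod 2) {Pi.single r (1 : ZMod 2)} with hW
    have hr : (Pi.single r (1 : ZMod 2) : V → ZMod 2) ∈ W :=
      Submodule.mem_sup_right (Submodule.mem_span_singleton_self _)
    have hstep : ∀ (u x : V), G.Walk u x → (Pi.single x (1 : ZMod 2) : V → ZMod 2) ∈ W →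
        (Pi.single u (1 : ZMod 2) : V → ZMod 2) ∈ W := by
      intro u x w
      induction w with
      | nil => exact id
      | @cons u y x hadj p ih =>
        intro hx
        have hy := ih hx
        have hd : bd1 G (Pi.single ⟨(⟨(u, y), hadj⟩ : G.Dart).edge, SimpleGraph.Dart.edge_mem _⟩ 1)
            = Pi.single u 1 + Pi.single y 1 := bd1_single G ⟨(u, y), hadj⟩
        have : (Pi.single u (1 : ZMod 2) + Pi.single y 1 : V → ZMod 2) ∈ W :=
          Submodule.mem_sup_left ⟨_, hd⟩
        have := W.sub_mem this hy
        simpa using this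
    rw [eq_top_iff]
    intro g _
    have : g = ∑ u, g u • (Pi.single u (1 : ZMod 2) : V → ZMod 2) := by
      funext x
      simp [Finset.sum_apply, Pi.single_apply]
    rw [this]
    refine Submodule.sum_mem _ fun u _ => W.smul_mem _ ?_
    obtain ⟨w⟩ := hG.preconnected u r
    exact hstep u r w hr
  have h1 := Submodule.finrank_add_le_finrank_add_finrank (LinearMap.range (bd1 G))
    (Submodule.span (ZMod 2) {(Pi.single r (1 : ZMod 2) : V → ZMod 2)})
  rw [hspan, finrank_top, Module.finrank_fintype_fun_eq_card] at h1
  have h2 := finrank_span_singleton (K := ZMod 2)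
    (v := (Pi.single r (1 : ZMod 2) : V → ZMod 2)) (by simp)
  have h3 := LinearMap.finrank_range_add_finrank_ker (bd1 G)
  rw [Module.finrank_fintype_fun_eq_card, ← Nat.card_eq_fintype_card] at h3
  omega

theorem range_bd2_finrank [Fintype V] {G : SimpleGraph V} (σ : Equiv.Perm G.Dart)
    (hσ : IsRotationSystem G σ) (hG : G.Connected) :
    numFaces σ ≤ Module.finrank (ZMod 2) (LinearMap.range (bd2 σ)) + 1 := by
  classical
  have : Fintype (Faces σ) := Fintype.ofFinite _
  have h3 := LinearMap.finrank_range_add_finrank_ker (bd2 σ)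
  rw [Module.finrank_fintype_fun_eq_card, ← Nat.card_eq_fintype_card] at h3
  have hker : LinearMap.ker (bd2 σ) ≤ Submodule.span (ZMod 2) {fun _ => (1 : ZMod 2)} := by
    intro s hs
    have hs' : ∀ d, s (faceOf σ d) + s (faceOf σ (σ d)) = 0 := by
      intro d
      rw [← bd2_apply, LinearMap.mem_ker.1 hs]; rfl
    have hs2 : ∀ d, s (faceOf σ (σ d)) = s (faceOf σ d) := fun d =>
      (CharTwo.add_eq_zero.1 (hs' d)).symm
    have hc := const_of_inv σ hσ hG (fun d => s (faceOf σ d)) hs2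
      (fun d => by rw [faceOf_symm]; exact hs2 d)
    rw [Submodule.mem_span_singleton]
    by_cases hne : Nonempty G.Dart
    · obtain ⟨d0⟩ := hne
      refine ⟨s (faceOf σ d0), ?_⟩
      funext x
      obtain ⟨d, rfl⟩ := Quotient.exists_rep x
      simp only [Pi.smul_apply, smul_eq_mul, mul_one]
      exact hc d0 d
    · refine ⟨0, ?_⟩
      funext x
      obtain ⟨d, rfl⟩ := Quotient.exists_rep x
      exact (hne ⟨d⟩).elim
  have h4 := Submodule.finrank_mono hker
  have h5 : Module.finrank (ZMod 2) (Submodule.span (ZMod 2)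
      {(fun _ => (1 : ZMod 2) : Faces σ → ZMod 2)}) ≤ 1 := by
    refine (finrank_span_le_card _).trans ?_
    simp
  have : numFaces σ = Nat.card (Faces σ) := rfl
  omega

/-- In a plane triangulation every mod 2 cycle is a sum of face boundaries. -/
theorem cycle_is_boundary [Fintype V] {G : SimpleGraph V} {σ : Equiv.Perm G.Dart}
    (hT : IsPlaneTriangulation G σ) (h : G.edgeSet → ZMod 2) (hh : bd1 G h = 0) :
    ∃ s : Faces σ → ZMod 2, bd2 σ s = h := by
  have hle : LinearMap.range (bd2 σ) ≤ LinearMap.ker (bd1 G) := by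
    rintro _ ⟨s, rfl⟩
    exact bd1_bd2 σ hT.rot s
  have h1 := ker_bd1_finrank G hT.connected
  have h2 := range_bd2_finrank σ hT.rot hT.connected
  have h3 := hT.euler
  have := Submodule.eq_of_le_of_finrank_le hle (by omega)
  have hm : h ∈ LinearMap.range (bd2 σ) := by rw [this]; exact hh
  exact hm

end Homology

section Kempe

/-- Reachability along vertices satisfying `P`. -/
def Conn (G : SimpleGraph V) (P : V → Prop) : V → V → Prop :=
  Relation.ReflTransGen (fun u w => G.Adj u w ∧ P u ∧ P w)

open Classical in
theorem conn_chain [Fintype V] (G : SimpleGraph V) (P : V → Prop) (a b : V)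
    (hab : Conn G P a b) : ∃ h : G.edgeSet → ZMod 2,
      bd1 G h = Pi.single a 1 + Pi.single b 1 ∧
      ∀ d : G.Dart, ¬ P d.fst → h ⟨d.edge, d.edge_mem⟩ = 0 := by
  induction hab with
  | refl =>
    refine ⟨0, ?_, fun _ _ => rfl⟩
    rw [map_zero]
    funext x
    exact (CharTwo.add_self_eq_zero _).symm
  | @tail b c _ hbc ih =>
    obtain ⟨h, h1, h2⟩ := ih
    obtain ⟨hadj, hb, hc⟩ := hbc
    have hd := bd1_single G ⟨(b, c), hadj⟩
    refine ⟨h + Pi.single ⟨(⟨(b, c), hadj⟩ : G.Dart).edge, SimpleGraph.Dart.edge_mem _⟩ 1, ?_, ?_⟩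
    · rw [map_add, h1, hd]
      funext x
      simp only [Pi.add_apply]
      have := CharTwo.add_self_eq_zero ((Pi.single b 1 : V → ZMod 2) x)
      simp only [Pi.single_apply] at *
      split_ifs at * <;> simp_all
    · intro d hd
      rw [Pi.add_apply, h2 d hd, zero_add, Pi.single_apply, if_neg]
      intro heq
      have heq' : d.edge = (⟨(b, c), hadj⟩ : G.Dart).edge := congrArg Subtype.val heq
      rcases (SimpleGraph.dart_edge_eq_iff _ _).1 heq' with e | e
      · rw [e] at hd; exact hd hb
      · rw [e] at hd; exact hd hc

/-- Discrete Jordan curve statement around a vertex. -/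
theorem jordan_s3 [Fintype V] {G : SimpleGraph V} {σ : Equiv.Perm G.Dart}
    (hT : IsPlaneTriangulation G σ) (e : G.Dart) (i1 i2 i3 : ℕ) (h01 : 0 < i1) (h12 : i1 < i2)
    (h23 : i2 < i3)
    (hinj : ∀ a b, a ≤ i3 → b ≤ i3 → (σ ^ a) e = (σ ^ b) e → a = b)
    (P Q : V → Prop) (hPQ : ∀ x, P x → ¬ Q x) (hPv : ¬ P e.fst) (hQv : ¬ Q e.fst)
    (hP : Conn G P e.snd ((σ ^ i2) e).snd)
    (hQ : Conn G Q ((σ ^ i1) e).snd ((σ ^ i3) e).snd) (hQ1 : Q ((σ ^ i1) e).snd) : False := by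
  classical
  obtain ⟨h, hh1, hh2⟩ := conn_chain G P _ _ hP
  have hfst : ∀ j : ℕ, ((σ ^ j) e).fst = e.fst := by
    intro j
    induction j with
    | zero => rfl
    | succ n ih => rw [pow_succ', Equiv.Perm.mul_apply]; exact (hT.rot.fst_eq _).trans ih
  set e2 := (σ ^ i2) e with he2
  have hfst2 : e2.fst = e.fst := hfst i2
  -- the closed chain
  set H : G.edgeSet → ZMod 2 := h + Pi.single ⟨e.edge, e.edge_mem⟩ 1
    + Pi.single ⟨e2.edge, e2.edge_mem⟩ 1 with hH
  have hcyc : bd1 G H = 0 := by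
    rw [hH, map_add, map_add, hh1, bd1_single, bd1_single, hfst2]
    have : ∀ a b c : V → ZMod 2, a + b + (c + a) + (c + b) = 0 := by
      intro a b c
      funext x
      have h1 := CharTwo.add_self_eq_zero (a x)
      have h2 := CharTwo.add_self_eq_zero (b x)
      have h3 := CharTwo.add_self_eq_zero (c x)
      simp only [Pi.add_apply, Pi.zero_apply]
      linear_combination h1 + h2 + h3
    exact this _ _ _
  obtain ⟨s, hs⟩ := cycle_is_boundary hT H hcyc
  have hs' : ∀ d, s (faceOf σ d) + s (faceOf σ (σ d)) = H ⟨d.edge, d.edge_mem⟩ := by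
    intro d; rw [← bd2_apply, hs]
  -- value of `H` on darts
  have hHval : ∀ d : G.Dart, ¬ P d.fst → d ≠ e → d ≠ e.symm → d ≠ e2 → d ≠ e2.symm →
      H ⟨d.edge, d.edge_mem⟩ = 0 := by
    intro d hd k1 k2 k3 k4
    rw [hH, Pi.add_apply, Pi.add_apply, hh2 d hd, Pi.single_apply, Pi.single_apply, if_neg, if_neg]
    · simp
    · intro heq
      rcases (SimpleGraph.dart_edge_eq_iff _ _).1 (congrArg Subtype.val heq) with q | q
      · exact k3 q
      · exact k4 q
    · intro heq
      rcases (SimpleGraph.dart_edge_eq_iff _ _).1 (congrArg Subtype.val heq) with q | q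
      · exact k1 q
      · exact k2 q
  have hsymm_ne : ∀ d d' : G.Dart, d.fst = e.fst → d'.fst = e.fst → d ≠ d'.symm := by
    intro d d' k k' heq
    have h1 : d.fst = d'.snd := by rw [heq]; rfl
    exact d'.fst_ne_snd (k'.trans (k.symm.trans h1))
  have hne2 : e ≠ e2 := by
    intro heq
    have := hinj 0 i2 (by omega) (by omega) (by simpa using heq)
    omega
  have hHe : H ⟨e.edge, e.edge_mem⟩ = 1 := by
    rw [hH, Pi.add_apply, Pi.add_apply, hh2 e hPv, Pi.single_eq_same, Pi.single_apply, if_neg]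
    · simp
    · intro heq
      rcases (SimpleGraph.dart_edge_eq_iff _ _).1 (congrArg Subtype.val heq) with q | q
      · exact hne2 q
      · exact hsymm_ne e e2 rfl hfst2 q
  have hHe2 : H ⟨e2.edge, e2.edge_mem⟩ = 1 := by
    rw [hH, Pi.add_apply, Pi.add_apply, hh2 e2 (by rw [hfst2]; exact hPv), Pi.single_eq_same,
      Pi.single_apply, if_neg]
    · simp
    · intro heq
      rcases (SimpleGraph.dart_edge_eq_iff _ _).1 (congrArg Subtype.val heq) with q | q
      · exact hne2 q.symm
      · exact hsymm_ne e2 e hfst2 rfl q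
  have hstep0 : ∀ j, j ≤ i3 → j ≠ 0 → j ≠ i2 →
      s (faceOf σ ((σ ^ (j + 1)) e)) = s (faceOf σ ((σ ^ j) e)) := by
    intro j hj hj0 hj2
    rw [pow_succ', Equiv.Perm.mul_apply]
    have := hs' ((σ ^ j) e)
    rw [hHval _ (by rw [hfst]; exact hPv)] at this
    · exact (CharTwo.add_eq_zero.1 this).symm
    · intro heq
      exact hj0 (hinj j 0 hj (by omega) (by simpa using heq))
    · exact hsymm_ne _ _ (hfst j) rfl
    · intro heq
      exact hj2 (hinj j i2 hj (by omega) heq)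
    · exact hsymm_ne _ _ (hfst j) hfst2
  have hA : ∀ j, 1 ≤ j → j ≤ i2 → s (faceOf σ ((σ ^ j) e)) = s (faceOf σ e) + 1 := by
    intro j hj
    induction j, hj using Nat.le_induction with
    | base =>
      intro _
      have := hs' e
      rw [hHe] at this
      rw [pow_one]
      have h1 := CharTwo.add_self_eq_zero (s (faceOf σ e))
      linear_combination this - h1
    | succ n hn ih =>
      intro hle
      rw [hstep0 n (by omega) (by omega) (by omega), ih (by omega)]
  have hB : ∀ j, i2 + 1 ≤ j → j ≤ i3 → s (faceOf σ ((σ ^ j) e)) = s (faceOf σ e) := by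
    intro j hj
    induction j, hj using Nat.le_induction with
    | base =>
      intro _
      have := hs' e2
      rw [hHe2, he2, hA i2 (by omega) le_rfl] at this
      rw [pow_succ', Equiv.Perm.mul_apply]
      have h1 := CharTwo.add_self_eq_zero (s (faceOf σ e))
      linear_combination this - h1
    | succ n hn ih =>
      intro hle
      rw [hstep0 n (by omega) (by omega) (by omega), ih (by omega)]
  -- constancy along `Q`
  have hPe : P e.snd ∨ e.snd = e2.snd := by
    rcases Relation.ReflTransGen.cases_head hP with q | ⟨c, hc, _⟩
    · exact Or.inr q
    · exact Or.inl hc.2.1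
  have hPe' : P e.snd ∧ P e2.snd := by
    rcases hPe with q | q
    · refine ⟨q, ?_⟩
      rcases Relation.ReflTransGen.cases_tail hP with q' | ⟨c, _, hc⟩
      · rw [q']; exact q
      · exact hc.2.2
    · exact (hne2 (SimpleGraph.Dart.ext _ _ (Prod.ext hfst2.symm q))).elim
  have hQH : ∀ d : G.Dart, Q d.fst → H ⟨d.edge, d.edge_mem⟩ = 0 := by
    intro d hd
    refine hHval d (fun hp => hPQ _ hp hd) ?_ ?_ ?_ ?_
    · rintro rfl; exact hQv hd
    · rintro rfl; exact hPQ _ hPe'.1 hd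
    · intro q; rw [q, hfst2] at hd; exact hQv hd
    · intro q; rw [q] at hd; exact hPQ _ hPe'.2 hd
  have hQσ : ∀ d : G.Dart, Q d.fst → s (faceOf σ (σ d)) = s (faceOf σ d) := by
    intro d hd
    have := hs' d
    rw [hQH d hd] at this
    exact (CharTwo.add_eq_zero.1 this).symm
  have hQc : ∀ d d' : G.Dart, Q d.fst → d.fst = d'.fst → s (faceOf σ d) = s (faceOf σ d') := by
    intro d d' hd hdd
    obtain ⟨i, hi⟩ := (hT.rot.orbit_eq d d' hdd).exists_nat_pow_eq
    rw [← hi]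
    have : ∀ j : ℕ, s (faceOf σ ((σ ^ j) d)) = s (faceOf σ d) ∧ Q ((σ ^ j) d).fst := by
      intro j
      induction j with
      | zero => exact ⟨rfl, hd⟩
      | succ n ih =>
        rw [pow_succ', Equiv.Perm.mul_apply]
        refine ⟨(hQσ _ ih.2).trans ih.1, ?_⟩
        have := hT.rot.fst_eq ((σ ^ n) d)
        rw [show (σ ((σ ^ n) d)).fst = ((σ ^ n) d).fst from this]
        exact ih.2
    exact (this i).1.symm
  have hQsymm : ∀ d : G.Dart, Q d.fst → s (faceOf σ d.symm) = s (faceOf σ d) := by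
    intro d hd
    rw [faceOf_symm]; exact hQσ d hd
  have hQpath : ∀ x, Conn G Q ((σ ^ i1) e).snd x → Q x ∧ ∀ d : G.Dart, d.fst = x →
      s (faceOf σ d) = s (faceOf σ ((σ ^ i1) e).symm) := by
    intro x hx
    induction hx with
    | refl => exact ⟨hQ1, fun d hd => hQc d _ (by rw [hd]; exact hQ1) hd⟩
    | @tail b c _ hbc ih =>
      refine ⟨hbc.2.2, fun d hd => ?_⟩
      have h1 := ih.2 ⟨(b, c), hbc.1⟩ rfl
      rw [← h1, ← hQsymm ⟨(b, c), hbc.1⟩ hbc.2.1]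
      exact hQc d _ (by rw [hd]; exact hbc.2.2) hd
  obtain ⟨hq3, hfin⟩ := hQpath _ hQ
  have h3 := hfin ((σ ^ i3) e).symm rfl
  have k1 := hQsymm ((σ ^ i1) e).symm hQ1
  have k3 := hQsymm ((σ ^ i3) e).symm hq3
  rw [SimpleGraph.Dart.symm_symm] at k1 k3
  rw [← k1, ← k3, hA i1 h01 h12.le, hB i3 h23 le_rfl] at h3
  have : (1 : ZMod 2) = 0 := by linear_combination -h3
  exact one_ne_zero this

/-- `A` is 4-colorable. -/
def Col (G : SimpleGraph V) (A : Set V) : Prop :=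
  ∃ f : V → Fin 4, ∀ u ∈ A, ∀ w ∈ A, G.Adj u w → f u ≠ f w

theorem col_insert_of_missing (G : SimpleGraph V) (A : Set V) (v : V) (f : V → Fin 4)
    (hf : ∀ u ∈ A, ∀ w ∈ A, G.Adj u w → f u ≠ f w) (k : Fin 4)
    (hk : ∀ w ∈ A, G.Adj v w → f w ≠ k) : Col G (insert v A) := by
  classical
  refine ⟨Function.update f v k, ?_⟩
  intro u hu w hw hadj
  by_cases h1 : u = v
  · subst h1
    have h2 : w ≠ u := hadj.ne'
    have hwA : w ∈ A := (Set.mem_insert_iff.1 hw).resolve_left h2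
    rw [Function.update_self, Function.update_of_ne h2]
    exact (hk w hwA hadj).symm
  · have huA : u ∈ A := (Set.mem_insert_iff.1 hu).resolve_left h1
    by_cases h2 : w = v
    · subst h2
      rw [Function.update_self, Function.update_of_ne h1]
      exact hk u huA hadj.symm
    · have hwA : w ∈ A := (Set.mem_insert_iff.1 hw).resolve_left h2
      rw [Function.update_of_ne h1, Function.update_of_ne h2]
      exact hf u huA w hwA hadj

theorem kempe_swap (G : SimpleGraph V) (A : Set V) (v : V) (f : V → Fin 4)
    (hf : ∀ u ∈ A, ∀ w ∈ A, G.Adj u w → f u ≠ f w) (n : Fin 4 → V)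
    (hn : ∀ k, f (n k) = k) (hA : ∀ k, n k ∈ A)
    (huniq : ∀ w ∈ A, G.Adj v w → w = n (f w)) (p q : Fin 4) (hpq : p ≠ q)
    (hc : ¬ Conn G (fun x => x ∈ A ∧ (f x = p ∨ f x = q)) (n p) (n q)) :
    Col G (insert v A) := by
  classical
  set P : V → Prop := fun x => x ∈ A ∧ (f x = p ∨ f x = q) with hP
  set K : Set V := {x | Conn G P (n p) x} with hK
  have hKP : ∀ x ∈ K, P x := by
    intro x hx
    rcases Relation.ReflTransGen.cases_tail (show Conn G P (n p) x from hx) with h | ⟨c, _, h⟩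
    · rw [h]; exact ⟨hA p, Or.inl (hn p)⟩
    · exact h.2.2
  have hcl : ∀ x ∈ K, ∀ y, G.Adj x y → P y → y ∈ K := fun x hx y hxy hy =>
    Relation.ReflTransGen.tail (show Conn G P (n p) x from hx) ⟨hxy, hKP x hx, hy⟩
  let f' : V → Fin 4 := fun x => if x ∈ K then Equiv.swap p q (f x) else f x
  have hsw : ∀ x ∈ K, Equiv.swap p q (f x) = p ∨ Equiv.swap p q (f x) = q := by
    intro x hx
    rcases (hKP x hx).2 with h | h <;> rw [h] <;> simp
  have hmix : ∀ u ∈ A, ∀ w ∈ A, G.Adj u w → u ∈ K → w ∉ K → f' u ≠ f' w := by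
    intro u hu w hw hadj huK hwK heq
    simp only [f', if_pos huK, if_neg hwK] at heq
    refine hwK (hcl u huK w hadj ⟨hw, ?_⟩)
    rw [← heq]; exact hsw u huK
  refine col_insert_of_missing G A v f' ?_ p ?_
  · intro u hu w hw hadj
    by_cases huK : u ∈ K <;> by_cases hwK : w ∈ K
    · simp only [f', if_pos huK, if_pos hwK]
      exact fun h => hf u hu w hw hadj ((Equiv.swap p q).injective h)
    · exact hmix u hu w hw hadj huK hwK
    · exact (hmix w hw u hu hadj.symm hwK huK).symm
    · simp only [f', if_neg huK, if_neg hwK]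
      exact hf u hu w hw hadj
  · intro w hw hadj heq
    by_cases hwK : w ∈ K
    · simp only [f', if_pos hwK] at heq
      have h1 : f w = q := by
        rcases (hKP w hwK).2 with h | h
        · rw [h, Equiv.swap_apply_left] at heq; exact (hpq heq.symm).elim
        · exact h
      have h2 := huniq w hw hadj
      rw [h1] at h2
      rw [h2] at hwK
      exact hc hwK
    · simp only [f', if_neg hwK] at heq
      have h2 := huniq w hw hadj
      rw [heq] at h2
      rw [h2] at hwK
      exact hwK Relation.ReflTransGen.refl

theorem kempe_step [Fintype V] {G : SimpleGraph V} {σ : Equiv.Perm G.Dart}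
    (hT : IsPlaneTriangulation G σ) (A : Set V) (v : V) (hv : v ∉ A) (hcol : Col G A)
    (hcard : {w | w ∈ A ∧ G.Adj v w}.ncard ≤ 4) : Col G (insert v A) := by
  classical
  obtain ⟨f, hf⟩ := hcol
  by_cases hmiss : ∃ k, ∀ w ∈ A, G.Adj v w → f w ≠ k
  · obtain ⟨k, hk⟩ := hmiss
    exact col_insert_of_missing G A v f hf k hk
  push Not at hmiss
  choose n hA hadj hn using hmiss
  have hninj : Function.Injective n := by
    intro a b hab
    rw [← hn a, ← hn b, hab]
  have hset : Set.range n = {w | w ∈ A ∧ G.Adj v w} := by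
    refine Set.eq_of_subset_of_ncard_le ?_ ?_ (Set.toFinite _)
    · rintro _ ⟨k, rfl⟩; exact ⟨hA k, hadj k⟩
    · refine hcard.trans ?_
      rw [← Set.image_univ, Set.ncard_image_of_injective _ hninj, Set.ncard_univ]
      simp
  have huniq : ∀ w ∈ A, G.Adj v w → w = n (f w) := by
    intro w hw hvw
    have : w ∈ Set.range n := by rw [hset]; exact ⟨hw, hvw⟩
    obtain ⟨k, rfl⟩ := this
    rw [hn]
  let e : Fin 4 → G.Dart := fun k => ⟨(v, n k), hadj k⟩
  have heinj : Function.Injective e := by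
    intro a b hab
    exact hninj (congrArg (fun d : G.Dart => d.snd) hab)
  have hex : ∀ k, ∃ i : ℕ, (σ ^ i) (e 0) = e k := fun k =>
    (hT.rot.orbit_eq (e 0) (e k) rfl).exists_nat_pow_eq
  let i : Fin 4 → ℕ := fun k => Nat.find (hex k)
  have hi : ∀ k, (σ ^ (i k)) (e 0) = e k := fun k => Nat.find_spec (hex k)
  have himin : ∀ k m, m < i k → (σ ^ m) (e 0) ≠ e k := fun k m hm => Nat.find_min (hex k) hm
  have hpos : ∀ k, k ≠ 0 → 0 < i k := by
    intro k hk
    rcases Nat.eq_zero_or_pos (i k) with h | h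
    · have := hi k
      rw [h, pow_zero] at this
      exact (hk (heinj this).symm).elim
    · exact h
  have hine : ∀ k l, k ≠ l → i k ≠ i l := by
    intro k l hkl h
    apply hkl; apply heinj
    rw [← hi k, ← hi l, h]
  have hinjlt : ∀ k, ∀ a b, a < b → b ≤ i k → (σ ^ a) (e 0) ≠ (σ ^ b) (e 0) := by
    intro k a b hab hb heq
    have h1 : (σ ^ (b - a)) (e 0) = e 0 := by
      have : (σ ^ a) ((σ ^ (b - a)) (e 0)) = (σ ^ a) (e 0) := by
        rw [← Equiv.Perm.mul_apply, ← pow_add, heq]; congr 2; omega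
      exact (σ ^ a).injective this
    refine himin k (i k - (b - a)) (by omega) ?_
    calc (σ ^ (i k - (b - a))) (e 0) = (σ ^ (i k - (b - a))) ((σ ^ (b - a)) (e 0)) := by rw [h1]
      _ = (σ ^ (i k)) (e 0) := by
        rw [← Equiv.Perm.mul_apply, ← pow_add]; congr 2; omega
      _ = e k := hi k
  have hinj : ∀ k, ∀ a b, a ≤ i k → b ≤ i k → (σ ^ a) (e 0) = (σ ^ b) (e 0) → a = b := by
    intro k a b ha hb heq
    rcases lt_trichotomy a b with h | h | h
    · exact (hinjlt k a b h hb heq).elim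
    · exact h
    · exact (hinjlt k b a h ha heq.symm).elim
  have core : ∀ a b c : Fin 4, a ≠ 0 → b ≠ 0 → c ≠ 0 → a ≠ b → a ≠ c → b ≠ c →
      i a < i b → i b < i c → Col G (insert v A) := by
    intro a b c ha hb hc hab hac hbc h1 h2
    by_cases hP : Conn G (fun x => x ∈ A ∧ (f x = 0 ∨ f x = b)) (n 0) (n b)
    · by_cases hQ : Conn G (fun x => x ∈ A ∧ (f x = a ∨ f x = c)) (n a) (n c)
      · exfalso
        refine jordan_s3 hT (e 0) (i a) (i b) (i c) (hpos a ha) h1 h2 (hinj c)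
          (fun x => x ∈ A ∧ (f x = 0 ∨ f x = b)) (fun x => x ∈ A ∧ (f x = a ∨ f x = c))
          ?_ (fun h => hv h.1) (fun h => hv h.1) ?_ ?_ ?_
        · rintro x ⟨_, hx | hx⟩ ⟨_, hy | hy⟩ <;> rw [hx] at hy
          · exact ha hy.symm
          · exact hc hy.symm
          · exact hab hy.symm
          · exact hbc hy
        · rw [hi b]; exact hP
        · rw [hi a, hi c]; exact hQ
        · rw [hi a]; exact ⟨hA a, Or.inl (hn a)⟩
      · exact kempe_swap G A v f hf n hn hA huniq a c hac hQ
    · exact kempe_swap G A v f hf n hn hA huniq 0 b hb.symm hP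
  have n12 := hine 1 2 (by decide)
  have n13 := hine 1 3 (by decide)
  have n23 := hine 2 3 (by decide)
  rcases lt_or_gt_of_ne n12 with o12 | o12 <;> rcases lt_or_gt_of_ne n13 with o13 | o13 <;>
    rcases lt_or_gt_of_ne n23 with o23 | o23
  · exact core 1 2 3 (by decide) (by decide) (by decide) (by decide) (by decide) (by decide) o12 o23
  · exact core 1 3 2 (by decide) (by decide) (by decide) (by decide) (by decide) (by decide) o13 o23
  · omega
  · exact core 3 1 2 (by decide) (by decide) (by decide) (by decide) (by decide) (by decide) o13 o12
  · exact core 2 1 3 (by decide) (by decide) (by decide) (by decide) (by decide) (by decide) o12 o13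
  · omega
  · exact core 2 3 1 (by decide) (by decide) (by decide) (by decide) (by decide) (by decide) o23 o13
  · exact core 3 2 1 (by decide) (by decide) (by decide) (by decide) (by decide) (by decide) o23 o12

open Classical in
/-- Adding a vertex all but four of whose neighbors are absent. -/
theorem kempe_add [Fintype V] {G : SimpleGraph V} {σ : Equiv.Perm G.Dart}
    (hT : IsPlaneTriangulation G σ) (A : Set V) (hcol : Col G A) (v : V) (hv : v ∉ A)
    (T : Finset V) (hd : deg G v ≤ T.card + 4) (hTA : ∀ x ∈ T, G.Adj v x ∧ x ∉ A) :
    Col G (insert v A) := by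
  refine kempe_step hT A v hv hcol ?_
  have h1 : deg G v = (G.neighborSet v).ncard := rfl
  have h2 : {w | w ∈ A ∧ G.Adj v w} ⊆ G.neighborSet v \ (T : Set V) := by
    rintro w ⟨hw, hvw⟩
    exact ⟨hvw, fun hwT => (hTA w hwT).2 hw⟩
  have h3 := Set.ncard_le_ncard h2 (Set.toFinite _)
  have h4 : (T : Set V) ⊆ G.neighborSet v := fun x hx => (hTA x hx).1
  have h5 := Set.ncard_sdiff_add_ncard_of_subset h4 (Set.toFinite _)
  rw [Set.ncard_coe_finset] at h5
  omega

end Kempe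

/-- Among the four degree 5 neighbors of the degree 7 vertex two are adjacent. -/
theorem exists_adj_pair [Fintype V] {G : SimpleGraph V} {σ : Equiv.Perm G.Dart}
    (hT : IsPlaneTriangulation G σ) (v : V) (hd : deg G v = 7) (B : Finset V) (hB : B.card = 4)
    (hBv : ∀ x ∈ B, G.Adj v x) : ∃ x ∈ B, ∃ y ∈ B, G.Adj x y := by
  classical
  by_contra hno
  push Not at hno
  -- successor map on neighbors
  have hconsec : ∀ d : G.Dart, G.Adj d.snd (σ d).snd := by
    intro d
    set g := facePerm σ with hg
    have h1 : g d.symm = σ d := by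
      change σ (d.symm.symm) = σ d
      rw [SimpleGraph.Dart.symm_symm]
    have hcard : Nat.card {e : G.Dart // g.SameCycle d.symm e} = 3 := hT.face_size_eq d.symm
    have hfst : ∀ x : G.Dart, (g x).fst = x.snd := fun x => hT.rot.fst_eq x.symm
    have h3 : g (g (g d.symm)) = d.symm := by
      by_contra hne
      have hpig : ∀ x : G.Dart, g x ≠ x := by
        intro x hx
        have h := hfst x
        rw [hx] at h
        exact x.fst_ne_snd h
      by_cases h2 : g (g d.symm) = d.symm
      · -- period two
        have hsub : ∀ m : ℕ, (g ^ m) d.symm = d.symm ∨ (g ^ m) d.symm = g d.symm := by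
          intro m
          induction m with
          | zero => exact Or.inl rfl
          | succ m ih =>
            rw [pow_succ', Equiv.Perm.mul_apply]
            rcases ih with h | h <;> rw [h]
            · exact Or.inr rfl
            · exact Or.inl h2
        have hle : {e : G.Dart | g.SameCycle d.symm e} ⊆ (({d.symm, g d.symm} : Finset G.Dart) : Set G.Dart) := by
          intro x hx
          obtain ⟨m, hm⟩ := Equiv.Perm.SameCycle.exists_nat_pow_eq (show g.SameCycle d.symm x from hx)
          rcases hsub m with h | h <;> rw [hm] at h <;> simp [h]
        have := Set.ncard_le_ncard hle (Set.toFinite _)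
        rw [Set.ncard_coe_finset] at this
        have h4 := Finset.card_le_two (a := d.symm) (b := g d.symm)
        have h5 : {e : G.Dart | g.SameCycle d.symm e}.ncard = 3 := hcard
        omega
      · have hsub : (({d.symm, g d.symm, g (g d.symm), g (g (g d.symm))} : Finset G.Dart) : Set G.Dart)
            ⊆ {e : G.Dart | g.SameCycle d.symm e} := by
          intro x hx
          simp only [Finset.coe_insert, Finset.coe_singleton, Set.mem_insert_iff,
            Set.mem_singleton_iff] at hx
          change g.SameCycle d.symm x
          rcases hx with rfl | rfl | rfl | rfl <;> simp [Equiv.Perm.sameCycle_apply_right, Equiv.Perm.SameCycle.refl]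
        have := Set.ncard_le_ncard hsub (Set.toFinite _)
        rw [Set.ncard_coe_finset] at this
        have h5 : {e : G.Dart | g.SameCycle d.symm e}.ncard = 3 := hcard
        have hinj := g.injective
        have h6 : ({d.symm, g d.symm, g (g d.symm), g (g (g d.symm))} : Finset G.Dart).card = 4 := by
          rw [Finset.card_insert_of_notMem, Finset.card_insert_of_notMem,
            Finset.card_insert_of_notMem, Finset.card_singleton]
          · simp only [Finset.mem_singleton]
            exact fun h => hpig _ h.symm
          · simp only [Finset.mem_insert, Finset.mem_singleton]
            rintro (h | h)
            · exact hpig _ h.symm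
            · exact h2 (hinj h).symm
          · simp only [Finset.mem_insert, Finset.mem_singleton]
            rintro (h | h | h)
            · exact hpig _ h.symm
            · exact h2 h.symm
            · exact hne h.symm
        omega
    rw [h1] at h3
    have h4 : (g (σ d)).fst = (σ d).snd := hfst _
    have h5 : (g (σ d)).snd = d.snd := by
      have := hfst (g (σ d))
      rw [h3] at this
      exact this.symm
    have := (g (σ d)).adj
    rw [h4, h5] at this
    exact this.symm
  let succ : {x // x ∈ B} → V := fun x => (σ ⟨(v, x.1), hBv x.1 x.2⟩).snd
  have hsinj : Function.Injective succ := by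
    intro x y hxy
    have h1 : σ ⟨(v, x.1), hBv x.1 x.2⟩ = σ ⟨(v, y.1), hBv y.1 y.2⟩ := by
      refine SimpleGraph.Dart.ext _ _ (Prod.ext ?_ hxy)
      rw [hT.rot.fst_eq, hT.rot.fst_eq]
    have h2 := σ.injective h1
    exact Subtype.ext (congrArg (fun d : G.Dart => d.snd) h2)
  have hsadj : ∀ x, G.Adj v (succ x) := by
    intro x
    have h1 := (σ ⟨(v, x.1), hBv x.1 x.2⟩).adj
    have h2 : (σ ⟨(v, x.1), hBv x.1 x.2⟩).fst = v := hT.rot.fst_eq _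
    rw [h2] at h1
    exact h1
  have hsB : ∀ x, succ x ∉ B := fun x hx => hno x.1 x.2 _ hx (hconsec ⟨(v, x.1), hBv x.1 x.2⟩)
  have hdisj : Disjoint B (Finset.univ.image succ) := by
    rw [Finset.disjoint_left]
    intro a ha ha'
    obtain ⟨x, _, rfl⟩ := Finset.mem_image.1 ha'
    exact hsB x ha
  have hcard : (B ∪ Finset.univ.image succ).card = 8 := by
    rw [Finset.card_union_of_disjoint hdisj, Finset.card_image_of_injective _ hsinj]
    simp [hB]
  have hsub : ((B ∪ Finset.univ.image succ : Finset V) : Set V) ⊆ G.neighborSet v := by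
    intro a ha
    rcases Finset.mem_union.1 (Finset.mem_coe.1 ha) with h | h
    · exact hBv a h
    · obtain ⟨x, _, rfl⟩ := Finset.mem_image.1 h
      exact hsadj x
  have := Set.ncard_le_ncard hsub (Set.toFinite _)
  rw [Set.ncard_coe_finset, hcard] at this
  have h1 : deg G v = (G.neighborSet v).ncard := rfl
  omega


theorem col_mono {G : SimpleGraph V} {A B : Set V} (hA : Col G A) (hBA : B ⊆ A) : Col G B := by
  obtain ⟨f, hf⟩ := hA
  exact ⟨f, fun u hu w hw => hf u (hBA hu) w (hBA hw)⟩

theorem kempe_add1 [Fintype V] {G : SimpleGraph V} {σ : Equiv.Perm G.Dart}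
    (hT : IsPlaneTriangulation G σ) (A : Set V) (hcol : Col G A) (v : V) (hv : v ∉ A)
    (a : V) (hd : deg G v ≤ 5) (ha : G.Adj v a) (ha' : a ∉ A) : Col G (insert v A) := by
  refine kempe_add hT A hcol v hv {a} (by simpa using hd) ?_
  intro x hx
  rw [Finset.mem_singleton] at hx
  subst hx
  exact ⟨ha, ha'⟩

theorem kempe_add3 [Fintype V] {G : SimpleGraph V} {σ : Equiv.Perm G.Dart}
    (hT : IsPlaneTriangulation G σ) (A : Set V) (hcol : Col G A) (v : V) (hv : v ∉ A)
    (a b c : V) (hab : a ≠ b) (hac : a ≠ c) (hbc : b ≠ c) (hd : deg G v ≤ 7)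
    (ha : G.Adj v a) (hb : G.Adj v b) (hc : G.Adj v c)
    (ha' : a ∉ A) (hb' : b ∉ A) (hc' : c ∉ A) : Col G (insert v A) := by
  classical
  refine kempe_add hT A hcol v hv {a, b, c} ?_ ?_
  · rw [Finset.card_eq_three.2 ⟨a, b, c, hab, hac, hbc, by congr⟩]
    exact hd
  · intro x hx
    simp only [Finset.mem_insert, Finset.mem_singleton] at hx
    rcases hx with rfl | rfl | rfl
    · exact ⟨ha, ha'⟩
    · exact ⟨hb, hb'⟩
    · exact ⟨hc, hc'⟩

theorem kempe_add4 [Fintype V] {G : SimpleGraph V} {σ : Equiv.Perm G.Dart}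
    (hT : IsPlaneTriangulation G σ) (A : Set V) (hcol : Col G A) (v : V) (hv : v ∉ A)
    (a b c s : V) (hab : a ≠ b) (hac : a ≠ c) (has : a ≠ s) (hbc : b ≠ c) (hbs : b ≠ s)
    (hcs : c ≠ s) (hd : deg G v ≤ 8)
    (ha : G.Adj v a) (hb : G.Adj v b) (hc : G.Adj v c) (hs : G.Adj v s)
    (ha' : a ∉ A) (hb' : b ∉ A) (hc' : c ∉ A) (hs' : s ∉ A) : Col G (insert v A) := by
  classical
  refine kempe_add hT A hcol v hv {a, b, c, s} ?_ ?_
  · rw [Finset.card_insert_of_notMem (by simp [hab, hac, has]),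
      Finset.card_insert_of_notMem (by simp [hbc, hbs]),
      Finset.card_insert_of_notMem (by simp [hcs]), Finset.card_singleton]
    exact hd
  · intro x hx
    simp only [Finset.mem_insert, Finset.mem_singleton] at hx
    rcases hx with rfl | rfl | rfl | rfl
    · exact ⟨ha, ha'⟩
    · exact ⟨hb, hb'⟩
    · exact ⟨hc, hc'⟩
    · exact ⟨hs, hs'⟩

set_option maxHeartbeats 2000000 in
/-- The main theorem with the set of six vertices abstracted. -/
theorem main_aux_s3 [Fintype V] (G : SimpleGraph V) (σ : Equiv.Perm G.Dart)
    (hT : IsPlaneTriangulation G σ) (v1 v2 v3 v4 v5 v6 : V)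
    (hdistinct : List.Nodup [v1, v2, v3, v4, v5, v6])
    (h12 : G.Adj v1 v2) (h13 : G.Adj v1 v3) (h14 : G.Adj v1 v4)
    (h15 : G.Adj v1 v5) (h16 : G.Adj v1 v6)
    (hd1 : deg G v1 = 7) (hd2 : deg G v2 = 8)
    (hd3 : deg G v3 = 5) (hd4 : deg G v4 = 5) (hd5 : deg G v5 = 5) (hd6 : deg G v6 = 5)
    (h23 : G.Adj v2 v3) (h24 : G.Adj v2 v4)
    (six : Set V)
    (hmem : ∀ u, u ∈ six ↔ (u = v1 ∨ u = v2 ∨ u = v3 ∨ u = v4 ∨ u = v5 ∨ u = v6))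
    (c : {x : V // x ∉ six} → Fin 5)
    (hc : ∀ u w : {x : V // x ∉ six}, G.Adj u.1 w.1 → c u ≠ c w) :
    ∃ c' : V → Fin 5, Proper5 G c' ∧
      (∀ (x : V) (hx : x ∉ six), (c' x = 4 ↔ c ⟨x, hx⟩ = 4)) ∧
      ({x : V | x ∈ six ∧ c' x = 4} : Set V).Subsingleton := by
  classical
  simp only [List.nodup_cons, List.mem_cons, List.not_mem_nil, or_false, not_or,
    not_false_eq_true, List.nodup_nil, and_true] at hdistinct
  obtain ⟨⟨n12, n13, n14, n15, n16⟩, ⟨n23, n24, n25, n26⟩, ⟨n34, n35, n36⟩, ⟨n45, n46⟩, n56⟩ :=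
    hdistinct
  set S : Set V := {x | ∃ hx : x ∉ six, c ⟨x, hx⟩ = 4} with hS
  have hSsix : ∀ x ∈ S, x ∉ six := fun x hx => hx.1
  have hSind : ∀ x ∈ S, ∀ y ∈ S, ¬ G.Adj x y := by
    rintro x ⟨hx, hx4⟩ y ⟨hy, hy4⟩ hxy
    exact hc ⟨x, hx⟩ ⟨y, hy⟩ hxy (hx4.trans hy4.symm)
  have fin : ∀ T : Set V, (∀ x, x ∉ six → (x ∈ T ↔ x ∈ S)) →
      ({x | x ∈ six ∧ x ∈ T} : Set V).Subsingleton → (∀ x ∈ T, ∀ y ∈ T, ¬ G.Adj x y) →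
      Col G Tᶜ → ∃ c' : V → Fin 5, Proper5 G c' ∧
      (∀ (x : V) (hx : x ∉ six), (c' x = 4 ↔ c ⟨x, hx⟩ = 4)) ∧
      ({x : V | x ∈ six ∧ c' x = 4} : Set V).Subsingleton := by
    rintro T hTS hsub hind ⟨f, hf⟩
    have hval : ∀ k : Fin 4, k.castSucc ≠ (4 : Fin 5) := by decide
    have h4 : ∀ x, (if x ∈ T then (4 : Fin 5) else (f x).castSucc) = 4 ↔ x ∈ T := by
      intro x
      by_cases hx : x ∈ T
      · simp [hx]
      · simp only [hx, iff_false]; exact hval _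
    refine ⟨fun x => if x ∈ T then 4 else (f x).castSucc, ?_, ?_, ?_⟩
    · intro u w huw heq
      by_cases hu : u ∈ T <;> by_cases hw : w ∈ T
      · exact hind u hu w hw huw
      · simp only [if_pos hu, if_neg hw] at heq; exact hval _ heq.symm
      · simp only [if_neg hu, if_pos hw] at heq; exact hval _ heq
      · simp only [if_neg hu, if_neg hw] at heq
        exact hf u hu w hw huw (Fin.castSucc_injective _ heq)
    · intro x hx
      change (if x ∈ T then (4 : Fin 5) else (f x).castSucc) = 4 ↔ _
      rw [h4, hTS x hx]
      exact ⟨fun h => h.2, fun h => ⟨hx, h⟩⟩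
    · intro x hx y hy
      exact hsub ⟨hx.1, (h4 x).1 hx.2⟩ ⟨hy.1, (h4 y).1 hy.2⟩
  have fin0 : ∀ A : Set V, Col G A → (∀ x, x ∉ S → x ∈ A) → _ := fun A hA hsub =>
    fin S (fun _ _ => Iff.rfl) (fun x hx => (hSsix x hx.2 hx.1).elim) hSind
      (col_mono hA fun x hx => hsub x hx)
  have fin1 : ∀ p ∈ six, (∀ x ∈ S, ¬ G.Adj p x) → ∀ A : Set V, Col G A →
      (∀ x, x ∉ S → x ≠ p → x ∈ A) → _ := fun p hp hpS A hA hsub =>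
    fin (insert p S)
      (fun x hx => by
        rw [Set.mem_insert_iff]
        exact ⟨fun h => h.resolve_left (fun e => hx (e ▸ hp)), Or.inr⟩)
      (fun x hx y hy => by
        have h1 : x = p := hx.2.resolve_right fun h => hSsix x h hx.1
        have h2 : y = p := hy.2.resolve_right fun h => hSsix y h hy.1
        rw [h1, h2])
      (by
        rintro x (rfl | hx) y (rfl | hy) hxy
        · exact hxy.ne rfl
        · exact hpS y hy hxy
        · exact hpS x hx hxy.symm
        · exact hSind x hx y hy hxy)
      (col_mono hA fun x hx => hsub x (fun h => hx (Or.inr h)) (fun h => hx (Or.inl h)))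
  set A : Set V := {x | x ∉ six ∧ x ∉ S} with hA
  have hAm : ∀ x, x ∈ A ↔ (x ∉ six ∧ x ∉ S) := fun x => Iff.rfl
  have hcolA : Col G A := by
    refine ⟨fun x => if hx : x ∉ six then ⟨(c ⟨x, hx⟩).val % 4, Nat.mod_lt _ (by norm_num)⟩ else 0, ?_⟩
    rintro u ⟨hu, huS⟩ w ⟨hw, hwS⟩ huw heq
    simp only [hu, hw, not_false_eq_true, dif_pos, Fin.mk.injEq] at heq
    apply hc ⟨u, hu⟩ ⟨w, hw⟩ huw
    have h1 : c ⟨u, hu⟩ ≠ 4 := fun h => huS ⟨hu, h⟩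
    have h2 : c ⟨w, hw⟩ ≠ 4 := fun h => hwS ⟨hw, h⟩
    apply Fin.ext
    have h1' : (c ⟨u, hu⟩).val ≠ 4 := fun h => h1 (Fin.ext h)
    have h2' : (c ⟨w, hw⟩).val ≠ 4 := fun h => h2 (Fin.ext h)
    have := (c ⟨u, hu⟩).isLt
    have := (c ⟨w, hw⟩).isLt
    omega
  have hvS : ∀ x ∈ six, x ∉ S := fun x hx h => hSsix x h hx
  have hvA : ∀ x ∈ six, x ∉ A := fun x hx h => h.1 hx
  have hSA : ∀ x ∈ S, x ∉ A := fun x hx h => h.2 hx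
  have m1 : v1 ∈ six := (hmem _).2 (by simp)
  have m2 : v2 ∈ six := (hmem _).2 (by simp)
  have m3 : v3 ∈ six := (hmem _).2 (by simp)
  have m4 : v4 ∈ six := (hmem _).2 (by simp)
  have m5 : v5 ∈ six := (hmem _).2 (by simp)
  have m6 : v6 ∈ six := (hmem _).2 (by simp)
  by_cases hs2 : ∀ x ∈ S, ¬ G.Adj v2 x
  · -- put `v2` into the last class
    have c1 : Col G (insert v5 A) :=
      kempe_add1 hT _ hcolA v5 (by grind) v1 hd5.le h15.symm (by grind)
    have c2 : Col G (insert v6 (insert v5 A)) :=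
      kempe_add1 hT _ c1 v6 (by grind) v1 hd6.le h16.symm (by grind)
    have c3 : Col G (insert v1 (insert v6 (insert v5 A))) :=
      kempe_add3 hT _ c2 v1 (by grind) v2 v3 v4 n23 n24 n34 hd1.le h12 h13 h14
        (by grind) (by grind) (by grind)
    have c4 : Col G (insert v3 (insert v1 (insert v6 (insert v5 A)))) :=
      kempe_add1 hT _ c3 v3 (by grind) v2 hd3.le h23.symm (by grind)
    have c5 : Col G (insert v4 (insert v3 (insert v1 (insert v6 (insert v5 A))))) :=
      kempe_add1 hT _ c4 v4 (by grind) v2 hd4.le h24.symm (by grind)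
    exact fin1 v2 m2 hs2 _ c5 (by grind)
  push Not at hs2
  obtain ⟨s, hsS, hs2⟩ := hs2
  have c1 : Col G (insert v2 A) :=
    kempe_add4 hT _ hcolA v2 (by grind) v1 v3 v4 s n13 n14 (by grind) n34 (by grind) (by grind)
      hd2.le h12.symm h23 h24 hs2 (by grind) (by grind) (by grind) (by grind)
  by_cases hs1 : ∀ x ∈ S, ¬ G.Adj v1 x
  · -- put `v1` into the last class
    have c2 : Col G (insert v3 (insert v2 A)) :=
      kempe_add1 hT _ c1 v3 (by grind) v1 hd3.le h13.symm (by grind)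
    have c3 : Col G (insert v4 (insert v3 (insert v2 A))) :=
      kempe_add1 hT _ c2 v4 (by grind) v1 hd4.le h14.symm (by grind)
    have c4 : Col G (insert v5 (insert v4 (insert v3 (insert v2 A)))) :=
      kempe_add1 hT _ c3 v5 (by grind) v1 hd5.le h15.symm (by grind)
    have c5 : Col G (insert v6 (insert v5 (insert v4 (insert v3 (insert v2 A))))) :=
      kempe_add1 hT _ c4 v6 (by grind) v1 hd6.le h16.symm (by grind)
    exact fin1 v1 m1 hs1 _ c5 (by grind)
  push Not at hs1
  obtain ⟨a, haS, ha1⟩ := hs1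
  have pair : ∀ x y z w : V, List.Nodup [v1, v2, x, y, z, w] →
      (∀ u, u ∈ six ↔ (u = v1 ∨ u = v2 ∨ u = x ∨ u = y ∨ u = z ∨ u = w)) →
      G.Adj v1 x → G.Adj v1 y → G.Adj v1 z → G.Adj v1 w →
      deg G x = 5 → deg G y = 5 → deg G z = 5 → deg G w = 5 → G.Adj z w →
      ∃ c' : V → Fin 5, Proper5 G c' ∧
      (∀ (x : V) (hx : x ∉ six), (c' x = 4 ↔ c ⟨x, hx⟩ = 4)) ∧
      ({x : V | x ∈ six ∧ c' x = 4} : Set V).Subsingleton := by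
    intro x y z w hnd hm hx hy hz hw dx dy dz dw hzw
    clear hmem n13 n14 n15 n16 n23 n24 n25 n26 n34 n35 n36 n45 n46 n56
    simp only [List.nodup_cons, List.mem_cons, List.not_mem_nil, or_false, not_or,
      not_false_eq_true, List.nodup_nil, and_true] at hnd
    obtain ⟨⟨_, p1, p2, p3, p4⟩, ⟨p5, p6, p7, p8⟩, ⟨p9, p10, p11⟩, ⟨p12, p13⟩, p14⟩ := hnd
    have mx : x ∈ six := (hm _).2 (by simp)
    have my : y ∈ six := (hm _).2 (by simp)
    have mz : z ∈ six := (hm _).2 (by simp)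
    have mw : w ∈ six := (hm _).2 (by simp)
    have c2 : Col G (insert x (insert v2 A)) :=
      kempe_add1 hT _ c1 x (by grind) v1 dx.le hx.symm (by grind)
    have c3 : Col G (insert y (insert x (insert v2 A))) :=
      kempe_add1 hT _ c2 y (by grind) v1 dy.le hy.symm (by grind)
    have c4 : Col G (insert v1 (insert y (insert x (insert v2 A)))) :=
      kempe_add3 hT _ c3 v1 (by grind) a z w (by grind) (by grind) p14 hd1.le ha1 hz hw
        (by grind) (by grind) (by grind)
    by_cases hsz : ∀ x ∈ S, ¬ G.Adj z x
    · have c5 : Col G (insert w (insert v1 (insert y (insert x (insert v2 A))))) :=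
        kempe_add1 hT _ c4 w (by grind) z dw.le hzw.symm (by grind)
      exact fin1 z mz hsz _ c5 (by grind)
    push Not at hsz
    obtain ⟨b, hbS, hzb⟩ := hsz
    have c5 : Col G (insert z (insert v1 (insert y (insert x (insert v2 A))))) :=
      kempe_add1 hT _ c4 z (by grind) b dz.le hzb (by grind)
    by_cases hsw : ∀ x ∈ S, ¬ G.Adj w x
    · exact fin1 w mw hsw _ c5 (by grind)
    push Not at hsw
    obtain ⟨b', hbS', hwb⟩ := hsw
    have c6 : Col G (insert w (insert z (insert v1 (insert y (insert x (insert v2 A)))))) :=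
      kempe_add1 hT _ c5 w (by grind) b' dw.le hwb (by grind)
    exact fin0 _ c6 (by grind)
  obtain ⟨p, hp, q, hq, hpq⟩ := exists_adj_pair hT v1 hd1 {v3, v4, v5, v6}
    (by
      rw [Finset.card_insert_of_notMem (by simp [n34, n35, n36]),
        Finset.card_insert_of_notMem (by simp [n45, n46]),
        Finset.card_insert_of_notMem (by simp [n56]), Finset.card_singleton])
    (by
      intro x hx
      simp only [Finset.mem_insert, Finset.mem_singleton] at hx
      rcases hx with rfl | rfl | rfl | rfl <;> assumption)
  simp only [Finset.mem_insert, Finset.mem_singleton] at hp hq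
  have go : ∀ x y z w : V, List.Perm [v3, v4, v5, v6] [x, y, z, w] → G.Adj z w →
      ∃ c' : V → Fin 5, Proper5 G c' ∧
      (∀ (x : V) (hx : x ∉ six), (c' x = 4 ↔ c ⟨x, hx⟩ = 4)) ∧
      ({x : V | x ∈ six ∧ c' x = 4} : Set V).Subsingleton := by
    intro x y z w hperm hzw
    have hin : ∀ u, u ∈ [x, y, z, w] → G.Adj v1 u ∧ deg G u = 5 := by
      intro u hu
      have := hperm.mem_iff.2 hu
      simp only [List.mem_cons, List.not_mem_nil, or_false] at this
      rcases this with rfl | rfl | rfl | rfl <;> constructor <;> assumption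
    refine pair x y z w ?_ ?_ (hin x (by simp)).1 (hin y (by simp)).1 (hin z (by simp)).1
      (hin w (by simp)).1 (hin x (by simp)).2 (hin y (by simp)).2 (hin z (by simp)).2
      (hin w (by simp)).2 hzw
    · refine ((hperm.cons v2).cons v1).nodup_iff.1 ?_
      simp [n12, n13, n14, n15, n16, n23, n24, n25, n26, n34, n35, n36, n45, n46, n56]
    · intro u
      have := ((hperm.cons v2).cons v1).mem_iff (a := u)
      simp only [List.mem_cons, List.not_mem_nil, or_false] at this
      rw [hmem]; exact this
  have two : ∀ x y z w : V, List.Perm [v3, v4, v5, v6] [x, y, z, w] → G.Adj w z →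
      ∃ c' : V → Fin 5, Proper5 G c' ∧
      (∀ (x : V) (hx : x ∉ six), (c' x = 4 ↔ c ⟨x, hx⟩ = 4)) ∧
      ({x : V | x ∈ six ∧ c' x = 4} : Set V).Subsingleton :=
    fun x y z w h hzw => go x y z w h hzw.symm
  have e34 : List.Perm [v3, v4, v5, v6] [v5, v6, v3, v4] :=
    List.perm_append_comm (l₁ := [v3, v4]) (l₂ := [v5, v6])
  have e56 : List.Perm [v3, v4, v5, v6] [v3, v4, v5, v6] := List.Perm.refl _
  have e46 : List.Perm [v3, v4, v5, v6] [v3, v5, v4, v6] :=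
    (List.Perm.swap v5 v4 [v6]).cons v3
  have e35 : List.Perm [v3, v4, v5, v6] [v4, v6, v3, v5] :=
    e46.trans (List.perm_append_comm (l₁ := [v3, v5]) (l₂ := [v4, v6]))
  have e45 : List.Perm [v3, v4, v5, v6] [v3, v6, v4, v5] :=
    (List.perm_append_comm (l₁ := [v4, v5]) (l₂ := [v6])).cons v3
  have e36 : List.Perm [v3, v4, v5, v6] [v4, v5, v3, v6] :=
    List.Perm.append_right [v6] (List.perm_append_comm (l₁ := [v3]) (l₂ := [v4, v5]))
  rcases hp with hp | hp | hp | hp <;> rcases hq with hq | hq | hq | hq <;> rw [hp, hq] at hpq <;>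
    first
    | exact (hpq.ne rfl).elim
    | exact go _ _ _ _ e34 hpq
    | exact go _ _ _ _ e35 hpq
    | exact go _ _ _ _ e36 hpq
    | exact go _ _ _ _ e45 hpq
    | exact go _ _ _ _ e46 hpq
    | exact go _ _ _ _ e56 hpq
    | exact two _ _ _ _ e34 hpq
    | exact two _ _ _ _ e35 hpq
    | exact two _ _ _ _ e36 hpq
    | exact two _ _ _ _ e45 hpq
    | exact two _ _ _ _ e46 hpq
    | exact two _ _ _ _ e56 hpq

theorem statement3 [Fintype V] (G : SimpleGraph V) (σ : Equiv.Perm G.Dart)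
    (hT : IsPlaneTriangulation G σ) (v1 v2 v3 v4 v5 v6 : V)
    (hdistinct : List.Nodup [v1, v2, v3, v4, v5, v6])
    (h12 : G.Adj v1 v2) (h13 : G.Adj v1 v3) (h14 : G.Adj v1 v4)
    (h15 : G.Adj v1 v5) (h16 : G.Adj v1 v6)
    (hd1 : deg G v1 = 7) (hd2 : deg G v2 = 8)
    (hd3 : deg G v3 = 5) (hd4 : deg G v4 = 5) (hd5 : deg G v5 = 5) (hd6 : deg G v6 = 5)
    (h23 : G.Adj v2 v3) (h24 : G.Adj v2 v4)
    (c : {x : V // x ∉ ({v1, v2, v3, v4, v5, v6} : Set V)} → Fin 5)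
    (hc : ∀ u w : {x : V // x ∉ ({v1, v2, v3, v4, v5, v6} : Set V)}, G.Adj u.1 w.1 → c u ≠ c w) :
    ∃ c' : V → Fin 5, Proper5 G c' ∧
      (∀ (x : V) (hx : x ∉ ({v1, v2, v3, v4, v5, v6} : Set V)), (c' x = 4 ↔ c ⟨x, hx⟩ = 4)) ∧
      ({x : V | x ∈ ({v1, v2, v3, v4, v5, v6} : Set V) ∧ c' x = 4} : Set V).Subsingleton := by
  exact main_aux_s3 G σ hT v1 v2 v3 v4 v5 v6 hdistinct h12 h13 h14 h15 h16 hd1 hd2 hd3 hd4 hd5 hd6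
    h23 h24 _ (fun u => by simp) c hc
end

section
/- Let G be a plane triangulation, let d ≥ 8 be an integer, let v be a vertex of G of degree d, and let U be a set of d − 3 neighbors of v each having degree 5. Then for every proper 5-coloring c of the induced subgraph G − ({v} ∪ U) there exists a proper 5-coloring of G whose set of vertices colored 5 consists of the vertices colored 5 by c together with at most one vertex of {v} ∪ U. -/
open SimpleGraph

variable {V : Type}

theorem sameCycle_inv {α β : Type*} {s : Equiv.Perm α} {h : α → β} (hs : ∀ x, h (s x) = h x)
    {x y : α} (hxy : s.SameCycle x y) : h x = h y := by
  obtain ⟨i, rfl⟩ := hxy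
  have hs' : ∀ x, h (s⁻¹ x) = h x := fun x => by
    have := hs (s⁻¹ x)
    simpa using this.symm
  induction i with
  | zero => simp
  | succ i ih => rw [add_comm, zpow_add, zpow_one, Equiv.Perm.mul_apply, hs]; exact ih
  | pred i ih => rw [sub_eq_neg_add, zpow_add, zpow_neg_one, Equiv.Perm.mul_apply, hs']; exact ih

theorem facePerm_apply {G : SimpleGraph V} (σ : Equiv.Perm G.Dart) (d : G.Dart) :
    facePerm σ d = σ d.symm := rfl

theorem sum_darts [Fintype V] {G : SimpleGraph V} [Fintype G.Dart] [Fintype G.edgeSet]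
    (r : G.edgeSet → G.Dart) (hr : ∀ e, (r e).edge = e.1) (F : G.Dart → ZMod 2) :
    ∑ d, F d = ∑ e, (F (r e) + F (r e).symm) := by
  classical
  rw [← Finset.sum_fiberwise (s := Finset.univ) (g := fun d : G.Dart => (⟨d.edge, d.edge_mem⟩ : G.edgeSet))]
  refine Finset.sum_congr rfl fun e _ => ?_
  have : (Finset.univ.filter fun d : G.Dart => (⟨d.edge, d.edge_mem⟩ : G.edgeSet) = e)
      = {r e, (r e).symm} := by
    ext d
    simp only [Finset.mem_filter, Finset.mem_univ, true_and, Finset.mem_insert,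
      Finset.mem_singleton, Subtype.ext_iff]
    rw [← hr e]
    exact SimpleGraph.dart_edge_eq_iff d (r e)
  rw [this, Finset.sum_pair]
  exact (SimpleGraph.Dart.symm_ne _).symm

/-- If the Euler formula holds, every closed mod 2 chain bounds. -/
theorem homology [Fintype V] {G : SimpleGraph V} [Fintype G.Dart]
    (σ : Equiv.Perm G.Dart) (hconn : G.Connected) (hrot : IsRotationSystem G σ)
    (heuler : Fintype.card V + numFaces σ = Nat.card G.edgeSet + 2)
    (b : G.Dart → ZMod 2) (hsym : ∀ d, b d.symm = b d)
    (hcl : ∀ g : V → ZMod 2, ∑ d, b d * g d.fst = 0) :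
    ∃ f : G.Dart → ZMod 2, (∀ d, f (facePerm σ d) = f d) ∧ ∀ d, f d + f d.symm = b d := by
  classical
  have two : ∀ z : ZMod 2, z + z = 0 := by decide
  have two' : ∀ z w : ZMod 2, z + w = 0 → z = w := by decide
  have hex : ∀ e : G.edgeSet, ∃ d : G.Dart, d.edge = e.1 := by
    rintro ⟨e, he⟩
    induction e with
    | h x y => exact ⟨⟨(x, y), he⟩, rfl⟩
  choose r hr using hex
  have hrd : ∀ d : G.Dart, ∃ e, d = r e ∨ d = (r e).symm := fun d =>
    ⟨⟨d.edge, d.edge_mem⟩, (SimpleGraph.dart_edge_eq_iff d (r _)).1 (hr ⟨d.edge, d.edge_mem⟩).symm⟩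
  let Q := Quotient (orbitSetoid (facePerm σ))
  let q : G.Dart → Q := fun d => Quotient.mk _ d
  have hq : ∀ d, q (facePerm σ d) = q d := fun d =>
    Quotient.sound (show (facePerm σ).SameCycle _ _ from (Equiv.Perm.SameCycle.refl _ _).apply_left)
  have : Fintype Q := Fintype.ofFinite _
  let M : Matrix G.edgeSet V (ZMod 2) := Matrix.of fun e w =>
    (if (r e).fst = w then 1 else 0) + (if (r e).snd = w then 1 else 0)
  have hM : ∀ g e, M.mulVec g e = g (r e).fst + g (r e).snd := by
    intro g e
    simp [M, Matrix.mulVec, dotProduct, add_mul, Finset.sum_add_distrib]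
  have hMt : ∀ a : G.edgeSet → ZMod 2, ∀ w, M.transpose.mulVec a w =
      ∑ e, ((if (r e).fst = w then a e else 0) + (if (r e).snd = w then a e else 0)) := by
    intro a w
    simp [M, Matrix.mulVec, dotProduct, add_mul]
  let D : (Q → ZMod 2) →ₗ[ZMod 2] (G.edgeSet → ZMod 2) :=
    { toFun := fun f e => f (q (r e)) + f (q (r e).symm)
      map_add' := by intro f g; ext e; simp; ring
      map_smul' := by intro c f; ext e; simp; ring }
  have one_le : ∀ (X : Type) [Fintype X] (L : Submodule (ZMod 2) (X → ZMod 2)),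
      (∀ f ∈ L, ∀ x y, f x = f y) → Module.finrank (ZMod 2) L ≤ 1 := by
    intro X _ L hL
    have : L ≤ Submodule.span (ZMod 2) {(fun _ => 1 : X → ZMod 2)} := by
      intro f hf
      rw [Submodule.mem_span_singleton]
      by_cases hX : Nonempty X
      · obtain ⟨x⟩ := hX
        exact ⟨f x, by ext y; simp [hL f hf x y]⟩
      · exact ⟨0, by ext y; exact (hX ⟨y⟩).elim⟩
    refine (Submodule.finrank_mono this).trans ?_
    exact (finrank_span_le_card _).trans (by simp)
  have hkM : Module.finrank (ZMod 2) (LinearMap.ker M.mulVecLin) ≤ 1 := by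
    apply one_le
    intro g hg x y
    have hg' : ∀ e, g (r e).fst + g (r e).snd = 0 := fun e => by
      rw [← hM]; exact congrFun (LinearMap.mem_ker.1 hg) e
    obtain ⟨p⟩ := hconn.preconnected x y
    induction p with
    | nil => rfl
    | cons h p ih =>
      rw [← ih]
      obtain ⟨e, he⟩ := hrd ⟨(_, _), h⟩
      have := two' _ _ (hg' e)
      rcases he with he | he
      · rw [← he] at this; exact this
      · have h2 := congrArg SimpleGraph.Dart.symm he
        rw [SimpleGraph.Dart.symm_symm] at h2
        rw [← h2] at this; exact this.symm
  have hkD : Module.finrank (ZMod 2) (LinearMap.ker D) ≤ 1 := by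
    apply one_le
    intro f hf
    have h1 : ∀ d : G.Dart, f (q d) = f (q d.symm) := by
      intro d
      obtain ⟨e, he⟩ := hrd d
      have : f (q (r e)) = f (q (r e).symm) := two' _ _ (congrFun (LinearMap.mem_ker.1 hf) e)
      rcases he with rfl | rfl
      · exact this
      · rw [SimpleGraph.Dart.symm_symm]; exact this.symm
    have h2 : ∀ d, f (q (σ d)) = f (q d) := by
      intro d
      have := hq d.symm
      rw [facePerm_apply, SimpleGraph.Dart.symm_symm] at this
      rw [this, h1 d]
    have h3 : ∀ d e : G.Dart, d.fst = e.fst → f (q d) = f (q e) := fun d e h =>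
      sameCycle_inv (h := fun d => f (q d)) h2 (hrot.orbit_eq d e h)
    have h4 : ∀ x y : V, ∀ p : G.Walk x y, ∀ d e : G.Dart, d.fst = x → e.fst = y →
        f (q d) = f (q e) := by
      intro x y p
      induction p with
      | nil => intro d e h h'; exact h3 d e (h.trans h'.symm)
      | cons hxz p ih =>
        intro d e h h'
        rw [h3 d ⟨(_, _), hxz⟩ h, h1]
        exact ih _ _ rfl h'
    intro x y
    induction x using Quotient.inductionOn with | _ x =>
    induction y using Quotient.inductionOn with | _ y =>
    obtain ⟨p⟩ := hconn.preconnected x.fst y.fst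
    exact h4 _ _ p x y rfl rfl
  have hle : LinearMap.range D ≤ LinearMap.ker M.transpose.mulVecLin := by
    rintro _ ⟨f, rfl⟩
    rw [LinearMap.mem_ker]
    ext w
    rw [Matrix.mulVecLin_apply, hMt]
    have e1 := sum_darts r hr (fun d => (if d.fst = w then f (q d) else 0) +
      (if d.snd = w then f (q d) else 0))
    have e2 : ∑ d : G.Dart, (if d.snd = w then f (q d) else 0) =
        ∑ d : G.Dart, (if d.fst = w then f (q d) else 0) := by
      rw [← Equiv.sum_comp (facePerm σ) (fun d => if d.fst = w then f (q d) else 0)]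
      refine Finset.sum_congr rfl fun d _ => ?_
      rw [hq]
      have : (facePerm σ d).fst = d.snd := hrot.fst_eq d.symm
      rw [this]
    rw [Finset.sum_add_distrib, e2, two] at e1
    refine Eq.trans ?_ e1.symm
    refine Finset.sum_congr rfl fun e _ => ?_
    simp only [D, LinearMap.coe_mk, AddHom.coe_mk]
    have s1 : (r e).symm.fst = (r e).snd := rfl
    have s2 : (r e).symm.snd = (r e).fst := rfl
    rw [s1, s2]
    split_ifs <;> ring
  have heq : LinearMap.range D = LinearMap.ker M.transpose.mulVecLin := by
    apply Submodule.eq_of_le_of_finrank_le hle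
    have r1 := LinearMap.finrank_range_add_finrank_ker D
    have r2 := LinearMap.finrank_range_add_finrank_ker M.mulVecLin
    have r3 := LinearMap.finrank_range_add_finrank_ker M.transpose.mulVecLin
    have r4 : M.transpose.rank = M.rank := Matrix.rank_transpose M
    unfold Matrix.rank at r4
    rw [Module.finrank_fintype_fun_eq_card] at r1 r2 r3
    have r5 : numFaces σ = Fintype.card Q := Nat.card_eq_fintype_card
    rw [Nat.card_eq_fintype_card] at heuler
    omega
  have hb : (fun e => b (r e)) ∈ LinearMap.ker M.transpose.mulVecLin := by
    rw [LinearMap.mem_ker]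
    ext w
    rw [Matrix.mulVecLin_apply, hMt]
    refine Eq.trans ?_ (hcl (fun x => if x = w then 1 else 0))
    rw [sum_darts r hr]
    refine Finset.sum_congr rfl fun e _ => ?_
    have s1 : (r e).symm.fst = (r e).snd := rfl
    rw [s1, hsym]
    simp
  rw [← heq] at hb
  obtain ⟨f, hf⟩ := hb
  refine ⟨fun d => f (q d), fun d => by simp only [hq], fun d => ?_⟩
  obtain ⟨e, he⟩ := hrd d
  have := congrFun hf e
  simp only [D, LinearMap.coe_mk, AddHom.coe_mk] at this
  rcases he with rfl | rfl
  · exact this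
  · rw [SimpleGraph.Dart.symm_symm, hsym, add_comm]; exact this

theorem iter_fst {G : SimpleGraph V} {σ : Equiv.Perm G.Dart} (hrot : IsRotationSystem G σ)
    (D : G.Dart) (i : ℕ) : (σ^[i] D).fst = D.fst := by
  induction i with
  | zero => rfl
  | succ i ih => rw [Function.iterate_succ_apply', hrot.fst_eq, ih]

theorem period_pos {G : SimpleGraph V} [Finite G.Dart] (σ : Equiv.Perm G.Dart) (D : G.Dart) :
    0 < Function.minimalPeriod σ D := by
  apply Function.minimalPeriod_pos_of_mem_periodicPts
  exact σ.injective.mem_periodicPts D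

theorem rot_index {G : SimpleGraph V} [Finite G.Dart] {σ : Equiv.Perm G.Dart}
    (hrot : IsRotationSystem G σ) (D : G.Dart) (y : V) (h : G.Adj D.fst y) :
    ∃ i < Function.minimalPeriod σ D, (σ^[i] D).snd = y := by
  obtain ⟨i, hi⟩ := (hrot.orbit_eq D ⟨(D.fst, y), h⟩ rfl).exists_nat_pow_eq
  refine ⟨i % Function.minimalPeriod σ D, Nat.mod_lt _ (period_pos σ D), ?_⟩
  rw [Function.iterate_mod_minimalPeriod_eq, ← Equiv.Perm.coe_pow, hi]

theorem rot_inj {G : SimpleGraph V} {σ : Equiv.Perm G.Dart}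
    (hrot : IsRotationSystem G σ) (D : G.Dart) {i j : ℕ}
    (hi : i < Function.minimalPeriod σ D) (hj : j < Function.minimalPeriod σ D)
    (h : (σ^[i] D).snd = (σ^[j] D).snd) : i = j := by
  apply Function.iterate_injOn_Iio_minimalPeriod (f := σ) (x := D) hi hj
  apply SimpleGraph.Dart.ext
  apply Prod.ext
  · exact (iter_fst hrot D i).trans (iter_fst hrot D j).symm
  · exact h

theorem edge_chain {G : SimpleGraph V} [Fintype G.Dart] (D : G.Dart) :
    ∃ b : G.Dart → ZMod 2, (∀ d, b d.symm = b d) ∧ (∀ d, b d ≠ 0 → d = D ∨ d = D.symm) ∧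
      b D = 1 ∧ ∀ g : V → ZMod 2, ∑ d, b d * g d.fst = g D.fst + g D.snd := by
  classical
  refine ⟨fun d => (if d = D then 1 else 0) + (if d = D.symm then 1 else 0), ?_, ?_, ?_, ?_⟩
  · intro d
    have h1 : d.symm = D ↔ d = D.symm := SimpleGraph.Dart.symm_involutive.eq_iff
    have h2 : d.symm = D.symm ↔ d = D := SimpleGraph.Dart.symm_involutive.injective.eq_iff
    simp only [h1, h2]
    rw [add_comm]
  · intro d hd
    by_contra hcon
    rw [not_or] at hcon
    simp [hcon.1, hcon.2] at hd
  · have := (SimpleGraph.Dart.symm_ne D).symm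
    simp [this]
  · intro g
    simp only [add_mul, Finset.sum_add_distrib, ite_mul, one_mul, zero_mul, Finset.sum_ite_eq',
      Finset.mem_univ, if_true]
    rfl

theorem path_chain {G : SimpleGraph V} [Fintype G.Dart] (X : Set V) {x y : V}
    (h : Relation.ReflTransGen (fun p q => G.Adj p q ∧ p ∈ X ∧ q ∈ X) x y) :
    ∃ b : G.Dart → ZMod 2, (∀ d, b d.symm = b d) ∧
      (∀ d, b d ≠ 0 → d.fst ∈ X ∧ d.snd ∈ X) ∧
      ∀ g : V → ZMod 2, ∑ d, b d * g d.fst = g x + g y := by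
  have two : ∀ z : ZMod 2, z + z = 0 := by decide
  have three : ∀ z w t : ZMod 2, z + w + (w + t) = z + t := by decide
  induction h with
  | refl => exact ⟨fun _ => 0, by simp, by simp, by intro g; simp [two]⟩
  | tail _ hs ih =>
    obtain ⟨b, h1, h2, h3⟩ := ih
    obtain ⟨a, k1, k2, -, k3⟩ := edge_chain ⟨(_, _), hs.1⟩
    refine ⟨fun d => b d + a d, fun d => by simp only [h1, k1], fun d hd => ?_, fun g => ?_⟩
    · by_cases hb : b d = 0
      · rcases k2 d (by intro h0; simp [hb, h0] at hd) with rfl | rfl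
        · exact hs.2
        · exact hs.2.symm
      · exact h2 d hb
    · simp only [add_mul, Finset.sum_add_distrib, h3, k3, three]

theorem jordan_s5 [Fintype V] {G : SimpleGraph V} (σ : Equiv.Perm G.Dart) (hconn : G.Connected)
    (hrot : IsRotationSystem G σ)
    (heuler : Fintype.card V + numFaces σ = Nat.card G.edgeSet + 2)
    (D : G.Dart) (i j k : ℕ) (hi : 0 < i) (hij : i < j) (hjk : j < k)
    (hk : k < Function.minimalPeriod σ D) (X Y : Set V) (hXY : ∀ z ∈ X, z ∉ Y)
    (huX : D.fst ∉ X) (huY : D.fst ∉ Y)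
    (hX0 : D.snd ∈ X) (hXj : (σ^[j] D).snd ∈ X)
    (hYi : (σ^[i] D).snd ∈ Y)
    (hX : Relation.ReflTransGen (fun p q => G.Adj p q ∧ p ∈ X ∧ q ∈ X) D.snd (σ^[j] D).snd)
    (hY : Relation.ReflTransGen (fun p q => G.Adj p q ∧ p ∈ Y ∧ q ∈ Y)
      (σ^[i] D).snd (σ^[k] D).snd) : False := by
  classical
  obtain ⟨b, h1, h2, h3⟩ := path_chain X hX
  obtain ⟨a, k1, k2, kD, k3⟩ := edge_chain D
  obtain ⟨a', l1, l2, lD, l3⟩ := edge_chain (σ^[j] D)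
  have four : ∀ z w t : ZMod 2, w + t + (z + w) + (z + t) = 0 := by decide
  obtain ⟨f, f1, f2⟩ := homology σ hconn hrot heuler (fun d => b d + a d + a' d)
    (fun d => by simp only [h1, k1, l1])
    (fun g => by
      simp only [add_mul, Finset.sum_add_distrib, h3, k3, l3, iter_fst hrot, four])
  have fst := iter_fst hrot D
  have inj := fun {x y : ℕ} => rot_inj (i := x) (j := y) hrot D
  -- values of the chain
  have hsupp : ∀ d : G.Dart, b d + a d + a' d ≠ 0 → d.fst ∉ Y ∧ d.snd ∉ Y := by
    intro d hd
    by_cases hb : b d = 0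
    · by_cases ha : a d = 0
      · rcases l2 d (by intro h0; simp [hb, ha, h0] at hd) with rfl | rfl
        · exact ⟨by rw [fst]; exact huY, hXY _ hXj⟩
        · exact ⟨hXY _ hXj, by
            change (σ^[j] D).fst ∉ Y
            rw [fst]; exact huY⟩
      · rcases k2 d ha with rfl | rfl
        · exact ⟨huY, hXY _ hX0⟩
        · exact ⟨hXY _ hX0, huY⟩
    · exact ⟨hXY _ (h2 d hb).1, hXY _ (h2 d hb).2⟩
  have hfσ : ∀ d, f (σ d) = f d + (b d + a d + a' d) := by
    intro d
    have e1 := f1 d.symm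
    rw [facePerm_apply, SimpleGraph.Dart.symm_symm] at e1
    have e2 := f2 d
    have : ∀ z w t : ZMod 2, z + w = t → w = z + t := by decide
    rw [e1]; exact this _ _ _ e2
  have hbu : ∀ n, b (σ^[n] D) = 0 := by
    intro n
    by_contra hb
    have := (h2 _ hb).1
    rw [fst] at this
    exact huX this
  have haux : ∀ m n, m < Function.minimalPeriod σ D → n < Function.minimalPeriod σ D → n ≠ m →
      ∀ e : G.Dart → ZMod 2, (∀ d, e d ≠ 0 → d = σ^[m] D ∨ d = (σ^[m] D).symm) →
      e (σ^[n] D) = 0 := by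
    intro m n hm hn hnm e he
    by_contra h0
    rcases he _ h0 with h | h
    · exact hnm (inj hn hm (by rw [h]))
    · have h' := congrArg (fun d : G.Dart => d.fst) h
      have h'' : (σ^[n] D).fst = (σ^[m] D).snd := h'
      rw [fst, ← fst m] at h''
      exact (σ^[m] D).adj.ne h''
  have hz : ∀ n < Function.minimalPeriod σ D, n ≠ 0 → n ≠ j → f (σ^[n+1] D) = f (σ^[n] D) := by
    intro n hn n0 nj
    rw [Function.iterate_succ_apply', hfσ, hbu,
      haux 0 n (period_pos σ D) hn n0 a k2, haux j n (by omega) hn nj a' l2]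
    simp
  have hrun1 : ∀ n, 1 ≤ n → n ≤ j → f (σ^[n] D) = f (σ^[1] D) := by
    intro n hn
    induction n, hn using Nat.le_induction with
    | base => intro _; rfl
    | succ n hn ih => intro h; rw [hz n (by omega) (by omega) (by omega), ih (by omega)]
  have hrun2 : ∀ n, j + 1 ≤ n → n ≤ k → f (σ^[n] D) = f (σ^[j+1] D) := by
    intro n hn
    induction n, hn using Nat.le_induction with
    | base => intro _; rfl
    | succ n hn ih => intro h; rw [hz n (by omega) (by omega) (by omega), ih (by omega)]
  have hjump : f (σ^[j+1] D) = f (σ^[j] D) + 1 := by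
    rw [Function.iterate_succ_apply', hfσ, hbu,
      haux 0 j (period_pos σ D) (by omega) (by omega) a k2, lD]
    simp
  have hne : f (σ^[k] D) ≠ f (σ^[i] D) := by
    rw [hrun2 k (by omega) le_rfl, hjump, hrun1 j (by omega) le_rfl, hrun1 i (by omega) (by omega)]
    have : ∀ z : ZMod 2, z + 1 ≠ z := by decide
    exact this _
  -- propagation along Y
  have hsymm : ∀ d : G.Dart, d.fst ∈ Y ∨ d.snd ∈ Y → f d = f d.symm := by
    intro d hd
    have h0 : b d + a d + a' d = 0 := by
      by_contra h0
      have := hsupp d h0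
      tauto
    have := f2 d
    simp only [h0] at this
    have h4 : ∀ z w : ZMod 2, z + w = 0 → z = w := by decide
    exact h4 _ _ this
  have hvert : ∀ d e : G.Dart, d.fst = e.fst → d.fst ∈ Y → f d = f e := by
    intro d e hde hd
    obtain ⟨n, rfl⟩ := (hrot.orbit_eq d e hde).exists_nat_pow_eq
    clear hde
    rw [Equiv.Perm.coe_pow]
    induction n with
    | zero => rfl
    | succ n ih =>
      rw [Function.iterate_succ_apply', hfσ, ← ih]
      have h0 : b (σ^[n] d) + a (σ^[n] d) + a' (σ^[n] d) = 0 := by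
        by_contra h0
        exact (hsupp _ h0).1 (by rw [iter_fst hrot]; exact hd)
      rw [h0, add_zero]
  have hprop : ∀ d e : G.Dart, d.fst = (σ^[i] D).snd → e.fst = (σ^[k] D).snd →
      e.fst ∈ Y ∧ f d = f e := by
    intro d e hd he
    generalize (σ^[k] D).snd = z at hY he
    induction hY generalizing e with
    | refl => exact ⟨by rw [he]; exact hYi, hvert d e (hd.trans he.symm) (by rw [hd]; exact hYi)⟩
    | tail _ hs ih =>
      have := ih ⟨(_, _), hs.1⟩ rfl
      refine ⟨by rw [he]; exact hs.2.2, ?_⟩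
      rw [this.2, hsymm _ (Or.inl this.1)]
      exact hvert _ _ he.symm hs.2.2
  have := hprop (σ^[i] D).symm (σ^[k] D).symm rfl rfl
  rw [← hsymm _ (Or.inr hYi), ← hsymm _ (Or.inr this.1)] at this
  exact hne this.2.symm

/-- `S` induces a 4-colorable subgraph. -/
def ColOn (G : SimpleGraph V) (S : Set V) : Prop :=
  ∃ c : V → Fin 4, ∀ x ∈ S, ∀ y ∈ S, G.Adj x y → c x ≠ c y

theorem kempe_swap_s5 {G : SimpleGraph V} {S : Set V} {u : V} (hu : u ∉ S) (c : V → Fin 4)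
    (hc : ∀ x ∈ S, ∀ y ∈ S, G.Adj x y → c x ≠ c y) (α γ : Fin 4) (x : V) (hxS : x ∈ S)
    (hx : c x = α) (hα : ∀ y ∈ S, G.Adj u y → c y = α → y = x)
    (hγ : ∀ y ∈ S, G.Adj u y → c y = γ → ¬ Relation.ReflTransGen
      (fun p q => G.Adj p q ∧ p ∈ {z | z ∈ S ∧ (c z = α ∨ c z = γ)} ∧
        q ∈ {z | z ∈ S ∧ (c z = α ∨ c z = γ)}) x y) : ColOn G (insert u S) := by
  classical
  set X := {z | z ∈ S ∧ (c z = α ∨ c z = γ)} with hXdef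
  set A := fun y => Relation.ReflTransGen (fun p q => G.Adj p q ∧ p ∈ X ∧ q ∈ X) x y with hA
  have hAX : ∀ y, A y → y ∈ X := by
    intro y hy
    cases hy with
    | refl => exact ⟨hxS, Or.inl hx⟩
    | tail _ h => exact h.2.2
  let c' : V → Fin 4 := fun p => if p = u then α else
    if A p then Equiv.swap α γ (c p) else c p
  have hmix : ∀ p ∈ S, ∀ q ∈ S, G.Adj p q → A p → ¬ A q → Equiv.swap α γ (c p) ≠ c q := by
    intro p _ q hq hpq hp hnq heq
    have hqX : q ∉ X := fun hqX => hnq (hp.tail ⟨hpq, hAX p hp, hqX⟩)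
    apply hqX
    refine ⟨hq, ?_⟩
    rcases (hAX p hp).2 with h | h
    · rw [h, Equiv.swap_apply_left] at heq; exact Or.inr heq.symm
    · rw [h, Equiv.swap_apply_right] at heq; exact Or.inl heq.symm
  have hun : ∀ y ∈ S, G.Adj u y → α ≠ c' y := by
    intro y hy huy heq
    have hyu : y ≠ u := fun h => hu (h ▸ hy)
    simp only [c', hyu, if_false] at heq
    split_ifs at heq with hAy
    · have : c y = γ := by
        have := congrArg (Equiv.swap α γ) heq
        rw [Equiv.swap_apply_left, Equiv.swap_apply_self] at this
        exact this.symm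
      exact hγ y hy huy this hAy
    · have := hα y hy huy heq.symm
      exact hAy (this ▸ Relation.ReflTransGen.refl)
  have hcu : c' u = α := by simp [c']
  refine ⟨c', ?_⟩
  rintro p (rfl | hp) q (rfl | hq) hpq
  · exact absurd hpq (G.irrefl)
  · rw [hcu]; exact hun q hq hpq
  · rw [hcu]; exact (hun p hp hpq.symm).symm
  · have hpu : p ≠ u := fun h => hu (h ▸ hp)
    have hqu : q ≠ u := fun h => hu (h ▸ hq)
    simp only [c', hpu, hqu, if_false]
    split_ifs with h1 h2 h2
    · exact fun h => hc p hp q hq hpq ((Equiv.swap α γ).injective h)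
    · exact hmix p hp q hq hpq h1 h2
    · exact (hmix q hq p hp hpq.symm h2 h1).symm
    · exact hc p hp q hq hpq

theorem extend [Fintype V] {G : SimpleGraph V} (σ : Equiv.Perm G.Dart) (hconn : G.Connected)
    (hrot : IsRotationSystem G σ)
    (heuler : Fintype.card V + numFaces σ = Nat.card G.edgeSet + 2)
    {S : Set V} {u : V} (hu : u ∉ S) (hcard : (G.neighborSet u ∩ S).ncard ≤ 4)
    (hS : ColOn G S) : ColOn G (insert u S) := by
  classical
  obtain ⟨c, hc⟩ := hS
  by_cases hall : ∀ k : Fin 4, ∃ y, y ∈ G.neighborSet u ∩ S ∧ c y = k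
  swap
  · push Not at hall
    obtain ⟨k, hk⟩ := hall
    refine ⟨fun p => if p = u then k else c p, ?_⟩
    rintro p (rfl | hp) q (rfl | hq) hpq
    · exact absurd hpq (G.irrefl)
    · have hqu : q ≠ p := fun h => hu (h ▸ hq)
      simp only [hqu, if_true, if_false]
      exact (hk q ⟨hpq, hq⟩).symm
    · have hpu : p ≠ q := fun h => hu (h ▸ hp)
      simp only [hpu, if_true, if_false]
      exact hk p ⟨hpq.symm, hp⟩
    · have hpu : p ≠ u := fun h => hu (h ▸ hp)
      have hqu : q ≠ u := fun h => hu (h ▸ hq)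
      simp only [hpu, hqu, if_false]
      exact hc p hp q hq hpq
  choose n hn hcn using hall
  have hninj : Function.Injective n := fun a b h => by rw [← hcn a, ← hcn b, h]
  have hrange : Set.range n = G.neighborSet u ∩ S := by
    apply Set.eq_of_subset_of_ncard_le
    · rintro _ ⟨k, rfl⟩; exact hn k
    · rw [← Set.image_univ, Set.ncard_image_of_injective _ hninj]
      simpa using hcard
    · exact Set.toFinite _
  have huniq : ∀ y ∈ S, G.Adj u y → y = n (c y) := by
    intro y hy huy
    have : y ∈ Set.range n := by rw [hrange]; exact ⟨huy, hy⟩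
    obtain ⟨k, rfl⟩ := this
    rw [hcn]
  let D : G.Dart := ⟨(u, n 0), (hn 0).1⟩
  have hidx : ∀ k, ∃ i < Function.minimalPeriod σ D, (σ^[i] D).snd = n k := fun k =>
    rot_index hrot D (n k) (hn k).1
  choose I hI hIn using hidx
  have hIinj : ∀ a b, I a = I b → a = b := fun a b h => hninj (by rw [← hIn, ← hIn, h])
  have hI0 : I 0 = 0 := rot_inj hrot D (hI 0) (period_pos σ D) (hIn 0)
  have key : ∀ β γ δ : Fin 4, β ≠ 0 → β ≠ γ → δ ≠ 0 → δ ≠ γ → I β < I γ → I γ < I δ →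
      ColOn G (insert u S) := by
    intro β γ δ hβ0 hβγ hδ0 hδγ h1 h2
    by_contra hno
    have r1 : Relation.ReflTransGen
        (fun p q => G.Adj p q ∧ p ∈ {z | z ∈ S ∧ (c z = 0 ∨ c z = γ)} ∧
        q ∈ {z | z ∈ S ∧ (c z = 0 ∨ c z = γ)}) (n 0) (n γ) := by
      by_contra hr
      refine hno (kempe_swap_s5 hu c hc 0 γ (n 0) (hn 0).2 (hcn 0) ?_ ?_)
      · intro y hy huy h; rw [huniq y hy huy, h]
      · intro y hy huy h; rw [huniq y hy huy, h]; exact hr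
    have r2 : Relation.ReflTransGen
        (fun p q => G.Adj p q ∧ p ∈ {z | z ∈ S ∧ (c z = β ∨ c z = δ)} ∧
        q ∈ {z | z ∈ S ∧ (c z = β ∨ c z = δ)}) (n β) (n δ) := by
      by_contra hr
      refine hno (kempe_swap_s5 hu c hc β δ (n β) (hn β).2 (hcn β) ?_ ?_)
      · intro y hy huy h; rw [huniq y hy huy, h]
      · intro y hy huy h; rw [huniq y hy huy, h]; exact hr
    rw [← hIn γ] at r1
    rw [← hIn β, ← hIn δ] at r2
    have hβpos : 0 < I β := Nat.pos_of_ne_zero fun h => hβ0 (hIinj _ _ (h.trans hI0.symm))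
    refine jordan_s5 σ hconn hrot heuler D (I β) (I γ) (I δ) hβpos h1 h2 (hI δ) _ _ ?_ ?_ ?_ ?_ ?_ ?_ r1 r2
    · rintro z ⟨_, hz⟩ ⟨_, hz'⟩
      grind
    · exact fun h => hu h.1
    · exact fun h => hu h.1
    · exact ⟨(hn 0).2, Or.inl (hcn 0)⟩
    · rw [hIn]; exact ⟨(hn γ).2, Or.inr (hcn γ)⟩
    · rw [hIn]; exact ⟨(hn β).2, Or.inl (hcn β)⟩
  have n12 : I 1 ≠ I 2 := fun h => absurd (hIinj _ _ h) (by decide)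
  have n13 : I 1 ≠ I 3 := fun h => absurd (hIinj _ _ h) (by decide)
  have n23 : I 2 ≠ I 3 := fun h => absurd (hIinj _ _ h) (by decide)
  rcases lt_or_gt_of_ne n12 with a | a <;> rcases lt_or_gt_of_ne n13 with b | b <;>
    rcases lt_or_gt_of_ne n23 with d | d
  · exact key 1 2 3 (by decide) (by decide) (by decide) (by decide) a d
  · exact key 1 3 2 (by decide) (by decide) (by decide) (by decide) b d
  · omega
  · exact key 3 1 2 (by decide) (by decide) (by decide) (by decide) b a
  · exact key 2 1 3 (by decide) (by decide) (by decide) (by decide) a b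
  · omega
  · exact key 2 3 1 (by decide) (by decide) (by decide) (by decide) d b
  · exact key 3 2 1 (by decide) (by decide) (by decide) (by decide) d a

theorem rot_adj [Fintype V] {G : SimpleGraph V} {σ : Equiv.Perm G.Dart}
    (hT : IsPlaneTriangulation G σ) (D : G.Dart) : G.Adj (σ D).snd D.snd := by
  classical
  set d := D.symm with hd
  have hp : Function.minimalPeriod (facePerm σ) d = 3 := by
    rw [← hT.face_size_eq d, faceSize]
    set p := Function.minimalPeriod (facePerm σ) d with hpdef
    have hpos : 0 < p := Function.minimalPeriod_pos_of_mem_periodicPts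
      ((facePerm σ).injective.mem_periodicPts d)
    let F : Fin p → {e : G.Dart // (facePerm σ).SameCycle d e} := fun i =>
      ⟨(facePerm σ)^[i.1] d, ⟨(i.1 : ℤ), by rw [zpow_natCast, Equiv.Perm.coe_pow]⟩⟩
    have hF : Function.Bijective F := by
      constructor
      · intro i j hij
        exact Fin.ext (Function.iterate_injOn_Iio_minimalPeriod (f := facePerm σ) (x := d) i.2 j.2
          (congrArg Subtype.val hij))
      · rintro ⟨e, he⟩
        obtain ⟨i, hi⟩ := he.exists_nat_pow_eq
        refine ⟨⟨i % p, Nat.mod_lt _ hpos⟩, Subtype.ext ?_⟩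
        change (facePerm σ)^[i % p] d = e
        rw [Function.iterate_mod_minimalPeriod_eq, ← Equiv.Perm.coe_pow, hi]
    rw [← Nat.card_eq_of_bijective F hF, Nat.card_fin]
  have h3 : (facePerm σ)^[3] d = d := by
    rw [← hp]; exact Function.iterate_minimalPeriod
  have h3' : σ (σ (σ D).symm).symm = d := h3
  have e1 : (σ (σ D).symm).fst = (σ D).snd := hT.rot.fst_eq _
  have e2 : (σ (σ D).symm).snd = D.snd := by
    have := hT.rot.fst_eq (σ (σ D).symm).symm
    rw [h3'] at this
    exact this.symm
  rw [← e1, ← e2]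
  exact (σ (σ D).symm).adj

theorem finish {G : SimpleGraph V} (W K O : Set V)
    (c : {x : V // x ∉ W} → Fin 5) (hK : ∀ x, x ∈ K ↔ ∃ hx : x ∉ W, c ⟨x, hx⟩ = 4)
    (hOW : O ⊆ W) (hO : O.Subsingleton)
    (hc : ∀ u w : {x : V // x ∉ W}, G.Adj u.1 w.1 → c u ≠ c w)
    (hOK : ∀ u ∈ O, ∀ z ∈ K, ¬ G.Adj u z) (hcol : ColOn G (K ∪ O)ᶜ) :
    ∃ c' : V → Fin 5, Proper5 G c' ∧
      (∀ (x : V) (hx : x ∉ W), (c' x = 4 ↔ c ⟨x, hx⟩ = 4)) ∧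
      ({x : V | x ∈ W ∧ c' x = 4} : Set V).Subsingleton := by
  classical
  obtain ⟨k, hk⟩ := hcol
  let c' : V → Fin 5 := fun x => if x ∈ K ∪ O then 4 else (k x).castSucc
  have h4 : ∀ x, c' x = 4 ↔ x ∈ K ∪ O := by
    intro x
    by_cases h : x ∈ K ∪ O
    · simp only [c', h, if_true]
    · simp only [c', h, if_false, iff_false]
      exact Fin.castSucc_ne_last (k x)
  have hind : ∀ x ∈ K ∪ O, ∀ y ∈ K ∪ O, ¬ G.Adj x y := by
    rintro x (hx | hx) y (hy | hy) hxy
    · obtain ⟨h1, h2⟩ := (hK x).1 hx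
      obtain ⟨h3, h4⟩ := (hK y).1 hy
      exact hc ⟨x, h1⟩ ⟨y, h3⟩ hxy (h2.trans h4.symm)
    · exact hOK y hy x hx hxy.symm
    · exact hOK x hx y hy hxy
    · exact hxy.ne (hO hx hy)
  refine ⟨c', ?_, ?_, ?_⟩
  · intro x y hxy heq
    by_cases hx : x ∈ K ∪ O
    · exact hind x hx y ((h4 y).1 (heq ▸ (h4 x).2 hx)) hxy
    · by_cases hy : y ∈ K ∪ O
      · exact hx ((h4 x).1 (heq.trans ((h4 y).2 hy)))
      · simp only [c', hx, hy, if_false] at heq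
        exact hk x hx y hy hxy (Fin.castSucc_injective _ heq)
  · intro x hx
    rw [h4]
    constructor
    · rintro (h | h)
      · exact ((hK x).1 h).2
      · exact absurd (hOW h) hx
    · intro h; exact Or.inl ((hK x).2 ⟨hx, h⟩)
  · have hsub : ∀ x, x ∈ W → c' x = 4 → x ∈ O := by
      intro x hx h
      rcases (h4 x).1 h with h | h
      · exact absurd hx ((hK x).1 h).1
      · exact h
    rintro x ⟨hx, hx'⟩ y ⟨hy, hy'⟩
    exact hO (hsub x hx hx') (hsub y hy hy')

theorem statement5 [Fintype V] [DecidableEq V] (G : SimpleGraph V) (σ : Equiv.Perm G.Dart)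
    (hT : IsPlaneTriangulation G σ) (d : ℕ) (hd : 8 ≤ d) (v : V) (hv : deg G v = d)
    (U : Finset V) (hUnbr : ∀ u ∈ U, G.Adj v u) (hUcard : U.card = d - 3)
    (hU5 : ∀ u ∈ U, deg G u = 5)
    (c : {x : V // x ∉ (insert v (U : Set V))} → Fin 5)
    (hc : ∀ u w : {x : V // x ∉ (insert v (U : Set V))}, G.Adj u.1 w.1 → c u ≠ c w) :
    ∃ c' : V → Fin 5, Proper5 G c' ∧
      (∀ (x : V) (hx : x ∉ (insert v (U : Set V))), (c' x = 4 ↔ c ⟨x, hx⟩ = 4)) ∧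
      ({x : V | x ∈ (insert v (U : Set V)) ∧ c' x = 4} : Set V).Subsingleton := by
  classical
  let W : Set V := insert v (U : Set V)
  let K : Set V := {x | ∃ hx : x ∉ W, c ⟨x, hx⟩ = 4}
  have hKdef : ∀ x, x ∈ K ↔ ∃ hx : x ∉ W, c ⟨x, hx⟩ = 4 := fun x => Iff.rfl
  have hKW : ∀ x ∈ K, x ∉ W := fun x hx => hx.1
  have hvW : v ∈ W := Set.mem_insert _ _
  have hUW : ∀ u ∈ U, u ∈ W := fun u hu => Set.mem_insert_of_mem _ hu
  have hvU : v ∉ U := fun h => (hUnbr v h).ne rfl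
  let S0 : Set V := {x | x ∉ W ∧ x ∉ K}
  have hext := fun {S : Set V} {u : V} => extend (S := S) (u := u) σ hT.connected hT.rot hT.euler
  -- the graph outside is 4-colored
  have hS0 : ColOn G S0 := by
    have hdec : ∀ a b : Fin 5, a ≠ 4 → b ≠ 4 → Fin.ofNat 4 a.val = Fin.ofNat 4 b.val → a = b := by
      decide
    refine ⟨fun x => if hx : x ∉ W then Fin.ofNat 4 (c ⟨x, hx⟩).val else 0, ?_⟩
    rintro x ⟨hx, hxK⟩ y ⟨hy, hyK⟩ hxy heq
    simp only [hx, hy, not_false_eq_true, dif_pos] at heq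
    exact hc ⟨x, hx⟩ ⟨y, hy⟩ hxy (hdec _ _ (fun h => hxK ⟨hx, h⟩) (fun h => hyK ⟨hy, h⟩) heq)
  have hdeg : ∀ u ∈ U, ∀ S : Set V, ∀ z, G.Adj u z → z ∉ S →
      (G.neighborSet u ∩ S).ncard ≤ 4 := by
    intro u hu S z huz hz
    have h5 : (G.neighborSet u).ncard = 5 := hU5 u hu
    have h1 : (G.neighborSet u \ {z}).ncard = 4 := by
      rw [Set.ncard_sdiff_singleton_of_mem (show z ∈ G.neighborSet u from huz), h5]
    rw [← h1]
    apply Set.ncard_le_ncard _ (Set.toFinite _)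
    rintro y ⟨hy, hyS⟩
    exact ⟨hy, fun h => hz (h ▸ hyS)⟩
  by_cases hcase : ∃ a, G.Adj v a ∧ a ∈ K
  swap
  · -- give v the color 4
    push Not at hcase
    have hT' : ∀ T : Finset V, T ⊆ U → ColOn G (S0 ∪ (T : Set V)) := by
      intro T
      induction T using Finset.induction_on with
      | empty => intro _; simpa using hS0
      | insert u T huT ih =>
        intro hsub
        have huU : u ∈ U := hsub (Finset.mem_insert_self _ _)
        have hTU : T ⊆ U := fun x hx => hsub (Finset.mem_insert_of_mem hx)
        rw [Finset.coe_insert, Set.union_insert]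
        refine hext ?_ (hdeg u huU _ v (hUnbr u huU).symm ?_) (ih hTU)
        · rintro (h | h)
          · exact h.1 (hUW u huU)
          · exact huT h
        · rintro (h | h)
          · exact h.1 hvW
          · exact hvU (hTU h)
    refine finish W K {v} c hKdef (by simpa using hvW) Set.subsingleton_singleton hc ?_ ?_
    · rintro u rfl z hz h
      exact hcase z h hz
    · convert hT' U subset_rfl using 1
      ext x
      simp only [Set.mem_compl_iff, Set.mem_union, Set.mem_singleton_iff, S0, Set.mem_ofPred_eq,
        Finset.mem_coe]
      constructor
      · intro h
        by_cases hxU : x ∈ U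
        · exact Or.inr hxU
        · refine Or.inl ⟨?_, fun h' => h (Or.inl h')⟩
          rintro (h' | h')
          · exact h (Or.inr h')
          · exact hxU h'
      · rintro (⟨h1, h2⟩ | h1) (h3 | h3)
        · exact h2 h3
        · exact h1 (h3 ▸ hvW)
        · exact hKW x h3 (hUW x h1)
        · exact hvU (h3 ▸ h1)
  · obtain ⟨a, hva, haK⟩ := hcase
    have haU : a ∉ U := fun h => hKW a haK (hUW a h)
    -- the three outside neighbors
    let B : Set V := G.neighborSet v \ (U : Set V)
    have hBcard : B.ncard = 3 := by
      have h1 : (G.neighborSet v).ncard = d := hv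
      have h2 : (U : Set V) ⊆ G.neighborSet v := fun u hu => hUnbr u hu
      have h3 := Set.ncard_sdiff h2 (Set.toFinite _)
      rw [h1, Set.ncard_coe_finset, hUcard] at h3
      change B.ncard = _ at h3
      omega
    have haB : a ∈ B := ⟨hva, haU⟩
    have hB2 : (B \ {a}).ncard = 2 := by
      rw [Set.ncard_sdiff_singleton_of_mem haB, hBcard]
    obtain ⟨x, y, hxy, hBxy⟩ := Set.ncard_eq_two.1 hB2
    have hxB : x ∈ B \ {a} := by rw [hBxy]; simp
    have hyB : y ∈ B \ {a} := by rw [hBxy]; simp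
    let D : G.Dart := ⟨(v, a), hva⟩
    set p := Function.minimalPeriod σ D with hp
    let w : ℕ → V := fun i => (σ^[i] D).snd
    have hw0 : w 0 = a := rfl
    have hwp : w p = a := by
      change (σ^[p] D).snd = a
      rw [hp, Function.iterate_minimalPeriod]
    have hwadj : ∀ i, G.Adj (w (i+1)) (w i) := by
      intro i
      change G.Adj (σ^[i+1] D).snd (σ^[i] D).snd
      rw [Function.iterate_succ_apply']
      exact rot_adj hT _
    have hwv : ∀ i, G.Adj v (w i) := by
      intro i
      have := (σ^[i] D).adj
      rw [iter_fst hT.rot D i] at this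
      exact this
    have hjk : ∃ j k, j < k ∧ k < p ∧ w j ∉ U ∧ w k ∉ U ∧
        ∀ i < p, i ≠ 0 → i ≠ j → i ≠ k → w i ∈ U := by
      obtain ⟨j, hj, hwj⟩ := rot_index hT.rot D x hxB.1.1
      obtain ⟨k, hk, hwk⟩ := rot_index hT.rot D y hyB.1.1
      have hjk : j ≠ k := by rintro rfl; exact hxy (hwj.symm.trans hwk)
      have hrest : ∀ i < p, i ≠ 0 → i ≠ j → i ≠ k → w i ∈ U := by
        intro i hi h0 h1 h2
        by_contra hiU
        have hne : w i ≠ a := fun h => h0 (rot_inj hT.rot D hi (period_pos σ D) h)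
        have : w i ∈ B \ {a} := ⟨⟨hwv i, hiU⟩, hne⟩
        rw [hBxy] at this
        rcases this with h | h
        · exact h1 (rot_inj hT.rot D hi hj (h.trans hwj.symm))
        · exact h2 (rot_inj hT.rot D hi hk (h.trans hwk.symm))
      have hjU : w j ∉ U := by change (σ^[j] D).snd ∉ U; rw [hwj]; exact hxB.1.2
      have hkU : w k ∉ U := by change (σ^[k] D).snd ∉ U; rw [hwk]; exact hyB.1.2
      rcases lt_or_gt_of_ne hjk with h | h
      · exact ⟨j, k, h, hk, hjU, hkU, hrest⟩
      · exact ⟨k, j, h, hj, hkU, hjU, fun i hi h0 h1 h2 => hrest i hi h0 h2 h1⟩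
    obtain ⟨j, k, hjk, hkp, hjU, hkU, hrest⟩ := hjk
    let O : Set V := {z | j + 1 < k ∧ z = w (j+1)}
    have hOU : ∀ z ∈ O, z ∈ U := by
      rintro z ⟨h, rfl⟩
      exact hrest _ (by omega) (by omega) (by omega) (by omega)
    have hOsub : O.Subsingleton := by
      rintro z ⟨_, rfl⟩ z' ⟨_, rfl⟩; rfl
    have hbase : ColOn G (insert v S0) := by
      refine hext (fun h => h.1 hvW) ?_ hS0
      have : (G.neighborSet v ∩ S0).ncard ≤ B.ncard := by
        apply Set.ncard_le_ncard _ (Set.toFinite _)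
        rintro z ⟨hz, hz'⟩
        exact ⟨hz, fun h => hz'.1 (hUW z h)⟩
      omega
    -- adding the vertices of U
    have hgrow : ∀ n, ∀ R : Set V, K ⊆ R → O ⊆ R → (∀ z ∈ R, z ∈ K ∨ z ∈ U) →
        ((U : Set V) \ R).ncard = n → ColOn G Rᶜ := by
      intro n
      induction n with
      | zero =>
        intro R hKR hOR hRU hn
        rw [Set.ncard_eq_zero (Set.toFinite _), Set.sdiff_eq_empty] at hn
        convert hbase using 1
        ext z
        simp only [Set.mem_compl_iff, Set.mem_insert_iff, S0, Set.mem_ofPred_eq]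
        constructor
        · intro hz
          by_cases hzv : z = v
          · exact Or.inl hzv
          · refine Or.inr ⟨?_, fun h => hz (hKR h)⟩
            rintro (h | h)
            · exact hzv h
            · exact hz (hn h)
        · rintro (rfl | ⟨h1, h2⟩) h
          · rcases hRU _ h with h | h
            · exact hKW _ h hvW
            · exact hvU h
          · rcases hRU _ h with h | h
            · exact h2 h
            · exact h1 (hUW z h)
      | succ n ih =>
        intro R hKR hOR hRU hn
        by_cases hstuck : ∃ u ∈ U, u ∉ R ∧ ∃ z ∈ R, G.Adj u z
        · obtain ⟨u, huU, huR, z, hzR, huz⟩ := hstuck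
          have hI := ih (insert u R) (hKR.trans (Set.subset_insert _ _))
            (hOR.trans (Set.subset_insert _ _))
            (by
              rintro z (rfl | hz)
              · exact Or.inr huU
              · exact hRU z hz)
            (by
              have h1 : (U : Set V) \ insert u R = ((U : Set V) \ R) \ {u} := by
                ext t; simp only [Set.mem_sdiff, Set.mem_insert_iff, Set.mem_singleton_iff]; tauto
              rw [h1, Set.ncard_sdiff_singleton_of_mem (show u ∈ (U : Set V) \ R from ⟨huU, huR⟩), hn]
              rfl)
          have h2 : Rᶜ = insert u (insert u R)ᶜ := by
            ext t
            simp only [Set.mem_compl_iff, Set.mem_insert_iff]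
            constructor
            · tauto
            · rintro (rfl | h)
              · exact huR
              · tauto
          rw [h2]
          refine hext (fun h => h (Set.mem_insert _ _)) ?_ hI
          exact hdeg u huU _ z huz (fun h => h (Set.mem_insert_of_mem _ hzR))
        · exfalso
          push Not at hstuck
          have hcl : ∀ u ∈ U, ∀ z ∈ R, G.Adj u z → u ∈ R := by
            intro u hu z hz huz
            by_contra h
            exact hstuck u hu h z hz huz
          have haR : a ∈ R := hKR haK
          have s1 : ∀ i, i = 0 ∨ i < j → w i ∈ R := by
            intro i
            induction i with
            | zero => intro _; exact haR
            | succ i ih' =>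
              intro hi
              exact hcl _ (hrest _ (by omega) (by omega) (by omega) (by omega)) _
                (ih' (by omega)) (hwadj i)
          have s2 : ∀ i, j + 1 ≤ i → i < k → w i ∈ R := by
            intro i hi
            induction i, hi using Nat.le_induction with
            | base => intro h; exact hOR ⟨h, rfl⟩
            | succ i hi ih' =>
              intro h
              exact hcl _ (hrest _ (by omega) (by omega) (by omega) (by omega)) _
                (ih' (by omega)) (hwadj i)
          have s3 : ∀ m, k < p - m → w (p - m) ∈ R := by
            intro m
            induction m with
            | zero => intro _; rw [Nat.sub_zero, hwp]; exact haR
            | succ m ih' =>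
              intro h
              have h1 := hwadj (p - (m+1))
              have h2 : p - (m + 1) + 1 = p - m := by omega
              rw [h2] at h1
              exact hcl _ (hrest _ (by omega) (by omega) (by omega) (by omega)) _
                (ih' (by omega)) h1.symm
          have hsub : (U : Set V) ⊆ R := by
            intro u hu
            obtain ⟨i, hi, hwi⟩ := rot_index hT.rot D u (hUnbr u hu)
            change w i = u at hwi
            subst hwi
            have n1 : i ≠ j := by rintro rfl; exact hjU hu
            have n2 : i ≠ k := by rintro rfl; exact hkU hu
            rcases lt_or_gt_of_ne n1 with h | h
            · exact s1 i (Or.inr h)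
            · rcases lt_or_gt_of_ne n2 with h' | h'
              · exact s2 i h h'
              · have := s3 (p - i) (by omega)
                rwa [show p - (p - i) = i by omega] at this
          rw [Set.sdiff_eq_empty.2 hsub, Set.ncard_empty] at hn
          omega
    have hKO : ColOn G (K ∪ O)ᶜ := hgrow _ (K ∪ O) Set.subset_union_left Set.subset_union_right
      (by
        rintro z (h | h)
        · exact Or.inl h
        · exact Or.inr (hOU z h)) rfl
    by_cases hb : ∃ u ∈ O, ∃ z ∈ K, G.Adj u z
    · obtain ⟨u, huO, z, hzK, huz⟩ := hb
      have huK : u ∉ K := fun h => hKW u h (hUW u (hOU u huO))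
      have hcolK : ColOn G (K ∪ ∅)ᶜ := by
        have h2 : (K ∪ ∅)ᶜ = insert u (K ∪ O)ᶜ := by
          ext t
          simp only [Set.mem_compl_iff, Set.mem_insert_iff, Set.mem_union, Set.mem_empty_iff_false,
            or_false]
          constructor
          · intro h
            by_cases htO : t ∈ O
            · exact Or.inl (hOsub htO huO)
            · tauto
          · rintro (rfl | h)
            · exact huK
            · tauto
        rw [h2]
        exact hext (fun h => h (Or.inr huO))
          (hdeg u (hOU u huO) _ z huz (fun h => h (Or.inl hzK))) hKO
      exact finish W K ∅ c hKdef (Set.empty_subset _) Set.subsingleton_empty hc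
        (fun u hu => absurd hu (Set.notMem_empty u)) hcolK
    · push Not at hb
      exact finish W K O c hKdef (fun z hz => hUW z (hOU z hz)) hOsub hc hb hKO
end
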